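/- Let A be an affine algebra of Krull dimension d ≥ 4 over the algebraic closure of a finite prime field 𝔽_p, and let P be a finitely generated projective A-module of rank d − 1. Suppose s ∈ A is such that: (i) P_s is free over A_s; (ii) there exist p_1,…,p_{d−1} ∈ P and φ_1,…,φ_{d−1} ∈ Hom_A(P,A) with φ_i(p_j) = δ_{ij}·s; (iii) sP ⊆ p_1A + … + p_{d−1}A; (iv) the image of s in A_red is a non-zero-divisor; and (v) (0 : sA) = (0 : s²A). If the free module of rank d − 1 over R = A[X]/(X² − s²X) is cancellative, then P is cancellative. -/

import Mathlib

open Polynomial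

/-- A module `P` over `A` is *cancellative* if `P ⊕ Aᵐ ≅ Q ⊕ Aᵐ` implies `P ≅ Q`
for every finitely generated projective `A`-module `Q` and every `m ≥ 0`. -/
def IsCancellative (A : Type) [CommRing A] (P : Type) [AddCommGroup P] [Module A P] : Prop :=
  ∀ (Q : Type) [AddCommGroup Q] [Module A Q], Module.Finite A Q → Module.Projective A Q →
    ∀ m : ℕ, Nonempty ((P × (Fin m → A)) ≃ₗ[A] (Q × (Fin m → A))) → Nonempty (P ≃ₗ[A] Q)

/-- A module has rank `n` if its localization at every prime ideal is of rank `n`. -/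
def HasRank (A : Type) [CommRing A] (P : Type) [AddCommGroup P] [Module A P] (n : ℕ) : Prop :=
  ∀ p : PrimeSpectrum A, Module.rankAtStalk P p = n

/-- One elementary column operation of level `s` on a row vector. -/
def EStep {B ι : Type*} [CommRing B] [DecidableEq ι] (s : B) (v v' : ι → B) : Prop :=
  ∃ i j c, i ≠ j ∧ v' = Function.update v i (v i + s * c * v j)

/-- Equivalence of row vectors under elementary operations of level `s`. -/
def ElemRel {B ι : Type*} [CommRing B] [DecidableEq ι] (s : B) : (ι → B) → (ι → B) → Prop :=
  Relation.ReflTransGen (EStep s)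

section Elementary

variable {B ι : Type*} [CommRing B] [DecidableEq ι] {s : B}

theorem EStep.symm {v v' : ι → B} (h : EStep s v v') : EStep s v' v := by
  obtain ⟨i, j, c, hij, rfl⟩ := h
  refine ⟨i, j, -c, hij, ?_⟩
  simp [Function.update_of_ne hij.symm]

theorem ElemRel.refl (v : ι → B) : ElemRel s v v := Relation.ReflTransGen.refl

theorem ElemRel.of_eq {v w : ι → B} (h : v = w) : ElemRel s v w := h ▸ ElemRel.refl v

theorem ElemRel.trans {u v w : ι → B} (h : ElemRel s u v) (h' : ElemRel s v w) :
    ElemRel s u w := Relation.ReflTransGen.trans h h'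

theorem ElemRel.symm {u v : ι → B} (h : ElemRel s u v) : ElemRel s v u := by
  induction h with
  | refl => exact ElemRel.refl _
  | tail _ h ih => exact (Relation.ReflTransGen.single h.symm).trans ih

theorem ElemRel.update_mul {v : ι → B} {i j : ι} (hij : i ≠ j) (c : B) :
    ElemRel s v (Function.update v i (v i + s * c * v j)) :=
  Relation.ReflTransGen.single ⟨i, j, c, hij, rfl⟩

theorem ElemRel.update_add_of_mem {v : ι → B} {i : ι} {x : B}
    (hx : x ∈ Ideal.span (v '' {i}ᶜ)) : ElemRel s v (Function.update v i (v i + s * x)) := by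
  suffices H : ∀ y, ElemRel s (Function.update v i y) (Function.update v i (y + s * x)) by
    simpa using H (v i)
  induction hx using Submodule.span_induction with
  | mem x hx =>
    obtain ⟨j, hj, rfl⟩ := hx
    intro y
    have hj' : i ≠ j := fun h => hj h.symm
    have := ElemRel.update_mul (s := s) (v := Function.update v i y) hj' 1
    simpa [Function.update_of_ne hj'.symm] using this
  | zero => intro y; simpa using ElemRel.refl _
  | add x x' _ _ h h' =>
    intro y
    have := (h y).trans (h' _)
    rwa [add_assoc, ← mul_add] at this
  | smul c x hx _ =>
    intro y
    clear * - hx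
    induction hx using Submodule.span_induction generalizing c y with
    | mem x hx =>
      obtain ⟨j, hj, rfl⟩ := hx
      have hj' : i ≠ j := fun h => hj h.symm
      have := ElemRel.update_mul (s := s) (v := Function.update v i y) hj' c
      simpa [Function.update_of_ne hj'.symm, mul_assoc] using this
    | zero => simpa using ElemRel.refl _
    | add x x' _ _ h h' =>
      have := (h c y).trans (h' c _)
      rwa [add_assoc, ← mul_add, ← smul_add] at this
    | smul d x _ h => simpa [mul_assoc] using h (c * d) y

theorem ElemRel.update_of_sub_mem {v : ι → B} {i : ι} {x : B}
    (hx : x - v i ∈ Ideal.span (v '' {i}ᶜ)) : ElemRel 1 v (Function.update v i x) := by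
  simpa using ElemRel.update_add_of_mem (s := 1) hx

theorem ElemRel.of_sub_mem {v v' : ι → B} (i : ι) (h : ∀ j ≠ i, v' j = v j)
    (hx : v' i - v i ∈ Ideal.span (v '' {i}ᶜ)) : ElemRel 1 v v' := by
  convert ElemRel.update_of_sub_mem hx using 1
  ext j
  by_cases hj : j = i
  · subst hj; simp
  · simp [hj, h j hj]

theorem ElemRel.span_range {v v' : ι → B} (h : ElemRel s v v') :
    Ideal.span (Set.range v) = Ideal.span (Set.range v') := by
  have key : ∀ v v' : ι → B, EStep s v v' →
      Ideal.span (Set.range v') ≤ Ideal.span (Set.range v) := by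
    rintro v v' ⟨i, j, c, hij, rfl⟩
    rw [Ideal.span_le]
    rintro _ ⟨l, rfl⟩
    have hm : ∀ l, v l ∈ Ideal.span (Set.range v) := fun l => Ideal.subset_span ⟨l, rfl⟩
    by_cases hl : l = i
    · subst hl
      simpa using Ideal.add_mem _ (hm l) (Ideal.mul_mem_left _ _ (hm j))
    · simpa [hl] using hm l
  induction h with
  | refl => rfl
  | tail _ h ih => exact ih.trans (le_antisymm (key _ _ h.symm) (key _ _ h))

/-- Elementary operations lift along surjective ring homomorphisms. -/
theorem ElemRel.exists_lift {B' : Type*} [CommRing B'] {f : B →+* B'}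
    (hf : Function.Surjective f) {v : ι → B} {w' : ι → B'} (h : ElemRel (f s) (f ∘ v) w') :
    ∃ v', f ∘ v' = w' ∧ ElemRel s v v' := by
  induction h with
  | refl => exact ⟨v, rfl, ElemRel.refl _⟩
  | tail _ h ih =>
    obtain ⟨v', rfl, hv⟩ := ih
    obtain ⟨i, j, c, hij, rfl⟩ := h
    obtain ⟨c, rfl⟩ := hf c
    refine ⟨_, ?_, hv.trans (ElemRel.update_mul hij c)⟩
    ext l
    by_cases hl : l = i
    · subst hl; simp
    · simp [hl]

/-- A transvection on two slots can be realised with the help of a third slot. -/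
theorem ElemRel.transvection {v : ι → B} {i j h : ι} (hij : i ≠ j) (hih : i ≠ h) (hjh : j ≠ h)
    {r₁ r₂ q₁ q₂ : B} (hq : r₁ * q₁ + r₂ * q₂ = 0) :
    ElemRel 1 v (Function.update (Function.update v i (v i + (v i * q₁ + v j * q₂) * r₁)) j
      (v j + (v i * q₁ + v j * q₂) * r₂)) := by
  set δ := v i * q₁ + v j * q₂ with hδ
  have mem : ∀ (w : ι → B) (a b : ι), a ≠ b → w b ∈ Ideal.span (w '' {a}ᶜ) :=
    fun w a b hab => Ideal.subset_span ⟨b, hab.symm, rfl⟩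
  let U : B → B → B → ι → B := fun x y t =>
    Function.update (Function.update (Function.update v i x) j y) h t
  have Ui : ∀ x y t, U x y t i = x := fun x y t => by simp [U, hih, hij]
  have Uj : ∀ x y t, U x y t j = y := fun x y t => by simp [U, hjh]
  have Uh : ∀ x y t, U x y t h = t := fun x y t => by simp [U]
  have Uo : ∀ x y t l, l ≠ i → l ≠ j → l ≠ h → U x y t l = v l := fun x y t l h1 h2 h3 => by
    simp [U, h1, h2, h3]
  have mi : ∀ x x' y t, x' - x ∈ Ideal.span {t} → ElemRel 1 (U x y t) (U x' y t) := by
    intro x x' y t hx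
    refine ElemRel.of_sub_mem i (fun l hl => ?_) ?_
    · by_cases l = j <;> by_cases l = h <;> simp_all [U]
    · rw [Ui, Ui]
      refine (Ideal.span_le.2 ?_ : Ideal.span {t} ≤ _) hx
      rintro _ rfl
      simpa only [Uh, SetLike.mem_coe] using mem (U x y _) i h hih
  have mj : ∀ x y y' t, y' - y ∈ Ideal.span {t} → ElemRel 1 (U x y t) (U x y' t) := by
    intro x y y' t hx
    refine ElemRel.of_sub_mem j (fun l hl => ?_) ?_
    · by_cases l = i <;> by_cases l = h <;> simp_all [U]
    · rw [Uj, Uj]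
      refine (Ideal.span_le.2 ?_ : Ideal.span {t} ≤ _) hx
      rintro _ rfl
      simpa only [Uh, SetLike.mem_coe] using mem (U x y _) j h hjh
  have mh : ∀ x y t t', (∃ c d, t' - t = c * x + d * y) →
      ElemRel 1 (U x y t) (U x y t') := by
    rintro x y t t' ⟨c, d, e⟩
    refine ElemRel.of_sub_mem h (fun l hl => ?_) ?_
    · simp_all [U]
    · rw [Uh, Uh, e]
      refine Ideal.add_mem _ (Ideal.mul_mem_left _ _ ?_) (Ideal.mul_mem_left _ _ ?_)
      · simpa only [Ui] using mem (U x y t) h i hih.symm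
      · simpa only [Uj] using mem (U x y t) h j hjh.symm
  have e0 : v = U (v i) (v j) (v h) := by
    ext l
    rcases eq_or_ne l h with rfl | h1
    · rw [Uh]
    rcases eq_or_ne l j with rfl | h2
    · rw [Uj]
    rcases eq_or_ne l i with rfl | h3
    · rw [Ui]
    rw [Uo _ _ _ _ h3 h2 h1]
  have e1 : ∀ x y, Function.update (Function.update v i x) j y = U x y (v h) := by
    intro x y
    ext l
    rcases eq_or_ne l h with rfl | h1
    · simp [Uh, hih.symm, hjh.symm]
    rcases eq_or_ne l j with rfl | h2
    · simp [Uj]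
    rcases eq_or_ne l i with rfl | h3
    · simp [Ui, hij]
    simp [Uo _ _ _ _ h3 h2 h1, h2, h3]
  rw [e1]
  clear_value δ
  generalize v i = x at *
  generalize v j = y at *
  generalize v h = t at *
  nth_rewrite 1 [e0]
  refine (mh x y t (t + δ) ⟨q₁, q₂, by rw [hδ]; ring⟩).trans ?_
  refine (mi x (x + r₁ * (t + δ)) y _ ?_).trans ?_
  · exact Ideal.mem_span_singleton'.2 ⟨r₁, by ring⟩
  refine (mj _ y (y + r₂ * (t + δ)) _ ?_).trans ?_
  · exact Ideal.mem_span_singleton'.2 ⟨r₂, by ring⟩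
  refine (mh _ _ _ t ⟨-q₁, -q₂, ?_⟩).trans ?_
  · linear_combination (t + δ) * hq - hδ
  refine (mi _ (x + δ * r₁) _ _ ?_).trans ?_
  · exact Ideal.mem_span_singleton'.2 ⟨-r₁, by ring⟩
  refine (mj _ _ _ _ ?_)
  exact Ideal.mem_span_singleton'.2 ⟨-r₂, by ring⟩

end Elementary

section Lifting

variable {B ι κ : Type*} [CommRing B] [DecidableEq ι] [DecidableEq κ] [Finite κ]

/-- Elementary equivalences of a subrow modulo the ideal generated by the remaining entries lift. -/
theorem ElemRel.lift_of_quotient {e : κ → ι} (he : Function.Injective e) {v v' : ι → B}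
    {𝔡 : Ideal B} (h𝔡 : 𝔡 = Ideal.span (v '' (Set.range e)ᶜ))
    (h : ElemRel 1 (fun k => Ideal.Quotient.mk 𝔡 (v (e k)))
      (fun k => Ideal.Quotient.mk 𝔡 (v' (e k))))
    (hv : ∀ j, j ∉ Set.range e → v' j = v j) : ElemRel 1 v v' := by
  generalize hu : (fun k => Ideal.Quotient.mk 𝔡 (v (e k))) = u at h
  generalize hu' : (fun k => Ideal.Quotient.mk 𝔡 (v' (e k))) = u' at h
  induction h using Relation.ReflTransGen.head_induction_on generalizing v with
  | refl =>
    cases nonempty_fintype κ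
    have key : ∀ s : Finset κ, ElemRel 1 v (fun j => if j ∈ s.image e then v' j else v j) := by
      intro s
      induction s using Finset.induction with
      | empty => simpa using ElemRel.refl _
      | insert a s ha ih =>
        refine ih.trans (ElemRel.of_sub_mem (e a) (fun j hj => ?_) ?_)
        · simp [hj]
        · have h1 : v' (e a) - v (e a) ∈ 𝔡 := by
            rw [← Ideal.Quotient.mk_eq_mk_iff_sub_mem]
            exact congrFun (hu'.trans hu.symm) a
          have h2 : ∀ x ∈ s, e x ≠ e a := fun x hx h => ha (he h ▸ hx)
          have h3 : e a ∉ s.image e := by simpa using h2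
          simp only [h3, Finset.mem_image_of_mem e (Finset.mem_insert_self a s), if_true, if_false]
          suffices H : 𝔡 ≤ _ from H h1
          rw [h𝔡, Ideal.span_le]
          rintro _ ⟨j, hj, rfl⟩
          have h4 : j ∉ s.image e := fun h => hj (by
            obtain ⟨k, _, rfl⟩ := Finset.mem_image.1 h
            exact ⟨k, rfl⟩)
          exact Ideal.subset_span ⟨j, fun h => hj ⟨a, h.symm⟩, if_neg h4⟩
    have := key Finset.univ
    convert this using 1
    ext j
    by_cases hj : j ∈ Finset.univ.image e
    · simp only [hj, if_true]
    · rw [if_neg hj, hv]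
      simpa using hj
  | head h _ ih =>
    obtain ⟨i, j, c, hij, rfl⟩ := h
    obtain ⟨c, rfl⟩ := Ideal.Quotient.mk_surjective c
    have hij' : e i ≠ e j := fun h => hij (he h)
    refine (ElemRel.update_mul hij' c).trans (ih (v := Function.update v (e i)
      (v (e i) + 1 * c * v (e j))) ?_ ?_ ?_)
    · rw [h𝔡]
      congr 1
      refine Set.image_congr fun x hx => ?_
      rw [Function.update_of_ne]
      rintro rfl
      exact hx ⟨i, rfl⟩
    · intro l hl
      rw [hv l hl, Function.update_of_ne]
      rintro rfl
      exact hl ⟨i, rfl⟩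
    · subst hu
      ext l
      by_cases hl : l = i
      · subst hl; simp
      · have : e l ≠ e i := fun h => hl (he h)
        simp [hl, this]

end Lifting

section RowsOfLengthThree

variable {R : Type*} [CommRing R]

theorem elemRel_vec3_fst {a b c a' : R} (h : ∃ x y, a' = a + x * b + y * c) :
    ElemRel 1 ![a, b, c] ![a', b, c] := by
  obtain ⟨x, y, rfl⟩ := h
  refine ElemRel.of_sub_mem 0 (fun j hj => ?_) ?_
  · fin_cases j <;> simp_all
  · have h1 : b ∈ Ideal.span (![a, b, c] '' {0}ᶜ) := Ideal.subset_span ⟨1, by simp, rfl⟩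
    have h2 : c ∈ Ideal.span (![a, b, c] '' {0}ᶜ) := Ideal.subset_span ⟨2, by simp, rfl⟩
    convert Ideal.add_mem _ (Ideal.mul_mem_left _ x h1) (Ideal.mul_mem_left _ y h2) using 1
    simp; ring

theorem elemRel_vec3_snd {a b c b' : R} (h : ∃ x y, b' = b + x * a + y * c) :
    ElemRel 1 ![a, b, c] ![a, b', c] := by
  obtain ⟨x, y, rfl⟩ := h
  refine ElemRel.of_sub_mem 1 (fun j hj => ?_) ?_
  · fin_cases j <;> simp_all
  · have h1 : a ∈ Ideal.span (![a, b, c] '' {1}ᶜ) := Ideal.subset_span ⟨0, by simp, rfl⟩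
    have h2 : c ∈ Ideal.span (![a, b, c] '' {1}ᶜ) := Ideal.subset_span ⟨2, by simp, rfl⟩
    convert Ideal.add_mem _ (Ideal.mul_mem_left _ x h1) (Ideal.mul_mem_left _ y h2) using 1
    simp; ring

theorem elemRel_vec3_trd {a b c c' : R} (h : ∃ x y, c' = c + x * a + y * b) :
    ElemRel 1 ![a, b, c] ![a, b, c'] := by
  obtain ⟨x, y, rfl⟩ := h
  refine ElemRel.of_sub_mem 2 (fun j hj => ?_) ?_
  · fin_cases j <;> simp_all
  · have h1 : a ∈ Ideal.span (![a, b, c] '' {2}ᶜ) := Ideal.subset_span ⟨0, by simp, rfl⟩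
    have h2 : b ∈ Ideal.span (![a, b, c] '' {2}ᶜ) := Ideal.subset_span ⟨1, by simp, rfl⟩
    convert Ideal.add_mem _ (Ideal.mul_mem_left _ x h1) (Ideal.mul_mem_left _ y h2) using 1
    simp; ring

theorem elemRel_vec3_transvection {a b c q₁ q₂ r₁ r₂ b' c' : R} (hq : r₁ * q₁ + r₂ * q₂ = 0)
    (hb : ∃ x, b' = b + (b * q₁ + c * q₂) * r₁ + x * a)
    (hc : ∃ x, c' = c + (b * q₁ + c * q₂) * r₂ + x * a) :
    ElemRel 1 ![a, b, c] ![a, b', c'] := by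
  obtain ⟨x, rfl⟩ := hb
  obtain ⟨y, rfl⟩ := hc
  have := ElemRel.transvection (v := ![a, b, c]) (i := 1) (j := 2) (h := 0) (by simp) (by simp)
    (by simp) hq
  refine this.trans ?_
  refine ElemRel.trans (v := ![a, b + (b * q₁ + c * q₂) * r₁, c + (b * q₁ + c * q₂) * r₂]) ?_ ?_
  · refine ElemRel.of_eq ?_
    ext j; fin_cases j <;> simp
  · refine (elemRel_vec3_snd ⟨x, 0, ?_⟩).trans (elemRel_vec3_trd ⟨y, 0, ?_⟩) <;> ring

theorem elemRel_vec3_whitehead_snd {a b c u w : R} (hu : u * w = 1) :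
    ElemRel 1 ![a, u * b, c] ![u * a, b, c] := by
  refine (elemRel_vec3_snd (b' := u * b + (u - 1) * a) ⟨u - 1, 0, by ring⟩).trans ?_
  refine (elemRel_vec3_fst (a' := u * a + u * b) ⟨1, 0, by ring⟩).trans ?_
  refine (elemRel_vec3_snd (b' := b) ⟨w - 1, 0, ?_⟩).trans ?_
  · linear_combination (-a - b) * hu
  exact (elemRel_vec3_fst (a' := u * a) ⟨-u, 0, by ring⟩)

theorem elemRel_vec3_whitehead_trd {a b c u w : R} (hu : u * w = 1) :
    ElemRel 1 ![a, b, u * c] ![u * a, b, c] := by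
  refine (elemRel_vec3_trd (c' := u * c + (u - 1) * a) ⟨u - 1, 0, by ring⟩).trans ?_
  refine (elemRel_vec3_fst (a' := u * a + u * c) ⟨0, 1, by ring⟩).trans ?_
  refine (elemRel_vec3_trd (c' := c) ⟨w - 1, 0, ?_⟩).trans ?_
  · linear_combination (-a - c) * hu
  exact (elemRel_vec3_fst (a' := u * a) ⟨0, -u, by ring⟩)

/-- Squares of units can be removed from an entry of a unimodular row of length three. -/
theorem elemRel_vec3_sq {a b c u : R} (hu : IsUnit u) (h : Ideal.span {a, b, c} = ⊤) :
    ElemRel 1 ![a * u ^ 2, b, c] ![a, b, c] := by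
  obtain ⟨w, hw⟩ := hu.exists_right_inv
  have h1 : (1 : R) ∈ Ideal.span {a, b, c} := h ▸ trivial
  obtain ⟨x, y, hy, h1⟩ := Ideal.mem_span_insert.1 h1
  obtain ⟨y, z, rfl⟩ := Ideal.mem_span_pair.1 hy
  apply ElemRel.symm
  refine ElemRel.trans (v := ![a, b - z, c + y]) ?_ ?_
  · refine elemRel_vec3_transvection (q₁ := y) (q₂ := z) (r₁ := -z) (r₂ := y) (by ring)
      ⟨-x * z, ?_⟩ ⟨x * y, ?_⟩
    · linear_combination -z * h1
    · linear_combination y * h1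
  refine ElemRel.trans (v := ![a, u * b - z, u * c + y]) ?_ ?_
  · refine elemRel_vec3_transvection (q₁ := -c * (u - 1)) (q₂ := b * (u - 1)) (r₁ := b) (r₂ := c)
      (by ring) ⟨x * b * (u - 1), ?_⟩ ⟨x * c * (u - 1), ?_⟩
    · linear_combination b * (u - 1) * h1
    · linear_combination c * (u - 1) * h1
  refine ElemRel.trans (v := ![a, u * b, u * c]) ?_ ?_
  · refine elemRel_vec3_transvection (q₁ := -y * w) (q₂ := -z * w) (r₁ := -z) (r₂ := y)
      (by ring) ⟨x * z, ?_⟩ ⟨-x * y, ?_⟩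
    · linear_combination z * h1 - (b * y + c * z) * z * hw
    · linear_combination -y * h1 + (b * y + c * z) * y * hw
  refine (elemRel_vec3_whitehead_snd hw).trans ((elemRel_vec3_whitehead_trd hw).trans ?_)
  refine ElemRel.of_eq ?_
  rw [show u * (u * a) = a * u ^ 2 by ring]

end RowsOfLengthThree

/-- The properties of the equivalence relation on pairs `(x, y)` given by elementary equivalence of
the rows `(x, y, a₂, …, aₙ)`, where `𝔠 = (a₂, …, aₙ)` and `n ≥ 3`. -/
structure PairRel {B : Type*} [CommRing B] (𝔠 : Ideal B) (r : B → B → B → B → Prop) : Prop where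
  symm : ∀ {x y x' y'}, r x y x' y' → r x' y' x y
  trans : ∀ {x y x' y' x'' y''}, r x y x' y' → r x' y' x'' y'' → r x y x'' y''
  fst : ∀ {x x' y}, x' - x ∈ Ideal.span {y} ⊔ 𝔠 → r x y x' y
  snd : ∀ {x y y'}, y' - y ∈ Ideal.span {x} ⊔ 𝔠 → r x y x y'
  transv : ∀ {x y r₁ r₂ q₁ q₂}, r₁ * q₁ + r₂ * q₂ = 0 →
    r x y (x + (x * q₁ + y * q₂) * r₁) (y + (x * q₁ + y * q₂) * r₂)
  sq : ∀ {x y θ}, IsCoprime x θ → Ideal.span {x, y} ⊔ 𝔠 = ⊤ → r x (y * θ ^ 2) x y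

theorem ElemRel.pairRel {B ι : Type*} [CommRing B] [DecidableEq ι] (v : ι → B) {i₀ i₁ i₂ i₃ : ι}
    (hi : [i₀, i₁, i₂, i₃].Nodup) :
    PairRel (Ideal.span (v '' {i₀, i₁}ᶜ)) fun x y x' y' =>
      ElemRel 1 (Function.update (Function.update v i₀ x) i₁ y)
        (Function.update (Function.update v i₀ x') i₁ y') := by
  obtain ⟨⟨h01, h02, h03⟩, ⟨h12, h13⟩, h23⟩ :
      (i₀ ≠ i₁ ∧ i₀ ≠ i₂ ∧ i₀ ≠ i₃) ∧ (i₁ ≠ i₂ ∧ i₁ ≠ i₃) ∧ i₂ ≠ i₃ := by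
    simpa [not_or] using hi
  let U : B → B → ι → B := fun x y => Function.update (Function.update v i₀ x) i₁ y
  have U0 : ∀ x y, U x y i₀ = x := fun x y => by simp [U, h01]
  have U1 : ∀ x y, U x y i₁ = y := fun x y => by simp [U]
  have Uo : ∀ x y l, l ≠ i₀ → l ≠ i₁ → U x y l = v l := fun x y l h1 h2 => by simp [U, h1, h2]
  have U00 : ∀ x x' y, Function.update (U x y) i₀ x' = U x' y := by
    intro x x' y
    simp only [U]
    rw [Function.update_comm h01, Function.update_idem, Function.update_comm h01.symm]
  have U11 : ∀ x y y', Function.update (U x y) i₁ y' = U x y' := by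
    intro x x' y
    simp only [U, Function.update_idem]
  have hc0 : ∀ x y, Ideal.span {y} ⊔ Ideal.span (v '' {i₀, i₁}ᶜ) ≤
      Ideal.span (U x y '' {i₀}ᶜ) := by
    intro x y
    refine sup_le (Ideal.span_le.2 ?_) (Ideal.span_le.2 ?_)
    · rintro _ rfl
      exact Ideal.subset_span ⟨i₁, h01.symm, U1 _ _⟩
    · rintro _ ⟨j, hj, rfl⟩
      have hj : j ≠ i₀ ∧ j ≠ i₁ := by simpa [not_or] using hj
      exact Ideal.subset_span ⟨j, hj.1, Uo _ _ _ hj.1 hj.2⟩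
  have hc1 : ∀ x y, Ideal.span {x} ⊔ Ideal.span (v '' {i₀, i₁}ᶜ) ≤
      Ideal.span (U x y '' {i₁}ᶜ) := by
    intro x y
    refine sup_le (Ideal.span_le.2 ?_) (Ideal.span_le.2 ?_)
    · rintro _ rfl
      exact Ideal.subset_span ⟨i₀, h01, U0 _ _⟩
    · rintro _ ⟨j, hj, rfl⟩
      have hj : j ≠ i₀ ∧ j ≠ i₁ := by simpa [not_or] using hj
      exact Ideal.subset_span ⟨j, hj.2, Uo _ _ _ hj.1 hj.2⟩
  refine ⟨ElemRel.symm, ElemRel.trans, ?_, ?_, ?_, ?_⟩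
  · intro x x' y h
    change ElemRel 1 (U x y) (U x' y)
    rw [← U00 x x' y]
    refine ElemRel.update_of_sub_mem ?_
    rw [U0]
    exact hc0 _ _ h
  · intro x y y' h
    change ElemRel 1 (U x y) (U x y')
    rw [← U11 x y y']
    refine ElemRel.update_of_sub_mem ?_
    rw [U1]
    exact hc1 _ _ h
  · intro x y r₁ r₂ q₁ q₂ hq
    have := ElemRel.transvection (v := U x y) h01 h02 h12 hq
    rw [U0, U1, U00, U11] at this
    exact this
  · intro x y θ hx h
    change ElemRel 1 (U x (y * θ ^ 2)) (U x y)
    have he : Function.Injective ![i₁, i₂, i₃] := by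
      intro a b
      fin_cases a <;> fin_cases b <;> simp [h12, h13, h23, h12.symm, h13.symm, h23.symm]
    have hr : Set.range ![i₁, i₂, i₃] = {i₁, i₂, i₃} := by
      rw [Matrix.range_cons, Matrix.range_cons, Matrix.range_cons, Matrix.range_empty,
        Set.union_empty]
      rfl
    refine ElemRel.lift_of_quotient he rfl ?_ ?_
    · set 𝔡 := Ideal.span (U x (y * θ ^ 2) '' (Set.range ![i₁, i₂, i₃])ᶜ) with h𝔡
      have hx𝔡 : x ∈ 𝔡 := Ideal.subset_span ⟨i₀, by
        rw [hr]; simp [h01, h02, h03], U0 _ _⟩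
      have hu : IsUnit (Ideal.Quotient.mk 𝔡 θ) := by
        obtain ⟨a, b, hab⟩ := hx
        refine IsUnit.of_mul_eq_one_right (Ideal.Quotient.mk 𝔡 b) ?_
        rw [← map_mul, ← map_one (Ideal.Quotient.mk 𝔡), Ideal.Quotient.eq]
        have : b * θ - 1 = (-a) * x := by linear_combination hab
        rw [this]
        exact Ideal.mul_mem_left _ _ hx𝔡
      have htop : Ideal.span {Ideal.Quotient.mk 𝔡 y, Ideal.Quotient.mk 𝔡 (v i₂),
          Ideal.Quotient.mk 𝔡 (v i₃)} = ⊤ := by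
        rw [eq_top_iff, ← Ideal.map_top (Ideal.Quotient.mk 𝔡), ← h, Ideal.map_sup, Ideal.map_span,
          Ideal.map_span]
        refine sup_le (Ideal.span_le.2 ?_) (Ideal.span_le.2 ?_)
        · rintro _ ⟨z, rfl | rfl, rfl⟩
          · rw [Ideal.Quotient.eq_zero_iff_mem.2 hx𝔡]
            exact Submodule.zero_mem _
          · exact Ideal.subset_span (by simp)
        · rintro _ ⟨_, ⟨j, hj, rfl⟩, rfl⟩
          have hj : j ≠ i₀ ∧ j ≠ i₁ := by simpa [not_or] using hj
          by_cases h2 : j = i₂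
          · subst h2; exact Ideal.subset_span (by simp)
          by_cases h3 : j = i₃
          · subst h3; exact Ideal.subset_span (by simp)
          have : v j ∈ 𝔡 := Ideal.subset_span ⟨j, by
            rw [hr]; simp [h2, h3, hj.2], Uo _ _ _ hj.1 hj.2⟩
          rw [Ideal.Quotient.eq_zero_iff_mem.2 this]
          exact Submodule.zero_mem _
      refine (ElemRel.of_eq ?_).trans ((elemRel_vec3_sq hu htop).trans (ElemRel.of_eq ?_))
      · ext k
        fin_cases k <;> simp [U1, Uo, h12.symm, h02.symm, h03.symm, h13.symm]
      · ext k
        fin_cases k <;> simp [U1, Uo, h12.symm, h02.symm, h03.symm, h13.symm]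
    · intro j hj
      rw [hr] at hj
      have : j ≠ i₁ := fun h => hj (by simp [h])
      simp [U, this]

section Transvection

open Matrix

variable {C : Type*} [CommRing C]

/-- Equivalence of rows of length two under all transvections
`v ↦ v + x * (v₁ * r₀ - v₀ * r₁) • r`. -/
def TransvRel : (Fin 2 → C) → (Fin 2 → C) → Prop :=
  Relation.ReflTransGen fun v v' => ∃ (x : C) (r : Fin 2 → C),
    v' = v + (x * (v 1 * r 0 - v 0 * r 1)) • r

theorem TransvRel.of_eq {v w : Fin 2 → C} (h : v = w) : TransvRel v w :=
  h ▸ Relation.ReflTransGen.refl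

theorem TransvRel.trans {u v w : Fin 2 → C} (h : TransvRel u v) (h' : TransvRel v w) :
    TransvRel u w := Relation.ReflTransGen.trans h h'

theorem TransvRel.add_smul (v r : Fin 2 → C) (x : C) :
    TransvRel v (v + (x * (v 1 * r 0 - v 0 * r 1)) • r) :=
  Relation.ReflTransGen.single ⟨x, r, rfl⟩

theorem TransvRel.vecMul {v v' : Fin 2 → C} (h : TransvRel v v') (M : Matrix (Fin 2) (Fin 2) C)
    (hM : M.det = 1) : TransvRel (v ᵥ* M) (v' ᵥ* M) := by
  induction h with
  | refl => exact Relation.ReflTransGen.refl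
  | @tail b c _ h ih =>
    obtain ⟨x, r, rfl⟩ := h
    refine ih.trans (Relation.ReflTransGen.single ⟨x, r ᵥ* M, ?_⟩)
    rw [Matrix.add_vecMul, Matrix.smul_vecMul]
    congr 2
    rw [Matrix.det_fin_two] at hM
    simp only [Matrix.vecMul, dotProduct, Fin.sum_univ_two]
    linear_combination x * (b 0 * r 1 - b 1 * r 0) * hM

theorem TransvRel.fst (x y t : C) : TransvRel ![x, y] ![x + y * t, y] := by
  have := TransvRel.add_smul ![x, y] ![1, 0] t
  convert this using 1
  ext i; fin_cases i <;> simp [mul_comm]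

theorem TransvRel.snd (x y t : C) : TransvRel ![x, y] ![x, y + x * t] := by
  have := TransvRel.add_smul ![x, y] ![0, 1] (-t)
  convert this using 1
  ext i; fin_cases i <;> simp [mul_comm]

theorem TransvRel.rotate (v : Fin 2 → C) : TransvRel v (v ᵥ* !![0, -1; 1, 0]) := by
  have h := (TransvRel.fst (v 0) (v 1) 1).trans
    ((TransvRel.snd _ _ (-1)).trans (TransvRel.fst _ _ 1))
  convert h using 1
  · ext i; fin_cases i <;> rfl
  · ext i; fin_cases i <;> simp [Matrix.vecMul, dotProduct]

theorem TransvRel.pow_mul_rotate (v : Fin 2 → C) (M : Matrix (Fin 2) (Fin 2) C) (hM : M.det = 1)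
    (m : ℕ) : TransvRel (v ᵥ* M ^ m) (v ᵥ* (M * !![0, -1; 1, 0]) ^ m) := by
  induction m with
  | zero => exact Relation.ReflTransGen.refl
  | succ m ih =>
    rw [pow_succ, pow_succ, ← Matrix.vecMul_vecMul, ← Matrix.vecMul_vecMul]
    refine (ih.vecMul M hM).trans ?_
    rw [← Matrix.vecMul_vecMul (v ᵥ* _) M]
    exact TransvRel.rotate _

theorem TransvRel.step {x y p q X A D h θ B' t : C} {v : Fin 2 → C} (hpq : p * x + q * y = 1)
    (hA : A = D + X * h) (hθ : X + A * B' = θ ^ 2) (hB : B' = p + t * y)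
    (hv : TransvRel v ![X, y * D]) :
    TransvRel (v ᵥ* !![x, y; -q, p]) ![θ ^ 2 * x - A, y * θ ^ 2] := by
  have hM : (!![x, y; -q, p] : Matrix (Fin 2) (Fin 2) C).det = 1 := by
    rw [Matrix.det_fin_two_of, ← hpq]; ring
  have := (hv.trans ((TransvRel.snd _ _ (y * h)).trans (TransvRel.fst _ _ t))).vecMul _ hM
  convert this using 1
  ext i
  fin_cases i
  · simp [Matrix.vecMul, dotProduct]
    rw [← hθ, hB, hA]
    linear_combination (D + X * h) * hpq
  · simp [Matrix.vecMul, dotProduct]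
    rw [← hθ, hB, hA]
    ring

theorem PairRel.of_transvRel {B : Type*} [CommRing B] {𝔠 : Ideal B} {r : B → B → B → B → Prop}
    (hr : PairRel 𝔠 r) {x y x' y' : B}
    (h : TransvRel ![Ideal.Quotient.mk 𝔠 x, Ideal.Quotient.mk 𝔠 y]
      ![Ideal.Quotient.mk 𝔠 x', Ideal.Quotient.mk 𝔠 y']) : r x y x' y' := by
  have congr : ∀ x y x' y', Ideal.Quotient.mk 𝔠 x = Ideal.Quotient.mk 𝔠 x' →
      Ideal.Quotient.mk 𝔠 y = Ideal.Quotient.mk 𝔠 y' → r x y x' y' := fun x y x' y' hx hy =>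
    hr.trans (hr.fst (Ideal.mem_sup_right (Ideal.Quotient.eq.1 hx.symm)))
      (hr.snd (Ideal.mem_sup_right (Ideal.Quotient.eq.1 hy.symm)))
  generalize hu : ![Ideal.Quotient.mk 𝔠 x, Ideal.Quotient.mk 𝔠 y] = u at h
  generalize hu' : ![Ideal.Quotient.mk 𝔠 x', Ideal.Quotient.mk 𝔠 y'] = u' at h
  induction h using Relation.ReflTransGen.head_induction_on generalizing x y with
  | refl =>
    rw [← hu'] at hu
    exact congr _ _ _ _ (congrFun hu 0) (congrFun hu 1)
  | @head _ w h _ ih =>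
    obtain ⟨z, s, rfl⟩ := h
    obtain ⟨z, rfl⟩ := Ideal.Quotient.mk_surjective z
    obtain ⟨r₁, h1⟩ := Ideal.Quotient.mk_surjective (s 0)
    obtain ⟨r₂, h2⟩ := Ideal.Quotient.mk_surjective (s 1)
    refine hr.trans (hr.transv (r₁ := r₁) (r₂ := r₂) (q₁ := -z * r₂) (q₂ := z * r₁) (by ring))
      (ih ?_)
    subst hu
    ext i
    fin_cases i <;> simp [← h1, ← h2] <;> ring

end Transvection

section PowerSwap

open Matrix

variable {B : Type*} [CommRing B] {𝔠 : Ideal B} {r : B → B → B → B → Prop}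

/-- The core step in the comparison of `(x ^ m, y)` with the first row of a matrix power. -/
theorem transvRel_pow_succ {x y p q X ψ h ψ₁ η m₁ m₂ : B} {m : ℕ}
    (hpq : p * x + q * y - 1 ∈ 𝔠) (hX : X - x ^ m ∈ Ideal.span {y} ⊔ 𝔠)
    (hψ : ψ₁ ^ 2 = ψ ^ 2 + X * h) (hco : IsCoprime X ψ₁)
    (hm : m₁ * η - m₂ * ψ₁ = 1) (hB : η ^ 2 - X * m₂ ^ 2 - p ∈ Ideal.span {y} ⊔ 𝔠)
    (ht : TransvRel (![1, 0] ᵥ* !![Ideal.Quotient.mk 𝔠 x, Ideal.Quotient.mk 𝔠 y;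
      -Ideal.Quotient.mk 𝔠 q, Ideal.Quotient.mk 𝔠 p] ^ m)
      ![Ideal.Quotient.mk 𝔠 X, Ideal.Quotient.mk 𝔠 (y * ψ ^ 2)]) :
    ∃ X' : B, IsCoprime X' (ψ₁ * η - X * m₁ * m₂) ∧
      X' - x ^ (m + 1) ∈ Ideal.span {y} ⊔ 𝔠 ∧
      TransvRel (![1, 0] ᵥ* !![Ideal.Quotient.mk 𝔠 x, Ideal.Quotient.mk 𝔠 y;
        -Ideal.Quotient.mk 𝔠 q, Ideal.Quotient.mk 𝔠 p] ^ (m + 1))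
      ![Ideal.Quotient.mk 𝔠 X', Ideal.Quotient.mk 𝔠 (y * (ψ₁ * η - X * m₁ * m₂) ^ 2)] := by
  set θ := ψ₁ * η - X * m₁ * m₂ with hθ
  set A := ψ₁ ^ 2 - X * m₁ ^ 2 with hA
  set B' := η ^ 2 - X * m₂ ^ 2 with hB'
  have key : X + A * B' = θ ^ 2 := by
    rw [hA, hB', hθ]
    linear_combination -X * (m₁ * η - m₂ * ψ₁ + 1) * hm
  refine ⟨θ ^ 2 * x - A, ?_, ?_, ?_⟩
  · have h1 : IsCoprime A θ := by
      obtain ⟨a, b, hab⟩ := hco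
      have hP : IsCoprime (A * B') (A * B' - θ ^ 2) → IsCoprime A θ := by
        intro hh
        have h2 := hh.of_mul_left_left
        have : A * B' - θ ^ 2 = -θ ^ 2 + A * B' := by ring
        rw [this, IsCoprime.add_mul_left_right_iff] at h2
        exact (IsCoprime.pow_right_iff two_pos).1 ((IsCoprime.neg_right_iff _ _).1 h2)
      have h3 : IsCoprime A X := by
        have : IsCoprime X (ψ₁ ^ 2) := IsCoprime.pow_right ⟨a, b, hab⟩
        have h4 : IsCoprime X (ψ₁ ^ 2 + X * (-m₁ ^ 2)) :=
          (IsCoprime.add_mul_left_right_iff).2 this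
        have e : A = ψ₁ ^ 2 + X * (-m₁ ^ 2) := by rw [hA]; ring
        rw [e]; exact h4.symm
      have h5 : IsCoprime A (X + A * B') := (IsCoprime.add_mul_left_right_iff).2 h3
      rw [key] at h5
      exact (IsCoprime.pow_right_iff two_pos).1 h5
    have e : θ ^ 2 * x - A = -A + θ * (θ * x) := by ring
    rw [e]
    exact IsCoprime.add_mul_left_left_iff.2 ((IsCoprime.neg_left_iff _ _).2 h1)
  · rw [← key]
    have h1 : p * x - 1 ∈ Ideal.span {y} ⊔ 𝔠 := by
      have e : p * x - 1 = (p * x + q * y - 1) - q * y := by ring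
      rw [e]
      exact Ideal.sub_mem _ (Ideal.mem_sup_right hpq)
        (Ideal.mem_sup_left (Ideal.mul_mem_left _ _ (Ideal.mem_span_singleton_self y)))
    have e : (X + A * B') * x - A - x ^ (m + 1) =
        x * (X - x ^ m) + (A * x) * (B' - p) + A * (p * x - 1) := by ring
    rw [e]
    exact Ideal.add_mem _ (Ideal.add_mem _ (Ideal.mul_mem_left _ _ hX)
      (Ideal.mul_mem_left _ _ hB)) (Ideal.mul_mem_left _ _ h1)
  · obtain ⟨z, hz, c, hc, hzc⟩ := Submodule.mem_sup.1 hB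
    obtain ⟨t, rfl⟩ := Ideal.mem_span_singleton'.1 hz
    rw [pow_succ, ← Matrix.vecMul_vecMul]
    have hc' := Ideal.Quotient.eq_zero_iff_mem.2 hc
    have hB1 : Ideal.Quotient.mk 𝔠 B' = Ideal.Quotient.mk 𝔠 p +
        Ideal.Quotient.mk 𝔠 t * Ideal.Quotient.mk 𝔠 y := by
      have : B' = p + t * y + c := by linear_combination -hzc
      rw [this, map_add, hc', add_zero, map_add, map_mul]
    have := TransvRel.step (A := Ideal.Quotient.mk 𝔠 A) (D := Ideal.Quotient.mk 𝔠 (ψ ^ 2))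
      (h := Ideal.Quotient.mk 𝔠 (h - m₁ ^ 2)) (θ := Ideal.Quotient.mk 𝔠 θ)
      (p := Ideal.Quotient.mk 𝔠 p) (q := Ideal.Quotient.mk 𝔠 q)
      (x := Ideal.Quotient.mk 𝔠 x) (y := Ideal.Quotient.mk 𝔠 y) (X := Ideal.Quotient.mk 𝔠 X)
      (by rw [← map_mul, ← map_mul, ← map_add, ← map_one (Ideal.Quotient.mk 𝔠),
        Ideal.Quotient.eq]; exact hpq)
      (by rw [← map_mul, ← map_add, hA, hψ]; congr 1; ring)
      (by rw [← map_mul, ← map_add, key, map_pow]) hB1 (by rwa [← map_mul])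
    simpa only [map_mul, map_sub, map_pow] using this

theorem PairRel.of_transvRel_pow (hr : PairRel 𝔠 r) {x y p q X ψ u w : B} {m : ℕ}
    {M : Matrix (Fin 2) (Fin 2) (B ⧸ 𝔠)}
    (hpq : p * x + q * y - 1 ∈ 𝔠) (hX : X - x ^ m ∈ Ideal.span {y} ⊔ 𝔠)
    (hco : IsCoprime X ψ) (huw : ![Ideal.Quotient.mk 𝔠 u, Ideal.Quotient.mk 𝔠 w] = ![1, 0] ᵥ* M ^ m)
    (ht : TransvRel (![1, 0] ᵥ* M ^ m)
      ![Ideal.Quotient.mk 𝔠 X, Ideal.Quotient.mk 𝔠 (y * ψ ^ 2)]) : r u w (x ^ m) y := by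
  rw [← huw] at ht
  refine hr.trans (hr.of_transvRel ht) (hr.trans (hr.sq hco ?_) (hr.fst ?_))
  · have hy : y ∈ Ideal.span {X, y} ⊔ 𝔠 := Ideal.mem_sup_left (Ideal.subset_span (by simp))
    have hX1 : X ∈ Ideal.span {X, y} ⊔ 𝔠 := Ideal.mem_sup_left (Ideal.subset_span (by simp))
    have hle : Ideal.span {y} ⊔ 𝔠 ≤ Ideal.span {X, y} ⊔ 𝔠 :=
      sup_le_sup_right (Ideal.span_mono (by simp)) _
    have hx : x ^ m ∈ Ideal.span {X, y} ⊔ 𝔠 := by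
      have e : x ^ m = X - (X - x ^ m) := by ring
      rw [e]
      exact Ideal.sub_mem _ hX1 (hle hX)
    have h1 : IsCoprime (Ideal.Quotient.mk (Ideal.span {X, y} ⊔ 𝔠) x)
        (Ideal.Quotient.mk (Ideal.span {X, y} ⊔ 𝔠) y) := by
      refine ⟨Ideal.Quotient.mk _ p, Ideal.Quotient.mk _ q, ?_⟩
      rw [← map_mul, ← map_mul, ← map_add, ← map_one (Ideal.Quotient.mk _), Ideal.Quotient.eq]
      exact Ideal.mem_sup_right hpq
    have h2 := h1.pow_left (m := m)
    rw [← map_pow, Ideal.Quotient.eq_zero_iff_mem.2 hx, Ideal.Quotient.eq_zero_iff_mem.2 hy] at h2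
    obtain ⟨a, b, hab⟩ := h2
    rw [Ideal.eq_top_iff_one, ← Ideal.Quotient.eq_zero_iff_mem, map_one, ← hab]
    ring
  · rw [← neg_sub]
    exact neg_mem hX

theorem transvRel_pow_of_sq {x y p q s : B} (hpq : p * x + q * y - 1 ∈ 𝔠)
    (hs : s ^ 2 - x ∈ Ideal.span {y} ⊔ 𝔠) (m : ℕ) :
    ∃ X ψ ψ' : B, IsCoprime X ψ ∧ ψ * ψ' - 1 ∈ Ideal.span {y} ⊔ 𝔠 ∧
      X - x ^ (m + 1) ∈ Ideal.span {y} ⊔ 𝔠 ∧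
      TransvRel (![1, 0] ᵥ* !![Ideal.Quotient.mk 𝔠 x, Ideal.Quotient.mk 𝔠 y;
        -Ideal.Quotient.mk 𝔠 q, Ideal.Quotient.mk 𝔠 p] ^ (m + 1))
      ![Ideal.Quotient.mk 𝔠 X, Ideal.Quotient.mk 𝔠 (y * ψ ^ 2)] := by
  induction m with
  | zero =>
    refine ⟨x, 1, 1, isCoprime_one_right, by simp, by simp, ?_⟩
    rw [zero_add, pow_one, one_pow, mul_one]
    refine TransvRel.of_eq ?_
    ext i; fin_cases i <;> simp
  | succ m ih =>
    obtain ⟨X, ψ, ψ', hco, hψ, hX, ht⟩ := ih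
    obtain ⟨a, d, had⟩ := hco
    let f := (d - a * ((s * p - X) * ψ')) * s
    let η := X + ψ * ((s * p - X) * ψ')
    let m₂ := -d + a * ((s * p - X) * ψ') + f * η
    have hm : (a + ψ * f) * η - m₂ * ψ = 1 := by
      simp only [m₂, η]
      linear_combination had
    set φ := Ideal.Quotient.mk (Ideal.span {y} ⊔ 𝔠) with hφ
    have hy : φ y = 0 := Ideal.Quotient.eq_zero_iff_mem.2
      (Ideal.mem_sup_left (Ideal.mem_span_singleton_self y))
    have h1 : φ p * φ x = 1 := by
      have := Ideal.Quotient.eq.2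
        (Ideal.mem_sup_right (S := Ideal.span {y}) hpq)
      rwa [← hφ, map_add, map_mul, map_mul, hy, mul_zero, add_zero, map_one] at this
    have h2 : φ s ^ 2 = φ x := by rw [← map_pow]; exact Ideal.Quotient.eq.2 hs
    have h3 : φ ψ * φ ψ' = 1 := by rw [← map_mul, ← map_one φ]; exact Ideal.Quotient.eq.2 hψ
    have hη : φ η = φ s * φ p := by
      simp only [η, map_add, map_mul, map_sub]
      linear_combination (φ s * φ p - φ X) * h3
    have hm2 : φ m₂ = 0 := by
      simp only [m₂, map_add, map_mul, hη, map_neg, f, map_sub]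
      linear_combination (φ d - φ a * (φ s * φ p - φ X) * φ ψ') * (φ p * h2 + h1)
    have hB : η ^ 2 - X * m₂ ^ 2 - p ∈ Ideal.span {y} ⊔ 𝔠 := by
      rw [← Ideal.Quotient.eq, ← hφ, map_sub, map_mul, map_pow, map_pow, hη, hm2]
      linear_combination φ p ^ 2 * h2 + φ p * h1
    obtain ⟨X', hc, hX', ht'⟩ := transvRel_pow_succ (h := 0) (ψ₁ := ψ) hpq hX (by ring)
      ⟨a, d, had⟩ hm hB ht
    refine ⟨X', _, ψ' * s, hc, ?_, hX', ht'⟩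
    rw [← Ideal.Quotient.eq, ← hφ]
    simp only [map_sub, map_mul, hm2, hη, map_one]
    linear_combination (φ s ^ 2 * φ p) * h3 + φ p * h2 + h1

theorem transvRel_sq {x y p q i : B} (hi : i ^ 2 = -1) (hpq : p * x + q * y - 1 ∈ 𝔠) :
    ∃ X ψ : B, IsCoprime X ψ ∧ X - x ^ 2 ∈ Ideal.span {y} ⊔ 𝔠 ∧
      TransvRel (![1, 0] ᵥ* !![Ideal.Quotient.mk 𝔠 x, Ideal.Quotient.mk 𝔠 y;
        -Ideal.Quotient.mk 𝔠 q, Ideal.Quotient.mk 𝔠 p] ^ 2)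
      ![Ideal.Quotient.mk 𝔠 X, Ideal.Quotient.mk 𝔠 (y * ψ ^ 2)] := by
  let f := (i * x - 1) * p
  let ψ := 1 + x * f
  let η := x + i * ψ
  set φ := Ideal.Quotient.mk (Ideal.span {y} ⊔ 𝔠) with hφ
  have hy : φ y = 0 := Ideal.Quotient.eq_zero_iff_mem.2
    (Ideal.mem_sup_left (Ideal.mem_span_singleton_self y))
  have h1 : φ p * φ x = 1 := by
    have := Ideal.Quotient.eq.2
      (Ideal.mem_sup_right (S := Ideal.span {y}) hpq)
    rwa [← hφ, map_add, map_mul, map_mul, hy, mul_zero, add_zero, map_one] at this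
  have h2 : φ i ^ 2 = -1 := by rw [← map_pow, hi, map_neg, map_one]
  obtain ⟨X', hc, hX', ht'⟩ := transvRel_pow_succ (x := x) (y := y) (p := p) (q := q) (X := x)
    (ψ := 1) (m := 1) (h := 2 * f + x * f ^ 2) (ψ₁ := ψ) (η := η) (m₁ := -f) (m₂ := -1 - i * f)
    hpq (by simp) (by simp only [ψ]; ring) ⟨-f, 1, by simp only [ψ]; ring⟩
    (by simp only [η, ψ]; ring)
    (by
      rw [← Ideal.Quotient.eq, ← hφ]
      have e1 : φ f = φ i - φ p := by
        simp only [f, map_mul, map_sub, map_one]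
        linear_combination φ i * h1
      have e2 : φ ψ = φ i * φ x := by
        simp only [ψ, map_add, map_mul, e1, map_one]
        linear_combination -h1
      have e3 : φ η = 0 := by
        simp only [η, map_add, map_mul, e2]
        linear_combination φ x * h2
      simp only [map_sub, map_pow, map_mul, e3, e1, map_neg, map_one]
      linear_combination (-φ x * (1 + φ i ^ 2 - 2 * φ i * φ p) - φ p ^ 2 * φ x) * h2 + φ p * h1)
    (by
      refine TransvRel.of_eq ?_
      ext i; fin_cases i <;> simp)
  exact ⟨X', _, hc, hX', ht'⟩

theorem PairRel.swap (hr : PairRel 𝔠 r) (x y : B) : r x y (-y) x := by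
  refine hr.trans (hr.snd (y' := y + x) (Ideal.mem_sup_left ?_))
    (hr.trans (hr.fst (x' := -y) (Ideal.mem_sup_left ?_)) (hr.snd (Ideal.mem_sup_left ?_)))
  · exact Ideal.mem_span_singleton'.2 ⟨1, by ring⟩
  · exact Ideal.mem_span_singleton'.2 ⟨-1, by ring⟩
  · exact Ideal.mem_span_singleton'.2 ⟨1, by ring⟩

theorem PairRel.pow_swap_of_bezout (hr : PairRel 𝔠 r) {x y p q : B}
    (hpq : p * x + q * y - 1 ∈ 𝔠) {m : ℕ}
    (h₁ : ∃ X ψ : B, IsCoprime X ψ ∧ X - x ^ m ∈ Ideal.span {y} ⊔ 𝔠 ∧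
      TransvRel (![1, 0] ᵥ* !![Ideal.Quotient.mk 𝔠 x, Ideal.Quotient.mk 𝔠 y;
        -Ideal.Quotient.mk 𝔠 q, Ideal.Quotient.mk 𝔠 p] ^ m)
      ![Ideal.Quotient.mk 𝔠 X, Ideal.Quotient.mk 𝔠 (y * ψ ^ 2)])
    (h₂ : ∃ X ψ : B, IsCoprime X ψ ∧ X - y ^ m ∈ Ideal.span {-x} ⊔ 𝔠 ∧
      TransvRel (![1, 0] ᵥ* !![Ideal.Quotient.mk 𝔠 y, Ideal.Quotient.mk 𝔠 (-x);
        -Ideal.Quotient.mk 𝔠 (-p), Ideal.Quotient.mk 𝔠 q] ^ m)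
      ![Ideal.Quotient.mk 𝔠 X, Ideal.Quotient.mk 𝔠 (-x * ψ ^ 2)]) :
    r (x ^ m) y x (y ^ m) := by
  obtain ⟨X, ψ, hco, hX, ht⟩ := h₁
  obtain ⟨Y, ψ', hco', hY, ht'⟩ := h₂
  have hpq' : q * y + -p * -x - 1 ∈ 𝔠 := by
    convert hpq using 1; ring
  set M := !![Ideal.Quotient.mk 𝔠 x, Ideal.Quotient.mk 𝔠 y;
        -Ideal.Quotient.mk 𝔠 q, Ideal.Quotient.mk 𝔠 p] with hM
  set N := !![Ideal.Quotient.mk 𝔠 y, Ideal.Quotient.mk 𝔠 (-x);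
        -Ideal.Quotient.mk 𝔠 (-p), Ideal.Quotient.mk 𝔠 q] with hN
  have hMN : M * !![0, -1; 1, 0] = N := by
    rw [hM, hN]
    ext i j
    fin_cases i <;> fin_cases j <;> simp
  have hdet : M.det = 1 := by
    rw [hM, Matrix.det_fin_two_of, ← map_one (Ideal.Quotient.mk 𝔠), ← Ideal.Quotient.eq.2 hpq]
    simp only [map_add, map_mul]
    ring
  have exlift : ∀ v : Fin 2 → B ⧸ 𝔠,
      ∃ a b, ![Ideal.Quotient.mk 𝔠 a, Ideal.Quotient.mk 𝔠 b] = v := by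
    intro v
    obtain ⟨a, ha⟩ := Ideal.Quotient.mk_surjective (v 0)
    obtain ⟨b, hb⟩ := Ideal.Quotient.mk_surjective (v 1)
    refine ⟨a, b, ?_⟩
    ext i; fin_cases i <;> simp [ha, hb]
  obtain ⟨a, b, hab⟩ := exlift (![1, 0] ᵥ* M ^ m)
  obtain ⟨a', b', hab'⟩ := exlift (![1, 0] ᵥ* N ^ m)
  have h1 := hr.of_transvRel_pow hpq hX hco hab ht
  have h2 := hr.of_transvRel_pow hpq' hY hco' hab' ht'
  have h3 : r a b a' b' := hr.of_transvRel (by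
    rw [hab, hab', ← hMN]
    exact TransvRel.pow_mul_rotate _ M hdet m)
  have h4 := hr.swap (y ^ m) (-x)
  rw [neg_neg] at h4
  exact hr.trans (hr.symm h1) (hr.trans h3 (hr.trans h2 h4))

theorem PairRel.sq_swap (hr : PairRel 𝔠 r) {x y i : B} (hi : i ^ 2 = -1)
    (hxy : Ideal.span {x, y} ⊔ 𝔠 = ⊤) : r (x ^ 2) y x (y ^ 2) := by
  obtain ⟨z, hz, c, hc, hzc⟩ := Submodule.mem_sup.1 ((Ideal.eq_top_iff_one _).1 hxy)
  obtain ⟨p, q, rfl⟩ := Ideal.mem_span_pair.1 hz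
  have hpq : p * x + q * y - 1 ∈ 𝔠 := by
    rw [← hzc]; simpa using hc
  have hpq' : q * y + -p * -x - 1 ∈ 𝔠 := by
    convert hpq using 1; ring
  exact hr.pow_swap_of_bezout hpq (transvRel_sq hi hpq) (transvRel_sq hi hpq')

theorem PairRel.pow_swap (hr : PairRel 𝔠 r) {x y s t : B} (hs : s ^ 2 - x ∈ Ideal.span {y} ⊔ 𝔠)
    (ht : t ^ 2 - y ∈ Ideal.span {x} ⊔ 𝔠)
    (hxy : Ideal.span {x, y} ⊔ 𝔠 = ⊤) (m : ℕ) : r (x ^ (m + 1)) y x (y ^ (m + 1)) := by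
  obtain ⟨z, hz, c, hc, hzc⟩ := Submodule.mem_sup.1 ((Ideal.eq_top_iff_one _).1 hxy)
  obtain ⟨p, q, rfl⟩ := Ideal.mem_span_pair.1 hz
  have hpq : p * x + q * y - 1 ∈ 𝔠 := by
    rw [← hzc]; simpa using hc
  have hpq' : q * y + -p * -x - 1 ∈ 𝔠 := by
    convert hpq using 1; ring
  have ht' : t ^ 2 - y ∈ Ideal.span {-x} ⊔ 𝔠 := by rwa [Ideal.span_singleton_neg]
  obtain ⟨X, ψ, _, h1, _, h2, h3⟩ := transvRel_pow_of_sq hpq hs m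
  obtain ⟨X', ψ', _, h1', _, h2', h3'⟩ := transvRel_pow_of_sq hpq' ht' m
  exact hr.pow_swap_of_bezout hpq ⟨X, ψ, h1, h2, h3⟩ ⟨X', ψ', h1', h2', h3'⟩

end PowerSwap

section IdealClasses

open nonZeroDivisors

theorem Polynomial.hasFiniteQuotients (F : Type*) [Field F] [Finite F] :
    Ring.HasFiniteQuotients F[X] where
  finiteQuotient {I} hI := by
    obtain ⟨f, rfl⟩ := IsPrincipalIdealRing.principal I
    have hf : f ≠ 0 := fun h => hI (by simp [h])
    have := (AdjoinRoot.powerBasis hf).finite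
    exact Module.finite_of_finite F (M := AdjoinRoot f)

/-- In a finite torsion-free extension of `F[X]`, `F` a finite field, an infinite sequence of
nonzero ideals has two members which agree up to principal ideals. -/
theorem exists_lt_span_mul_eq (F : Type*) {S : Type*} [Field F] [Finite F] [CommRing S] [IsDomain S]
    [Algebra F[X] S] [Module.Finite F[X] S] [Module.IsTorsionFree F[X] S]
    (I : ℕ → Ideal S) (hI : ∀ j, I j ≠ ⊥) :
    ∃ j l, j < l ∧ ∃ β β' : S, β ≠ 0 ∧ β' ≠ 0 ∧
      Ideal.span {β} * I j = Ideal.span {β'} * I l := by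
  classical
  cases nonempty_fintype F
  let bS := Module.Free.chooseBasis F[X] S
  set M := ∏ m ∈ ClassGroup.finsetApprox bS cardPowDegreeIsAdmissible, m with hM
  have hM0 : algebraMap F[X] S M ≠ 0 := ClassGroup.prod_finsetApprox_ne_zero bS _
  set μ := algebraMap F[X] S M
  have key : ∀ I : Ideal S, I ≠ ⊥ → ∃ J : Ideal S, μ ∈ J ∧ ∃ β : S, β ≠ 0 ∧
      Ideal.span {μ} * I = Ideal.span {β} * J := by
    intro I hI
    obtain ⟨b, hb, hb0, hmin⟩ := ClassGroup.exists_min (S := S) (cardPowDegree (Fq := F))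
      ⟨I, mem_nonZeroDivisors_iff_ne_zero.2 hI⟩
    have hdvd : ∀ a ∈ I, b ∣ μ * a := by
      intro a ha
      obtain ⟨q, r, r_mem, lt⟩ := ClassGroup.exists_mem_finset_approx' bS
        cardPowDegreeIsAdmissible a hb0
      simp only [Algebra.smul_def] at lt
      have h0 := hmin _ (I.sub_mem (I.mul_mem_left _ ha) (I.mul_mem_left _ hb)) lt
      have h1 : b ∣ algebraMap F[X] S r * a := ⟨q, by linear_combination h0⟩
      have h2 : r ∣ M := Finset.dvd_prod_of_mem _ r_mem
      exact h1.trans (mul_dvd_mul_right (map_dvd _ h2) _)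
    refine ⟨(Submodule.comap (LinearMap.mulLeft S b) (Ideal.span {μ} * I : Ideal S) : Ideal S),
      ?_, b, hb0, ?_⟩
    · simp only [Submodule.mem_comap, LinearMap.mulLeft_apply]
      rw [mul_comm b]
      exact Ideal.mul_mem_mul (Ideal.mem_span_singleton_self _) hb
    · ext x
      rw [Ideal.mem_span_singleton_mul, Ideal.mem_span_singleton_mul]
      constructor
      · rintro ⟨a, ha, rfl⟩
        obtain ⟨z, hz⟩ := hdvd a ha
        refine ⟨z, ?_, hz.symm⟩
        simp only [Submodule.mem_comap, LinearMap.mulLeft_apply]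
        rw [← hz]
        exact Ideal.mul_mem_mul (Ideal.mem_span_singleton_self _) ha
      · rintro ⟨z, hz, rfl⟩
        exact Ideal.mem_span_singleton_mul.1 hz
  have := Polynomial.hasFiniteQuotients F
  have := Ring.HasFiniteQuotients.of_module_finite F[X] S
  have hfin : Finite (S ⧸ Ideal.span {μ}) :=
    Ring.HasFiniteQuotients.finiteQuotient (by simpa using hM0)
  choose! J hμJ β hβ hJ using key
  have hJfin : Finite {J : Ideal S // μ ∈ J} := by
    refine Finite.of_injective (β := Set (S ⧸ Ideal.span {μ}))
      (fun J => (Ideal.Quotient.mk _) '' (J.1 : Set S)) fun J J' h => ?_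
    have hle : ∀ J : {J : Ideal S // μ ∈ J}, Ideal.comap (Ideal.Quotient.mk (Ideal.span {μ}))
        (Ideal.map (Ideal.Quotient.mk (Ideal.span {μ})) J.1) = J.1 := by
      intro J
      rw [Ideal.comap_map_of_surjective _ Ideal.Quotient.mk_surjective, ← RingHom.ker_eq_comap_bot,
        Ideal.mk_ker, sup_eq_left, Ideal.span_singleton_le_iff_mem]
      exact J.2
    apply Subtype.ext
    rw [← hle J, ← hle J', Ideal.map, Ideal.map]
    simp only at h
    rw [h]
  obtain ⟨a, b, hab, h⟩ := Finite.exists_ne_map_eq_of_infinite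
    (fun j : ℕ => (⟨J (I j), hμJ _ (hI j)⟩ : {J : Ideal S // μ ∈ J}))
  have h : J (I a) = J (I b) := congrArg Subtype.val h
  have main : Ideal.span {β (I b)} * I a = Ideal.span {β (I a)} * I b := by
    have : Ideal.span {μ} * (Ideal.span {β (I b)} * I a) =
        Ideal.span {μ} * (Ideal.span {β (I a)} * I b) := by
      rw [mul_left_comm, hJ _ (hI a), h, mul_left_comm, ← hJ _ (hI b), mul_left_comm]
    exact (Ideal.span_singleton_mul_right_inj hM0).1 this
  rcases lt_or_gt_of_ne hab with h1 | h1
  · exact ⟨a, b, h1, _, _, hβ _ (hI b), hβ _ (hI a), main⟩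
  · exact ⟨b, a, h1, _, _, hβ _ (hI a), hβ _ (hI b), main.symm⟩

/-- A torsion statement for the ideal `(b, 1 - e)` in an order. -/
theorem exists_pow_eq_mul_of_finite_polynomial (F : Type*) {S : Type*} [Field F] [Finite F]
    [CommRing S] [IsDomain S] [Algebra F[X] S] [Module.Finite F[X] S] [Module.IsTorsionFree F[X] S]
    {b e h : S} (hb : b ≠ 0) (he : e * (1 - e) = b * h) :
    ∃ (N : ℕ) (y w : S), N ≠ 0 ∧ b ^ N = y * w ∧ IsCoprime y e ∧ IsCoprime w (1 - e) := by
  set I := Ideal.span {b, 1 - e} with hI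
  set I' := Ideal.span {b, e} with hI'
  have hb1 : b ∈ I := Ideal.subset_span (by simp)
  have hb2 : b ∈ I' := Ideal.subset_span (by simp)
  have he1 : 1 - e ∈ I := Ideal.subset_span (by simp)
  have he2 : e ∈ I' := Ideal.subset_span (by simp)
  have hII : I * I' = Ideal.span {b} := by
    apply le_antisymm
    · rw [hI, hI', Ideal.span_pair_mul_span_pair, Ideal.span_le]
      rintro x (rfl | rfl | rfl | rfl) <;> rw [SetLike.mem_coe, Ideal.mem_span_singleton]
      · exact ⟨b, rfl⟩
      · exact ⟨e, rfl⟩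
      · exact ⟨1 - e, mul_comm _ _⟩
      · exact ⟨h, by rw [mul_comm, he]⟩
    · rw [Ideal.span_singleton_le_iff_mem]
      have : b = (1 - e) * b + b * e := by ring
      rw [this]
      exact Ideal.add_mem _ (Ideal.mul_mem_mul he1 hb2) (Ideal.mul_mem_mul hb1 he2)
  have hI0 : ∀ j, I ^ j ≠ ⊥ := fun j => pow_ne_zero j fun h => hb (by
    rw [h] at hb1; exact hb1)
  obtain ⟨j, l, hjl, β, β', hβ, hβ', hm⟩ := exists_lt_span_mul_eq F (fun j => I ^ j) hI0
  obtain ⟨N, rfl⟩ := Nat.exists_eq_add_of_lt hjl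
  have h1 : Ideal.span {β} = Ideal.span {β'} * I ^ (N + 1) := by
    have h2 : Ideal.span {b ^ j} * Ideal.span {β} =
        Ideal.span {b ^ j} * (Ideal.span {β'} * I ^ (N + 1)) := by
      rw [← Ideal.span_singleton_pow, ← hII, mul_pow]
      calc I ^ j * I' ^ j * Ideal.span {β} = (Ideal.span {β} * I ^ j) * I' ^ j := by ring
        _ = (Ideal.span {β'} * I ^ (j + N + 1)) * I' ^ j := by rw [hm]
        _ = _ := by ring
    exact (Ideal.span_singleton_mul_right_inj (pow_ne_zero j hb)).1 h2
  have hββ : β ∈ Ideal.span {β'} * I ^ (N + 1) := h1 ▸ Ideal.mem_span_singleton_self β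
  obtain ⟨y, hy, rfl⟩ := Ideal.mem_span_singleton_mul.1 hββ
  have h3 : Ideal.span {y} = I ^ (N + 1) := by
    rw [← Ideal.span_singleton_mul_span_singleton] at h1
    exact (Ideal.span_singleton_mul_right_inj hβ').1 h1
  have hy0 : y ≠ 0 := right_ne_zero_of_mul hβ
  have h4 : Ideal.span {b ^ (N + 1)} = Ideal.span {y} * I' ^ (N + 1) := by
    rw [← Ideal.span_singleton_pow, ← hII, mul_pow, h3]
  have hbN : b ^ (N + 1) ∈ Ideal.span {y} * I' ^ (N + 1) := h4 ▸ Ideal.mem_span_singleton_self _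
  obtain ⟨w, hw, hyw⟩ := Ideal.mem_span_singleton_mul.1 hbN
  have h5 : Ideal.span {w} = I' ^ (N + 1) := by
    rw [← hyw, ← Ideal.span_singleton_mul_span_singleton] at h4
    exact (Ideal.span_singleton_mul_right_inj hy0).1 h4
  refine ⟨N + 1, y, w, Nat.succ_ne_zero N, hyw.symm, ?_, ?_⟩
  · rw [← Ideal.isCoprime_span_singleton_iff, h3]
    refine IsCoprime.pow_left (Ideal.isCoprime_iff_exists.2 ⟨1 - e, he1, e, ?_, by ring⟩)
    exact Ideal.mem_span_singleton_self e
  · rw [← Ideal.isCoprime_span_singleton_iff, h5]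
    refine IsCoprime.pow_left (Ideal.isCoprime_iff_exists.2 ⟨e, he2, 1 - e, ?_, by ring⟩)
    exact Ideal.mem_span_singleton_self _

end IdealClasses

section TwoElementRelations

/-- A nontrivial relation between two elements, as a polynomial in two nested variables. -/
theorem exists_eval₂_aeval_eq_zero {F D : Type*} [Field F] [CommRing D] [Algebra F D] {x y : D}
    (h : ¬ AlgebraicIndependent F ![y, x]) :
    ∃ P : F[X][X], P ≠ 0 ∧ P.eval₂ (aeval x : F[X] →ₐ[F] D).toRingHom y = 0 := by
  rw [algebraicIndependent_iff] at h
  push Not at h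
  obtain ⟨f, hf, hf0⟩ := h
  let e : MvPolynomial (Fin 2) F ≃ₐ[F] F[X][X] := (MvPolynomial.finSuccEquiv F 1).trans
    (Polynomial.mapAlgEquiv (MvPolynomial.uniqueAlgEquiv F (Fin 1)))
  refine ⟨e f, by simpa using hf0, ?_⟩
  rw [← hf]
  let ψ : F[X][X] →ₐ[F] D :=
    { Polynomial.eval₂RingHom (aeval x : F[X] →ₐ[F] D).toRingHom y with
      commutes' := fun r => by
        simp [Polynomial.algebraMap_apply] }
  have : ψ.comp e.toAlgHom = MvPolynomial.aeval ![y, x] := by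
    apply MvPolynomial.algHom_ext
    intro i
    fin_cases i
    · have : (MvPolynomial.finSuccEquiv F 1) (MvPolynomial.X 0) = Polynomial.X :=
        MvPolynomial.finSuccEquiv_X_zero
      simp [ψ, e, this]
    · have : (MvPolynomial.finSuccEquiv F 1) (MvPolynomial.X 1) =
        Polynomial.C (MvPolynomial.X 0) := MvPolynomial.finSuccEquiv_X_succ (j := 0)
      simp [ψ, e, this]
  exact DFunLike.congr_fun this f

/-- If any two elements are algebraically dependent modulo the prime `𝔭`, then modulo any larger
ideal every element is algebraic. -/
theorem isAlgebraic_mk_sup {F C : Type*} [Field F] [CommRing C] [Algebra F C]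
    (J 𝔭 : Ideal C) [𝔭.IsPrime] (hJ : ¬ J ≤ 𝔭)
    (h : ∀ x y : C ⧸ 𝔭, ¬ AlgebraicIndependent F ![x, y]) (z : C) :
    IsAlgebraic F (Ideal.Quotient.mk (J ⊔ 𝔭) z) := by
  obtain ⟨j, hjJ, hj𝔭⟩ := SetLike.not_le_iff_exists.1 hJ
  have key : ∀ (n : ℕ) (P : F[X][X]), P.natDegree = n → P ≠ 0 →
      P.eval₂ (aeval z : F[X] →ₐ[F] C).toRingHom j ∈ 𝔭 →
      ∃ g : F[X], g ≠ 0 ∧ aeval z g ∈ J ⊔ 𝔭 := by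
    intro n
    induction n with
    | zero =>
      intro P hP hP0 hm
      rw [Polynomial.eq_C_of_natDegree_eq_zero hP] at hm hP0
      refine ⟨P.coeff 0, by simpa using hP0, (le_sup_right : 𝔭 ≤ J ⊔ 𝔭) ?_⟩
      simpa using hm
    | succ n ih =>
      intro P hP hP0 hm
      have hd := Polynomial.divX_mul_X_add P
      by_cases h0 : P.coeff 0 = 0
      · refine ih P.divX (by rw [natDegree_divX_eq_natDegree_tsub_one, hP]; rfl) ?_ ?_
        · intro hh
          rw [hh, h0] at hd
          simp at hd
          exact hP0 hd.symm
        · rw [← hd, h0] at hm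
          simp only [map_zero, add_zero, eval₂_mul, eval₂_X] at hm
          exact (Ideal.IsPrime.mem_or_mem ‹_› hm).resolve_right hj𝔭
      · refine ⟨P.coeff 0, h0, ?_⟩
        rw [← hd] at hm
        simp only [eval₂_add, eval₂_mul, eval₂_X, eval₂_C] at hm
        have h2 := (J ⊔ 𝔭).sub_mem ((le_sup_right : 𝔭 ≤ J ⊔ 𝔭) hm)
          ((le_sup_left : J ≤ J ⊔ 𝔭) (J.mul_mem_left
            (P.divX.eval₂ (aeval z : F[X] →ₐ[F] C).toRingHom j) hjJ))
        simpa using h2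
  obtain ⟨P, hP0, hP⟩ := exists_eval₂_aeval_eq_zero
    (h (Ideal.Quotient.mk 𝔭 j) (Ideal.Quotient.mk 𝔭 z))
  obtain ⟨g, hg, hm⟩ := key _ P rfl hP0 (by
    rw [← Ideal.Quotient.eq_zero_iff_mem, Polynomial.hom_eval₂, ← hP]
    congr 1
    refine RingHom.ext fun q => ?_
    exact (Polynomial.aeval_algHom_apply (Ideal.Quotient.mkₐ F 𝔭) z q).symm)
  refine ⟨g, hg, ?_⟩
  have := Polynomial.aeval_algHom_apply (Ideal.Quotient.mkₐ F (J ⊔ 𝔭)) z g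
  simp only [Ideal.Quotient.mkₐ_eq_mk] at this
  rw [this, Ideal.Quotient.eq_zero_iff_mem]
  exact hm

/-- An element which is algebraic over a finite field has an idempotent power. -/
theorem IsAlgebraic.exists_isIdempotentElem_pow {F Q : Type*} [Field F] [Finite F] [CommRing Q]
    [Algebra F Q] {z : Q} (hz : IsAlgebraic F z) : ∃ m ≠ 0, IsIdempotentElem (z ^ m) := by
  have hfg := hz.isIntegral.fg_adjoin_singleton
  have : Module.Finite F (Algebra.adjoin F {z}) := Module.Finite.iff_fg.2 hfg
  have : Finite (Algebra.adjoin F {z}) := Module.finite_of_finite F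
  obtain ⟨a, b, hab, h⟩ := Finite.exists_ne_map_eq_of_infinite
    (fun j : ℕ => (⟨z, Algebra.self_mem_adjoin_singleton F z⟩ : Algebra.adjoin F {z}) ^ j)
  wlog hlt : a < b generalizing a b
  · exact this b a hab.symm h.symm (lt_of_le_of_ne (not_lt.1 hlt) hab.symm)
  have h : z ^ a = z ^ b := by simpa using congrArg Subtype.val h
  obtain ⟨n, rfl⟩ := Nat.exists_eq_add_of_lt hlt
  have h1 : ∀ k c, z ^ (a + c + (n + 1) * k) = z ^ (a + c) := by
    intro k c
    induction k with
    | zero => simp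
    | succ k ih =>
      rw [← ih]
      have : a + c + (n + 1) * (k + 1) = (a + n + 1) + (c + (n + 1) * k) := by ring
      rw [this, pow_add, ← h, ← pow_add]
      congr 1; ring
  refine ⟨(n + 1) * (a + 1), by positivity, ?_⟩
  have h2 := h1 (a + 1) (n * (a + 1) + 1)
  rw [IsIdempotentElem, ← pow_add]
  have h3 : a + (n * (a + 1) + 1) = (n + 1) * (a + 1) := by ring
  rwa [h3] at h2

end TwoElementRelations

section Factorization

/-- The relation `b ^ N = y * w` with `y` coprime to `e` and `w` coprime to `1 - e`. -/
def IsSplitPow {Q : Type*} [CommRing Q] (b e : Q) (N : ℕ) (y w : Q) : Prop :=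
  b ^ N = y * w ∧ IsCoprime y e ∧ IsCoprime w (1 - e)

variable {Q : Type*} [CommRing Q] {b e : Q} {N : ℕ} {y w : Q}

theorem IsSplitPow.pow (h : IsSplitPow b e N y w) (m : ℕ) :
    IsSplitPow b e (N * m) (y ^ m) (w ^ m) :=
  ⟨by rw [pow_mul, h.1, mul_pow], h.2.1.pow_left, h.2.2.pow_left⟩

theorem IsSplitPow.map {Q' : Type*} [CommRing Q'] (f : Q →+* Q') (h : IsSplitPow b e N y w) :
    IsSplitPow (f b) (f e) N (f y) (f w) :=
  ⟨by rw [← map_pow, h.1, map_mul], h.2.1.map f, by simpa using h.2.2.map f⟩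

theorem IsSplitPow.swap (h : IsSplitPow b e N y w) : IsSplitPow b (1 - e) N w y :=
  ⟨by rw [h.1, mul_comm], h.2.2, by simpa using h.2.1⟩

theorem IsSplitPow.fst_eq {y' w' g : Q} (he : e * (1 - e) = b * g) (h : IsSplitPow b e N y w)
    (h' : IsSplitPow b e N y' w') (hy : IsIdempotentElem y) (hy' : IsIdempotentElem y') :
    y = y' := by
  have key : ∀ {y w y' w' : Q}, IsSplitPow b e N y w → IsSplitPow b e N y' w' →
      IsIdempotentElem y' → y = y * y' := by
    intro y w y' w' h h' hy'
    obtain ⟨h1, -, u₁, v₁, hw⟩ := h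
    obtain ⟨h1', ⟨u, v, hy⟩, -⟩ := h'
    have e1 : y * (1 - y') * y' = 0 := by linear_combination -y * hy'.eq
    have e2 : y * (1 - y') * w = 0 := by
      have : y * w = y' * w' := h1.symm.trans h1'
      linear_combination (1 - y') * this - w' * hy'.eq
    have e3 : y * (1 - y') = y * (1 - y') * (v * v₁ * g * b) := by
      linear_combination -(y * (1 - y')) * hy + u * e1 - v * e * (y * (1 - y')) * hw +
        v * e * u₁ * e2 + y * (1 - y') * v * v₁ * he
    have e4 : ∀ m : ℕ, y * (1 - y') = y * (1 - y') * (v * v₁ * g * b) ^ m := by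
      intro m
      induction m with
      | zero => simp
      | succ m ih => rw [pow_succ, ← mul_assoc, ← ih, ← e3]
    have e5 := e4 N
    rw [mul_pow, h1'] at e5
    linear_combination e5 + (v * v₁ * g) ^ N * w' * e1
  rw [key h h' hy', mul_comm, ← key h' h hy]

theorem exists_isSplitPow_inf {F C : Type*} [Field F] [Finite F] [CommRing C] [Algebra F C]
    {b e g : C} (he : e * (1 - e) = b * g)
    {J 𝔭 : Ideal C} [𝔭.IsPrime] (h : ∀ x y : C ⧸ 𝔭, ¬ AlgebraicIndependent F ![x, y])
    (hJ : ∃ N y w, N ≠ 0 ∧ IsSplitPow (Ideal.Quotient.mk J b) (Ideal.Quotient.mk J e) N y w)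
    (h𝔭 : ∃ N y w, N ≠ 0 ∧ IsSplitPow (Ideal.Quotient.mk 𝔭 b) (Ideal.Quotient.mk 𝔭 e) N y w) :
    ∃ N y w, N ≠ 0 ∧
      IsSplitPow (Ideal.Quotient.mk (J ⊓ 𝔭) b) (Ideal.Quotient.mk (J ⊓ 𝔭) e) N y w := by
  by_cases hle : J ≤ 𝔭
  · rwa [inf_eq_left.2 hle]
  obtain ⟨N₁, y₁, w₁, hN₁, h₁⟩ := hJ
  obtain ⟨N₂, y₂, w₂, hN₂, h₂⟩ := h𝔭
  obtain ⟨N, y₁, w₁, y₂, w₂, hN, h₁, h₂⟩ : ∃ N y₁ w₁ y₂ w₂, N ≠ 0 ∧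
      IsSplitPow (Ideal.Quotient.mk J b) (Ideal.Quotient.mk J e) N
        (Ideal.Quotient.mk J y₁) (Ideal.Quotient.mk J w₁) ∧
      IsSplitPow (Ideal.Quotient.mk 𝔭 b) (Ideal.Quotient.mk 𝔭 e) N
        (Ideal.Quotient.mk 𝔭 y₂) (Ideal.Quotient.mk 𝔭 w₂) := by
    obtain ⟨y₁, rfl⟩ := Ideal.Quotient.mk_surjective y₁
    obtain ⟨w₁, rfl⟩ := Ideal.Quotient.mk_surjective w₁
    obtain ⟨y₂, rfl⟩ := Ideal.Quotient.mk_surjective y₂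
    obtain ⟨w₂, rfl⟩ := Ideal.Quotient.mk_surjective w₂
    exact ⟨N₁ * N₂, y₁ ^ N₂, w₁ ^ N₂, y₂ ^ N₁, w₂ ^ N₁, mul_ne_zero hN₁ hN₂,
      by simpa using h₁.pow N₂, by simpa [mul_comm] using h₂.pow N₁⟩
  set q := Ideal.Quotient.mk (J ⊔ 𝔭) with hq
  have hid : ∀ z : C, ∃ m ≠ 0, IsIdempotentElem (q z ^ m) := fun z =>
    (isAlgebraic_mk_sup J 𝔭 hle h z).exists_isIdempotentElem_pow
  choose m hm0 hm using hid
  have hM : ∃ M, M ≠ 0 ∧ ∀ z ∈ ({y₁, w₁, y₂, w₂} : Set C), IsIdempotentElem (q z ^ M) := by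
    refine ⟨m y₁ * m w₁ * m y₂ * m w₂, by simp [hm0], ?_⟩
    intro z hz
    have : m z ∣ m y₁ * m w₁ * m y₂ * m w₂ := by
      rcases hz with rfl | rfl | rfl | rfl
      · exact ⟨m w₁ * m y₂ * m w₂, by ring⟩
      · exact ⟨m y₁ * m y₂ * m w₂, by ring⟩
      · exact ⟨m y₁ * m w₁ * m w₂, by ring⟩
      · exact ⟨m y₁ * m w₁ * m y₂, by ring⟩
    obtain ⟨k, hk⟩ := this
    rw [hk, pow_mul]
    exact (hm z).pow k
  obtain ⟨M, hM0, hM⟩ := hM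
  have h₁ := h₁.pow M
  have h₂ := h₂.pow M
  simp only [← map_pow] at h₁ h₂ hM
  have hN : N * M ≠ 0 := mul_ne_zero hN hM0
  have q₁ : IsSplitPow (q b) (q e) (N * M) (q (y₁ ^ M)) (q (w₁ ^ M)) :=
    h₁.map (Ideal.Quotient.factor le_sup_left)
  have q₂ : IsSplitPow (q b) (q e) (N * M) (q (y₂ ^ M)) (q (w₂ ^ M)) :=
    h₂.map (Ideal.Quotient.factor le_sup_right)
  have hqe : q e * (1 - q e) = q b * q g := by simpa using congrArg q he
  have hy := q₁.fst_eq hqe q₂ (hM _ (by simp)) (hM _ (by simp))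
  have hw := q₁.swap.fst_eq (g := q g) (by rw [← hqe]; ring) q₂.swap (hM _ (by simp))
    (hM _ (by simp))
  have glue : ∀ {u v : C}, q u = q v → ∃ z, Ideal.Quotient.mk J z = Ideal.Quotient.mk J u ∧
      Ideal.Quotient.mk 𝔭 z = Ideal.Quotient.mk 𝔭 v := by
    intro u v huv
    obtain ⟨j, hj, p, hp, hjp⟩ := Submodule.mem_sup.1 (Ideal.Quotient.eq.1 huv)
    refine ⟨u - j, ?_, ?_⟩ <;> rw [Ideal.Quotient.eq]
    · simpa using hj
    · have : u - j - v = p := by linear_combination -hjp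
      rwa [this]
  obtain ⟨y, hyJ, hyp⟩ := glue hy
  obtain ⟨w, hwJ, hwp⟩ := glue hw
  rw [← hyJ, ← hwJ] at h₁
  rw [← hyp, ← hwp] at h₂
  have hco : ∀ {y e : C}, IsCoprime (Ideal.Quotient.mk J y) (Ideal.Quotient.mk J e) →
      IsCoprime (Ideal.Quotient.mk 𝔭 y) (Ideal.Quotient.mk 𝔭 e) →
      IsCoprime (Ideal.Quotient.mk (J ⊓ 𝔭) y) (Ideal.Quotient.mk (J ⊓ 𝔭) e) := by
    rintro y e ⟨a, c, hJ⟩ ⟨a', c', hp⟩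
    obtain ⟨a, rfl⟩ := Ideal.Quotient.mk_surjective a
    obtain ⟨c, rfl⟩ := Ideal.Quotient.mk_surjective c
    obtain ⟨a', rfl⟩ := Ideal.Quotient.mk_surjective a'
    obtain ⟨c', rfl⟩ := Ideal.Quotient.mk_surjective c'
    simp only [← map_mul, ← map_add] at hJ hp
    rw [← map_one (Ideal.Quotient.mk _), Ideal.Quotient.eq] at hJ hp
    refine ⟨Ideal.Quotient.mk _ (a + a' - a * (a' * y + c' * e)),
      Ideal.Quotient.mk _ (c + c' - c * (a' * y + c' * e)), ?_⟩
    simp only [← map_mul, ← map_add]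
    rw [← map_one (Ideal.Quotient.mk _), Ideal.Quotient.eq]
    have : (a + a' - a * (a' * y + c' * e)) * y + (c + c' - c * (a' * y + c' * e)) * e - 1 =
      -((a * y + c * e - 1) * (a' * y + c' * e - 1)) := by ring
    rw [this]
    exact neg_mem ⟨J.mul_mem_right _ hJ, 𝔭.mul_mem_left _ hp⟩
  refine ⟨N * M, Ideal.Quotient.mk _ y, Ideal.Quotient.mk _ w, hN, ?_, hco h₁.2.1 h₂.2.1, ?_⟩
  · have e1 := h₁.1
    have e2 := h₂.1
    rw [← map_mul, ← map_pow, Ideal.Quotient.eq] at e1 e2 ⊢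
    exact ⟨e1, e2⟩
  · simpa using hco (y := w) (e := 1 - e) (by simpa using h₁.2.2) (by simpa using h₂.2.2)

end Factorization

theorem exists_isSplitPow_of_isDomain {F D : Type*} [Field F] [Finite F] [CommRing D] [IsDomain D]
    [Algebra F D] (h : ∀ x y : D, ¬ AlgebraicIndependent F ![x, y]) {b e g : D}
    (he : e * (1 - e) = b * g) : ∃ N y w, N ≠ 0 ∧ IsSplitPow b e N y w := by
  by_cases hb : b = 0
  · rcases mul_eq_zero.1 (he.trans (by rw [hb, zero_mul])) with h0 | h1
    · exact ⟨1, 1, 0, one_ne_zero, by simp [hb], isCoprime_one_left,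
      by simpa [h0] using isCoprime_one_right⟩
    · exact ⟨1, 0, 1, one_ne_zero, by simp [hb],
      by simpa [← sub_eq_zero.1 h1] using isCoprime_one_right, isCoprime_one_left⟩
  let S := Algebra.adjoin F ({b, e, g} : Set D)
  have hS : ({b, e, g} : Set D) ⊆ S := Algebra.subset_adjoin
  let b' : S := ⟨b, hS (by simp)⟩
  let e' : S := ⟨e, hS (by simp)⟩
  let g' : S := ⟨g, hS (by simp)⟩
  have he' : e' * (1 - e') = b' * g' := Subtype.ext he
  have hb' : b' ≠ 0 := fun hh => hb (congrArg Subtype.val hh)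
  suffices ∃ N y w, N ≠ 0 ∧ IsSplitPow b' e' N y w by
    obtain ⟨N, y, w, hN, hs⟩ := this
    exact ⟨N, _, _, hN, hs.map S.val.toRingHom⟩
  have : Algebra.FiniteType F S :=
    S.fg_iff_finiteType.1 (Subalgebra.fg_def.2 ⟨_, by simp, rfl⟩)
  obtain ⟨s, φ, hφ, hfin⟩ := exists_finite_inj_algHom_of_fg F S
  have hs : s < 2 := by
    by_contra! hs
    refine h (φ (MvPolynomial.X ⟨0, by omega⟩) : S) (φ (MvPolynomial.X ⟨1, by omega⟩) : S) ?_
    have h1 : AlgebraicIndependent F (MvPolynomial.X : Fin s → MvPolynomial (Fin s) F) :=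
      MvPolynomial.algebraicIndependent_X _ _
    have h2 := (h1.map' (f := S.val.comp φ) (Subtype.val_injective.comp hφ)).comp
      ![⟨0, by omega⟩, ⟨1, by omega⟩] (by
        intro i j
        fin_cases i <;> fin_cases j <;> simp)
    convert h2 using 1
    ext i
    fin_cases i <;> rfl
  interval_cases s
  · have h1 : (algebraMap F S).Finite := by
      have := hfin.comp (RingHom.Finite.of_surjective
        (MvPolynomial.isEmptyAlgEquiv F (Fin 0)).symm.toAlgHom.toRingHom
        (MvPolynomial.isEmptyAlgEquiv F (Fin 0)).symm.surjective)
      have he : algebraMap F S = φ.toRingHom.comp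
          (MvPolynomial.isEmptyAlgEquiv F (Fin 0)).symm.toAlgHom.toRingHom := by
        ext x
        exact congrArg Subtype.val
          ((φ.comp (MvPolynomial.isEmptyAlgEquiv F (Fin 0)).symm.toAlgHom).commutes x).symm
      rwa [he]
    have : Module.Finite F S := RingHom.finite_algebraMap.1 h1
    have : Finite S := Module.finite_of_finite F
    have hu : IsUnit b' := by
      obtain ⟨c, hc⟩ := (Finite.isField_of_domain S).mul_inv_cancel hb'
      exact .of_mul_eq_one _ hc
    exact ⟨1, 1, b', one_ne_zero, by simp, isCoprime_one_left,
      hu.elim fun u hu => ⟨↑u⁻¹, 0, by simp [← hu]⟩⟩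
  · let ψ : F[X] →+* S :=
      φ.toRingHom.comp (MvPolynomial.uniqueAlgEquiv F (Fin 1)).symm.toAlgHom.toRingHom
    have hψ : Function.Injective ψ :=
      hφ.comp (MvPolynomial.uniqueAlgEquiv F (Fin 1)).symm.injective
    have hψf : ψ.Finite := RingHom.Finite.comp hfin (RingHom.Finite.of_surjective
      (MvPolynomial.uniqueAlgEquiv F (Fin 1)).symm.toAlgHom.toRingHom
      (MvPolynomial.uniqueAlgEquiv F (Fin 1)).symm.surjective)
    let := ψ.toAlgebra
    have : Module.Finite F[X] S := hψf
    have : FaithfulSMul F[X] S := (faithfulSMul_iff_algebraMap_injective _ _).2 hψ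
    have : Module.IsTorsionFree F[X] S := inferInstance
    exact exists_pow_eq_mul_of_finite_polynomial F hb' he'

/-- If any two elements of `C` are algebraically dependent over a finite field modulo every prime
ideal, then every element which is idempotent modulo `b` comes from a factorization of a power
of `b`. -/
theorem exists_isSplitPow {F C : Type*} [Field F] [Finite F] [CommRing C] [IsNoetherianRing C]
    [Algebra F C]
    (h : ∀ (𝔭 : Ideal C) [𝔭.IsPrime] (x y : C ⧸ 𝔭), ¬ AlgebraicIndependent F ![x, y])
    {b e g : C} (he : e * (1 - e) = b * g) : ∃ N y w, N ≠ 0 ∧ IsSplitPow b e N y w := by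
  classical
  cases subsingleton_or_nontrivial C
  · exact ⟨1, 1, 1, one_ne_zero, Subsingleton.elim _ _, isCoprime_one_left, isCoprime_one_left⟩
  have hfin : ∀ s : Finset (Ideal C), (∀ 𝔭 ∈ s, 𝔭.IsPrime) → ∃ N y w, N ≠ 0 ∧
      IsSplitPow (Ideal.Quotient.mk (s.inf id) b) (Ideal.Quotient.mk (s.inf id) e) N y w := by
    intro s
    induction s using Finset.induction with
    | empty =>
      intro _
      have : Subsingleton (C ⧸ (∅ : Finset (Ideal C)).inf id) :=
        Ideal.Quotient.subsingleton_iff.2 (by simp)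
      exact ⟨1, 1, 1, one_ne_zero, Subsingleton.elim _ _, isCoprime_one_left, isCoprime_one_left⟩
    | insert 𝔭 s hs ih =>
      intro hp
      have : 𝔭.IsPrime := hp 𝔭 (by simp)
      rw [Finset.inf_insert, id_eq, inf_comm]
      refine exists_isSplitPow_inf he (h 𝔭) (ih fun 𝔮 hq => hp 𝔮 (by simp [hq])) ?_
      exact exists_isSplitPow_of_isDomain (h 𝔭) (g := Ideal.Quotient.mk 𝔭 g)
        (by simpa using congrArg (Ideal.Quotient.mk 𝔭) he)
  have hmin : (minimalPrimes C).Finite := minimalPrimes.finite_of_isNoetherianRing C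
  have hall := hfin hmin.toFinset fun 𝔭 hp => by
    rw [Set.Finite.mem_toFinset] at hp
    exact hp.1.1
  have hnil : hmin.toFinset.inf id = nilradical C := by
    rw [Finset.inf_id_eq_sInf, Set.Finite.coe_toFinset]
    exact Ideal.sInf_minimalPrimes
  rw [hnil] at hall
  obtain ⟨N, y, w, hN, hs⟩ := hall
  obtain ⟨y, rfl⟩ := Ideal.Quotient.mk_surjective y
  obtain ⟨w, rfl⟩ := Ideal.Quotient.mk_surjective w
  have hco : ∀ {y e : C}, IsCoprime (Ideal.Quotient.mk (nilradical C) y)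
      (Ideal.Quotient.mk (nilradical C) e) → IsCoprime y e := by
    rintro y e ⟨a, c, hac⟩
    obtain ⟨a, rfl⟩ := Ideal.Quotient.mk_surjective a
    obtain ⟨c, rfl⟩ := Ideal.Quotient.mk_surjective c
    rw [← map_mul, ← map_mul, ← map_add, ← map_one (Ideal.Quotient.mk _), Ideal.Quotient.eq] at hac
    have hu : IsUnit (a * y + c * e) := by
      have := IsNilpotent.isUnit_add_one (mem_nilradical.1 hac)
      simpa using this
    obtain ⟨u, hu⟩ := hu.exists_left_inv
    exact ⟨u * a, u * c, by rw [← hu]; ring⟩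
  obtain ⟨p, hp⟩ := ExpChar.exists F
  have : ExpChar C p := expChar_of_injective_algebraMap (algebraMap F C).injective p
  have h1 := hs.1
  rw [← map_pow, ← map_mul, Ideal.Quotient.eq] at h1
  obtain ⟨K, hK⟩ := mem_nilradical.1 h1
  have hpK : K ≤ p ^ K ∨ p = 1 := by
    rcases expChar_is_prime_or_one F p with hp | hp
    · exact Or.inl (Nat.lt_pow_self hp.one_lt).le
    · exact Or.inr hp
  have hp1 : p ≠ 1 := by
    rintro rfl
    have : CharZero F := charZero_of_expChar_one' F
    exact not_finite F
  refine ⟨N * p ^ K, y ^ p ^ K, w ^ p ^ K, mul_ne_zero hN (pow_ne_zero _ (expChar_pos F p).ne'), ?_,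
    (hco hs.2.1).pow_left, (hco (y := w) (e := 1 - e) (by simpa using hs.2.2)).pow_left⟩
  rw [pow_mul, ← mul_pow, ← sub_eq_zero, ← sub_pow_expChar_pow]
  exact pow_eq_zero_of_le (hpK.resolve_right hp1) hK

section Quotient

variable {B : Type*} [CommRing B] {𝔠 : Ideal B} {x y : B}

theorem mem_span_singleton_sup_iff :
    x ∈ Ideal.span {y} ⊔ 𝔠 ↔ Ideal.Quotient.mk 𝔠 y ∣ Ideal.Quotient.mk 𝔠 x := by
  rw [← Ideal.mem_span_singleton, ← Set.image_singleton, ← Ideal.map_span, ← Ideal.mem_comap,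
    Ideal.comap_map_of_surjective _ Ideal.Quotient.mk_surjective, ← RingHom.ker_eq_comap_bot,
    Ideal.mk_ker]

theorem span_pair_sup_eq_top_iff : Ideal.span {x, y} ⊔ 𝔠 = ⊤ ↔
    IsCoprime (Ideal.Quotient.mk 𝔠 x) (Ideal.Quotient.mk 𝔠 y) := by
  rw [← Ideal.isCoprime_span_singleton_iff, Ideal.isCoprime_iff_sup_eq, ← Ideal.span_union,
    Set.singleton_union]
  have : ({Ideal.Quotient.mk 𝔠 x, Ideal.Quotient.mk 𝔠 y} : Set (B ⧸ 𝔠)) =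
    Ideal.Quotient.mk 𝔠 '' {x, y} := by rw [Set.image_pair]
  rw [this, ← Ideal.map_span]
  conv_lhs => rw [← Ideal.mk_ker (I := 𝔠), RingHom.ker_eq_comap_bot,
    ← Ideal.comap_map_of_surjective _ Ideal.Quotient.mk_surjective]
  rw [Ideal.comap_eq_top_iff]

end Quotient

section Interpolation

variable {k : Type*} [Field k] {ι : Type*} {S : Finset ι} {μ : ι → k}

theorem pairwise_isCoprime_X_sub_C_pow (hμ : Set.InjOn μ S) (K : ℕ) :
    (S : Set ι).Pairwise (Function.onFun IsCoprime fun i => (X - C (μ i)) ^ K) := by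
  intro i hi j hj hij
  refine IsCoprime.pow (isCoprime_X_sub_C_of_isUnit_sub ?_)
  exact (sub_ne_zero.2 fun h => hij (hμ hi hj h)).isUnit

theorem exists_forall_X_sub_C_pow_dvd (hμ : Set.InjOn μ S) (ν : ι → k) (K : ℕ) :
    ∃ g : k[X], ∀ i ∈ S, (X - C (μ i)) ^ K ∣ g - C (ν i) := by
  obtain ⟨g, hg⟩ := Ideal.exists_forall_sub_mem_ideal (ι := S)
    (I := fun i => Ideal.span {(X - C (μ i)) ^ K}) (fun i j hij => by
      rw [Function.onFun, Ideal.isCoprime_span_singleton_iff]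
      exact pairwise_isCoprime_X_sub_C_pow hμ K i.2 j.2 (Subtype.coe_ne_coe.2 hij))
    (fun i => C (ν i))
  exact ⟨g, fun i hi => Ideal.mem_span_singleton.1 (hg ⟨i, hi⟩)⟩

theorem prod_X_sub_C_pow_dvd (hμ : Set.InjOn μ S) {K : ℕ} {f : k[X]}
    (h : ∀ i ∈ S, (X - C (μ i)) ^ K ∣ f) : (∏ i ∈ S, (X - C (μ i))) ^ K ∣ f := by
  rw [← Finset.prod_pow]
  exact Finset.prod_dvd_of_coprime (pairwise_isCoprime_X_sub_C_pow hμ K) h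

theorem prod_X_sub_C_dvd_of_eval_eq_zero (hμ : Set.InjOn μ S) {f : k[X]}
    (h : ∀ i ∈ S, f.eval (μ i) = 0) : (∏ i ∈ S, (X - C (μ i))) ∣ f := by
  rw [← pow_one (∏ i ∈ S, (X - C (μ i)))]
  exact prod_X_sub_C_pow_dvd hμ fun i hi => by rw [pow_one]; exact dvd_iff_isRoot.2 (h i hi)

end Interpolation

/-- If the idempotents of all quotients `B ⧸ (𝔠 + (b))` come from factorizations of powers of `b`
modulo `𝔠`, then a pair `(c, b)` such that modulo `b` the element `c` is a root of a product of
distinct linear factors with nonzero roots is equivalent to `(1, 0)`. -/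
theorem PairRel.of_prod_mem {k B ι : Type*} [Field k] [IsAlgClosed k] [CommRing B] [Algebra k B]
    {𝔠 : Ideal B} {r : B → B → B → B → Prop} (hr : PairRel 𝔠 r)
    (hL : ∀ b e g : B ⧸ 𝔠, e * (1 - e) = b * g → ∃ N y w, N ≠ 0 ∧ IsSplitPow b e N y w)
    (S : Finset ι) : ∀ μ : ι → k, Set.InjOn μ S → (∀ i ∈ S, μ i ≠ 0) → ∀ c b : B,
      ∏ i ∈ S, (c - algebraMap k B (μ i)) ∈ Ideal.span {b} ⊔ 𝔠 → r c b 1 0 := by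
  classical
  induction S using Finset.induction with
  | empty =>
    intro μ _ _ c b h
    rw [Finset.prod_empty, ← Ideal.eq_top_iff_one] at h
    refine hr.trans (hr.fst (x' := 1) ?_) (hr.snd ?_)
    · rw [h]; trivial
    · rw [Ideal.span_singleton_one, top_sup_eq]; trivial
  | insert i₀ S hi₀ ih =>
    intro μ hμ hμ0 c b h
    set q := Ideal.Quotient.mkₐ k 𝔠 with hq
    have hqm : ∀ x, Ideal.Quotient.mk 𝔠 x = q x := fun _ => rfl
    have hqa : ∀ f : k[X], q (aeval c f) = aeval (q c) f := fun f =>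
      (aeval_algHom_apply q c f).symm
    set P : k[X] := ∏ i ∈ insert i₀ S, (X - C (μ i)) with hP
    set P' : k[X] := ∏ i ∈ S, (X - C (μ i)) with hP'
    have hPP' : P = (X - C (μ i₀)) * P' := Finset.prod_insert hi₀
    have hbP : q b ∣ aeval (q c) P := by
      rw [mem_span_singleton_sup_iff, hqm, hqm] at h
      convert h using 1
      simp [hP, map_prod]
    have hbPow : ∀ (K : ℕ) (f : k[X]), P ^ K ∣ f → q b ^ K ∣ aeval (q c) f := by
      rintro K f ⟨f, rfl⟩
      rw [map_mul, map_pow]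
      exact (pow_dvd_pow_of_dvd hbP K).mul_right _
    have hbP1 : ∀ f : k[X], P ∣ f → q b ∣ aeval (q c) f := fun f hf => by
      simpa using hbPow 1 f (by simpa using hf)
    have hμS : Set.InjOn μ S := hμ.mono (by simp)
    set u : k := ∏ i ∈ S, (μ i₀ - μ i) with hu
    have hu0 : u ≠ 0 := Finset.prod_ne_zero_iff.2 fun i hi => sub_ne_zero.2 fun hh =>
      hi₀ (by rwa [hμ (by simp) (by simp [hi]) hh])
    set E : k[X] := C u⁻¹ * P' with hE
    have hP'E : P' = C u * E := by
      rw [hE, ← mul_assoc, ← C_mul, mul_inv_cancel₀ hu0, C_1, one_mul]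
    have hE0 : E.eval (μ i₀) = 1 := by
      simp [hE, hP', eval_prod, ← hu, hu0]
    have hEi : ∀ i ∈ S, E.eval (μ i) = 0 := by
      intro i hi
      rw [hE, eval_mul, hP', eval_prod, Finset.prod_eq_zero hi (by simp), mul_zero]
    obtain ⟨g₀, hg₀⟩ := hbP1 (E * (1 - E)) (prod_X_sub_C_dvd_of_eval_eq_zero hμ (by
      intro i hi
      rcases Finset.mem_insert.1 hi with rfl | hi
      · simp [hE0]
      · simp [hEi i hi]))
    obtain ⟨N, y, w, hN, hNyw, hye, hwe⟩ := hL (q b) (aeval (q c) E) g₀ (by simpa using hg₀)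
    obtain ⟨y, rfl⟩ := Ideal.Quotient.mk_surjective y
    obtain ⟨w, rfl⟩ := Ideal.Quotient.mk_surjective w
    rw [hqm] at hye hwe hNyw
    rw [hqm] at hNyw
    choose! ν hν using fun a : k => IsAlgClosed.exists_pow_nat_eq a
      (Nat.pos_of_ne_zero (mul_ne_zero two_ne_zero hN))
    obtain ⟨t, ht⟩ : ∃ t : k → k, ∀ a, t a ^ 2 = a := by
      choose! t ht using fun a : k => IsAlgClosed.exists_pow_nat_eq a two_pos
      exact ⟨t, ht⟩
    obtain ⟨g, hg⟩ := exists_forall_X_sub_C_pow_dvd hμ (fun i => ν (μ i)) (2 * N)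
    obtain ⟨f, hf⟩ := exists_forall_X_sub_C_pow_dvd hμ (fun i => t (ν (μ i))) (2 * N)
    have hdvd1 : ∀ i, (X - C (μ i)) ∣ (X - C (μ i)) ^ (2 * N) := fun i =>
      dvd_pow_self _ (mul_ne_zero two_ne_zero hN)
    have hgi : ∀ i ∈ insert i₀ S, g.eval (μ i) = ν (μ i) := by
      intro i hi
      have := dvd_iff_isRoot.1 ((hdvd1 i).trans (hg i hi))
      rw [IsRoot.def, eval_sub, eval_C, sub_eq_zero] at this
      exact this
    set γ := aeval c g with hγ
    have hqγ : q γ = aeval (q c) g := hqa g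
    have h1 : q b ∣ q γ ^ (2 * N) - q c := by
      have := hbP1 (g ^ (2 * N) - X) (prod_X_sub_C_dvd_of_eval_eq_zero hμ (by
        intro i hi
        rw [eval_sub, eval_pow, hgi i hi, eval_X, hν, sub_self]))
      simpa [hqγ] using this
    have hcb : IsCoprime (q c) (q b) := by
      obtain ⟨z, hz⟩ := hbP
      have hP0 : P.coeff 0 ≠ 0 := by
        rw [coeff_zero_eq_eval_zero, hP, eval_prod]
        exact Finset.prod_ne_zero_iff.2 fun i hi => by simpa using hμ0 i hi
      refine ⟨-(algebraMap k _ (P.coeff 0)⁻¹ * aeval (q c) P.divX),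
        algebraMap k _ (P.coeff 0)⁻¹ * z, ?_⟩
      have h2 : aeval (q c) P = aeval (q c) P.divX * q c + algebraMap k _ (P.coeff 0) := by
        conv_lhs => rw [← divX_mul_X_add P]
        simp
      have h3 : algebraMap k (B ⧸ 𝔠) (P.coeff 0)⁻¹ * algebraMap k _ (P.coeff 0) = 1 := by
        rw [← map_mul, inv_mul_cancel₀ hP0, map_one]
      linear_combination h3 - algebraMap k _ (P.coeff 0)⁻¹ * hz +
        algebraMap k _ (P.coeff 0)⁻¹ * h2
    have hγb : IsCoprime (q γ) (q b) := by
      obtain ⟨z, hz⟩ := h1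
      have : IsCoprime (q γ ^ (2 * N)) (q b) := by
        rw [show q γ ^ (2 * N) = q c + q b * z by rw [← hz]; ring]
        exact IsCoprime.add_mul_left_left hcb z
      exact (IsCoprime.pow_left_iff (by omega)).1 this
    have hNe : 0 < N := Nat.pos_of_ne_zero hN
    refine hr.trans (hr.fst (x' := (γ ^ N) ^ 2) ?_) (hr.trans (hr.sq_swap
      (i := algebraMap k B (t (-1))) ?_ ?_) (?_ : r (γ ^ N) (b ^ 2) 1 0))
    · rw [mem_span_singleton_sup_iff, hqm, hqm, map_sub, map_pow, map_pow, ← pow_mul, mul_comm N]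
      exact h1
    · rw [← map_pow, ht, map_neg, map_one]
    · rw [span_pair_sup_eq_top_iff, hqm, hqm, map_pow]
      exact hγb.pow_left
    obtain ⟨M, rfl⟩ : ∃ M, N = M + 1 := ⟨N - 1, by omega⟩
    refine hr.trans (hr.pow_swap (s := aeval c f) (t := b) ?_ ?_ ?_ M) ?_
    · rw [mem_span_singleton_sup_iff, hqm, hqm, map_sub, map_pow, map_pow, hqa, hqγ]
      have h2 : P ^ (2 * (M + 1)) ∣ f ^ 2 - g := by
        refine prod_X_sub_C_pow_dvd hμ fun i hi => ?_
        have : f ^ 2 - g = (f - C (t (ν (μ i)))) * (f + C (t (ν (μ i)))) - (g - C (ν (μ i))) := by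
          have : C (t (ν (μ i))) ^ 2 = C (ν (μ i)) := by rw [← C_pow, ht]
          linear_combination this
        rw [this]
        exact dvd_sub ((hf i hi).mul_right _) (hg i hi)
      have h3 := hbPow _ _ h2
      rw [map_sub, map_pow] at h3
      exact (pow_dvd_pow _ (by omega)).trans h3
    · rw [sub_self]; exact zero_mem _
    · rw [span_pair_sup_eq_top_iff, hqm, hqm, map_pow]
      exact hγb.pow_right
    have hy1 : q y ∣ q γ - algebraMap k _ (ν (μ i₀)) := by
      have h2 : q b ∣ (q c - algebraMap k _ (μ i₀)) * aeval (q c) E := by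
        have := hbP1 ((X - C (μ i₀)) * E) (by rw [hPP', hE]; exact ⟨C u⁻¹, by ring⟩)
        simpa using this
      have h3 := pow_dvd_pow_of_dvd h2 (M + 1)
      rw [hNyw, mul_pow] at h3
      have h4 := hye.pow_right.dvd_of_dvd_mul_right ((dvd_mul_right _ _).trans h3)
      have h5 := (pow_dvd_pow (X - C (μ i₀)) (by omega : M + 1 ≤ 2 * (M + 1))).trans
        (hg i₀ (by simp))
      obtain ⟨z, hz⟩ := h5
      have h6 := congrArg (aeval (q c)) hz
      simp only [map_sub, map_mul, map_pow, aeval_X, aeval_C] at h6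
      rw [hqγ, h6]
      exact h4.mul_right _
    have hw1 : q w ^ 2 ∣ ∏ i ∈ S, (q γ - algebraMap k _ (ν (μ i))) := by
      have h3 := pow_dvd_pow_of_dvd (Dvd.intro _ hg₀.symm) (M + 1)
      rw [hNyw, map_mul, map_sub, map_one, mul_pow] at h3
      have h4 := hwe.pow_right.dvd_of_dvd_mul_right ((dvd_mul_left _ _).trans h3)
      have h5 : P' ^ (2 * (M + 1)) ∣ ∏ i ∈ S, (g - C (ν (μ i))) := by
        rw [hP', ← Finset.prod_pow]
        exact Finset.prod_dvd_prod_of_dvd _ _ fun i hi => hg i (by simp [hi])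
      obtain ⟨z, hz⟩ := h5
      have h6 := congrArg (aeval (q c)) hz
      rw [hP'E] at h6
      simp only [map_sub, map_mul, map_prod, map_pow, aeval_C] at h6
      rw [hqγ, h6, mul_pow, mul_comm 2, pow_mul (aeval (q c) E)]
      exact ((pow_dvd_pow_of_dvd h4 2).mul_left _).mul_right _
    obtain ⟨z, hz⟩ := hy1
    obtain ⟨z, rfl⟩ := Ideal.Quotient.mk_surjective z
    rw [hqm] at hz
    set γ' := algebraMap k B (ν (μ i₀)) + y * z with hγ'
    have hqγ' : q γ' = q γ := by
      rw [hγ', map_add, map_mul, AlgHom.commutes]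
      linear_combination -hz
    have hν0 : ∀ i ∈ insert i₀ S, ν (μ i) ≠ 0 := by
      intro i hi h0
      have := hν (μ i)
      rw [h0, zero_pow (by omega)] at this
      exact hμ0 i hi this.symm
    have hγ'y : IsCoprime γ' y := by
      refine IsCoprime.add_mul_left_left ?_ z
      refine ⟨algebraMap k B (ν (μ i₀))⁻¹, 0, ?_⟩
      rw [← map_mul, inv_mul_cancel₀ (hν0 i₀ (by simp)), map_one, zero_mul, add_zero]
    refine hr.trans (hr.fst (x' := γ') ?_) (hr.trans (hr.snd (y' := w ^ 2 * y ^ 2) ?_)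
      (hr.trans (hr.sq hγ'y ?_) (ih (ν ∘ μ) ?_ ?_ _ _ ?_)))
    · rw [mem_span_singleton_sup_iff, hqm, hqm, map_sub, hqγ', sub_self]
      exact dvd_zero _
    · rw [mem_span_singleton_sup_iff, hqm, hqm]
      have : q (w ^ 2 * y ^ 2 - (b ^ 2) ^ (M + 1)) = 0 := by
        simp only [map_sub, map_mul, map_pow]
        rw [← pow_mul, mul_comm 2, pow_mul, hNyw]
        ring
      rw [this]
      exact dvd_zero _
    · rw [span_pair_sup_eq_top_iff, hqm, hqm, hqγ', map_pow]
      have := (hγb.pow_right (n := M + 1))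
      rw [hNyw] at this
      exact this.of_mul_right_right.pow_right
    · intro i hi j hj hij
      refine hμS hi hj ?_
      rw [← hν (μ i), ← hν (μ j)]
      exact congrArg (· ^ _) hij
    · exact fun i hi => hν0 i (by simp [hi])
    · rw [mem_span_singleton_sup_iff, hqm, hqm]
      simpa [hqγ', map_prod] using hw1

theorem exists_isPrime_ne_bot_of_transcendental_of_isLocalization {R D : Type} (K T : Type)
    [CommRing R] [IsDomain R] [CommRing D] [IsDomain D] [Algebra R D] [FaithfulSMul R D]
    [Field K] [Algebra R K] [IsFractionRing R K] [CommRing T] [Algebra K T] [Algebra D T]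
    [Algebra R T] [IsScalarTower R D T] [IsScalarTower R K T] [Algebra.FiniteType K T]
    [IsLocalization (Algebra.algebraMapSubmonoid D (nonZeroDivisors R)) T]
    {x : D} (hx : Transcendental R x) :
    ∃ 𝔭 : Ideal D, 𝔭.IsPrime ∧ 𝔭 ≠ ⊥ ∧ ∀ r : R, algebraMap R D r ∈ 𝔭 → r = 0 := by
  have hle : Algebra.algebraMapSubmonoid D (nonZeroDivisors R) ≤ nonZeroDivisors D := by
    rintro _ ⟨r, hr, rfl⟩
    have hr' := nonZeroDivisors.ne_zero hr
    rw [mem_nonZeroDivisors_iff_ne_zero]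
    simpa using hr'
  have hdom : IsDomain T := IsLocalization.isDomain_of_le_nonZeroDivisors _ hle
  obtain ⟨m, hm⟩ := Ideal.exists_maximal T
  refine ⟨m.comap (algebraMap D T), Ideal.IsPrime.comap _, ?_, ?_⟩
  · intro h
    have hm0 : m = ⊥ := by
      rw [← IsLocalization.map_under (Algebra.algebraMapSubmonoid D (nonZeroDivisors R)) T m]
      change Ideal.map _ (Ideal.comap _ _) = _
      rw [h, Ideal.map_bot]
    have hf : IsField T := by
      rw [Ring.isField_iff_maximal_bot, ← hm0]
      exact hm
    let := hf.toField
    have : Module.Finite K T := finite_of_finite_type_of_isJacobsonRing K T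
    have halg : IsAlgebraic K (algebraMap D T x) := Algebra.IsAlgebraic.isAlgebraic _
    have halg' : IsAlgebraic R (algebraMap D T x) := (IsFractionRing.isAlgebraic_iff R K T).2 halg
    exact hx ((isAlgebraic_algebraMap_iff (IsLocalization.injective T hle)).1 halg')
  · intro r hr'
    by_contra h0
    have h2 : IsUnit (algebraMap D T (algebraMap R D r)) :=
      IsLocalization.map_units T (⟨_, ⟨r, mem_nonZeroDivisors_iff_ne_zero.2 h0, rfl⟩⟩ :
        Algebra.algebraMapSubmonoid D (nonZeroDivisors R))
    exact hm.ne_top (Ideal.eq_top_of_isUnit_mem _ hr' h2)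

attribute [local instance] Algebra.TensorProduct.rightAlgebra in
open scoped TensorProduct in
theorem Transcendental.exists_isPrime_ne_bot {R D : Type}
    [CommRing R] [IsDomain R] [CommRing D] [IsDomain D] [Algebra R D] [FaithfulSMul R D]
    [Algebra.FiniteType R D] {x : D} (hx : Transcendental R x) :
    ∃ 𝔭 : Ideal D, 𝔭.IsPrime ∧ 𝔭 ≠ ⊥ ∧ ∀ r : R, algebraMap R D r ∈ 𝔭 → r = 0 :=
  exists_isPrime_ne_bot_of_transcendental_of_isLocalization
    (FractionRing R) (FractionRing R ⊗[R] D) hx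

theorem AlgebraicIndependent.natCast_le_ringKrullDim {k D : Type} [Field k] [CommRing D]
    [IsDomain D] [Algebra k D] [Algebra.FiniteType k D] {n : ℕ} {x : Fin n → D}
    (hx : AlgebraicIndependent k x) : (n : WithBot ℕ∞) ≤ ringKrullDim D := by
  induction n generalizing D with
  | zero => exact ringKrullDim_nonneg_of_nontrivial
  | succ n ih =>
    let R := Algebra.adjoin k (x '' {0}ᶜ)
    have htr : Transcendental R (x 0) := hx.transcendental_adjoin (by simp)
    have hft : Algebra.FiniteType R D := Algebra.FiniteType.of_restrictScalars_finiteType k R D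
    obtain ⟨𝔭, hprime, hne, hdisj⟩ := htr.exists_isPrime_ne_bot
    replace hdisj : ∀ r ∈ R, r ∈ 𝔭 → r = 0 :=
      fun r hr hr' => congrArg Subtype.val (hdisj ⟨r, hr⟩ hr')
    obtain ⟨r, hr, hr0⟩ := Submodule.exists_mem_ne_zero_of_ne_bot hne
    have hind : AlgebraicIndependent k (fun i : Fin n => Ideal.Quotient.mkₐ k 𝔭 (x i.succ)) := by
      rw [algebraicIndependent_iff] at hx ⊢
      intro f hf
      have h1 : MvPolynomial.aeval (fun i : Fin n => x i.succ) f ∈ 𝔭 := by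
        rw [← Ideal.Quotient.eq_zero_iff_mem, ← Ideal.Quotient.mkₐ_eq_mk k,
          MvPolynomial.comp_aeval_apply]
        exact hf
      have h2 := hdisj _ (by
        have : MvPolynomial.aeval (fun i : Fin n => x i.succ) f ∈
            (MvPolynomial.aeval (R := k) (fun i : Fin n => x i.succ)).range := ⟨f, rfl⟩
        rw [← Algebra.adjoin_range_eq_range_aeval] at this
        refine Algebra.adjoin_mono ?_ this
        rintro _ ⟨i, rfl⟩
        exact ⟨i.succ, by simp, rfl⟩) h1
      have h3 := hx (MvPolynomial.rename Fin.succ f) (by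
        rw [MvPolynomial.aeval_rename]; exact h2)
      exact MvPolynomial.rename_injective _ (Fin.succ_injective n) (by simpa using h3)
    have := ih hind
    calc ((n + 1 : ℕ) : WithBot ℕ∞) = n + 1 := by push_cast; rfl
      _ ≤ ringKrullDim (D ⧸ 𝔭) + 1 := by gcongr
      _ ≤ ringKrullDim D := ringKrullDim_succ_le_of_surjective (Ideal.Quotient.mk 𝔭)
        Ideal.Quotient.mk_surjective (mem_nonZeroDivisors_iff_ne_zero.2 hr0)
        (Ideal.Quotient.eq_zero_iff_mem.2 hr)

/-- Every integral quotient of `B` has transcendence degree at most `n` over `k`. -/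
def TrdegLE (k B : Type) [Field k] [CommRing B] [Algebra k B] (n : ℕ) : Prop :=
  ∀ (𝔭 : Ideal B) [𝔭.IsPrime], Algebra.trdeg k (B ⧸ 𝔭) ≤ n

theorem TrdegLE.of_ringKrullDim_le {k B : Type} [Field k] [CommRing B] [Algebra k B]
    [Algebra.FiniteType k B] {n : ℕ} (h : ringKrullDim B ≤ n) : TrdegLE k B n := by
  intro 𝔭 _
  obtain ⟨s, hs⟩ := exists_isTranscendenceBasis k (B ⧸ 𝔭)
  rw [← hs.cardinalMk_eq_trdeg]
  by_contra! hlt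
  obtain ⟨m, hm⟩ := Cardinal.lt_aleph0.1
    (hs.cardinalMk_eq_trdeg.trans_lt (trdeg_lt_aleph0_of_finiteType))
  have : Finite s := Cardinal.lt_aleph0_iff_finite.1 (hm ▸ Cardinal.natCast_lt_aleph0)
  have hcard : Nat.card s = m := by simp [Nat.card, hm]
  let e : Fin m ≃ s := (Finite.equivFinOfCardEq hcard).symm
  have h1 := (hs.1.comp e e.injective).natCast_le_ringKrullDim
  have h2 := h1.trans ((ringKrullDim_quotient_le 𝔭).trans h)
  rw [hm] at hlt
  have h3 : n < m := by exact_mod_cast hlt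
  have h4 : m ≤ n := by exact_mod_cast h2
  omega

section TrdegLE

variable {k B C : Type} [Field k] [CommRing B] [Algebra k B] [CommRing C] [Algebra k C] {n : ℕ}

theorem TrdegLE.of_surjective (h : TrdegLE k B n) (f : B →ₐ[k] C) (hf : Function.Surjective f) :
    TrdegLE k C n := by
  intro 𝔭 _
  have hp : (𝔭.comap f).IsPrime := Ideal.IsPrime.comap _
  refine (trdeg_le_of_surjective (Ideal.quotientMapₐ 𝔭 f le_rfl) ?_).trans (h (𝔭.comap f))
  exact Ideal.quotientMap_surjective (H := le_rfl) hf

theorem TrdegLE.quotient (h : TrdegLE k B n) (I : Ideal B) : TrdegLE k (B ⧸ I) n :=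
  h.of_surjective (Ideal.Quotient.mkₐ k I) Ideal.Quotient.mk_surjective

theorem TrdegLE.localizationAway (h : TrdegLE k B n) (g : B) :
    TrdegLE k (Localization.Away g) n := by
  intro 𝔓 _
  have hp : (𝔓.comap (algebraMap B (Localization.Away g))).IsPrime := Ideal.IsPrime.comap _
  set 𝔭 := 𝔓.comap (algebraMap B (Localization.Away g)) with h𝔭
  let f : B ⧸ 𝔭 →ₐ[k] Localization.Away g ⧸ 𝔓 :=
    Ideal.quotientMapₐ 𝔓 (Algebra.algHom k B (Localization.Away g)) le_rfl
  have hf : Function.Injective f := Ideal.quotientMap_injective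
  have hst : IsScalarTower k (B ⧸ 𝔭) (Localization.Away g ⧸ 𝔓) :=
    IsScalarTower.of_algebraMap_eq fun x => (f.commutes x).symm
  have hfs : FaithfulSMul (B ⧸ 𝔭) (Localization.Away g ⧸ 𝔓) :=
    (faithfulSMul_iff_algebraMap_injective _ _).2 hf
  have halg : Algebra.IsAlgebraic (B ⧸ 𝔭) (Localization.Away g ⧸ 𝔓) := by
    refine ⟨fun z => ?_⟩
    obtain ⟨z, rfl⟩ := Ideal.Quotient.mk_surjective z
    obtain ⟨b, ⟨_, m, rfl⟩, rfl⟩ := IsLocalization.exists_mk'_eq (Submonoid.powers g) z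
    have hg : g ^ m ∉ 𝔭 := by
      intro hg
      exact Ideal.IsPrime.ne_top ‹_› (Ideal.eq_top_of_isUnit_mem 𝔓 hg
        (IsLocalization.map_units (Localization.Away g) (⟨g ^ m, m, rfl⟩ : Submonoid.powers g)))
    refine ⟨C (Ideal.Quotient.mk 𝔭 (g ^ m)) * X - C (Ideal.Quotient.mk 𝔭 b), ?_, ?_⟩
    · intro h0
      have := congrArg (fun q => q.coeff 1) h0
      simp only [coeff_sub, coeff_C_mul, coeff_X_one, mul_one, coeff_C_succ, sub_zero,
        coeff_zero] at this
      exact hg (Ideal.Quotient.eq_zero_iff_mem.1 this)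
    · simp only [map_sub, map_mul, aeval_C, aeval_X]
      change Ideal.Quotient.mk 𝔓 (algebraMap B _ (g ^ m)) * _ -
        Ideal.Quotient.mk 𝔓 (algebraMap B _ b) = 0
      rw [← map_mul, mul_comm]
      exact sub_eq_zero.2 (congrArg _ (IsLocalization.mk'_spec _ _ _))
  rw [← trdeg_add_eq k (B ⧸ 𝔭) (A := Localization.Away g ⧸ 𝔓), trdeg_eq_zero (R := B ⧸ 𝔭), add_zero]
  exact h 𝔭

theorem TrdegLE.not_algebraicIndependent (h : TrdegLE k B n) {ι : Type} [Finite ι]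
    (hι : n < Nat.card ι) (x : ι → B) : ¬ AlgebraicIndependent k x := by
  intro hx
  let M : Submonoid B :=
    (nonZeroDivisors (MvPolynomial ι k)).map (MvPolynomial.aeval (R := k) x : _ →* B)
  have hdisj : Disjoint ((⊥ : Ideal B) : Set B) (M : Set B) := by
    rw [Set.disjoint_left]
    rintro _ h0 ⟨q, hq, rfl⟩
    exact nonZeroDivisors.ne_zero hq ((algebraicIndependent_iff.1 hx) q (by simpa using h0))
  obtain ⟨𝔭, hp, -, hd⟩ := Ideal.exists_le_prime_disjoint ⊥ M hdisj
  have hind : AlgebraicIndependent k (fun i => Ideal.Quotient.mkₐ k 𝔭 (x i)) := by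
    rw [algebraicIndependent_iff]
    intro q hq
    by_contra h0
    have hM : MvPolynomial.aeval x q ∈ M :=
      Submonoid.mem_map.2 ⟨q, mem_nonZeroDivisors_iff_ne_zero.2 h0, rfl⟩
    refine Set.disjoint_right.1 hd hM ?_
    rw [SetLike.mem_coe, ← Ideal.Quotient.eq_zero_iff_mem, ← hq, ← Ideal.Quotient.mkₐ_eq_mk k,
      MvPolynomial.comp_aeval_apply]
  have h1 := hind.cardinalMk_le_trdeg.trans (h 𝔭)
  rw [← Nat.cast_card] at h1
  have : Nat.card ι ≤ n := by exact_mod_cast h1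
  omega

theorem TrdegLE.exists_aeval_eq_zero (h : TrdegLE k B n) {ι : Type} [Finite ι]
    (hι : n < Nat.card ι) (x : ι → B) :
    ∃ q : MvPolynomial ι k, q ≠ 0 ∧ MvPolynomial.aeval x q = 0 := by
  have := h.not_algebraicIndependent hι x
  rw [algebraicIndependent_iff] at this
  push Not at this
  obtain ⟨q, h1, h2⟩ := this
  exact ⟨q, h2, h1⟩

end TrdegLE

theorem TrdegLE.exists_forall_eval_ne_zero_pair {k B : Type} [Field k] [CommRing B] [Algebra k B]
    {n : ℕ} (h : TrdegLE k B n) (g : B) {ι : Type} [Finite ι] (hι : n < Nat.card ι + 2)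
    (a : ι → B) (x : Fin 2 → B) :
    ∃ G : MvPolynomial ι k, G ≠ 0 ∧ ∀ τ : ι → k, MvPolynomial.eval τ G ≠ 0 →
      ∀ (𝔮 : Ideal B) [𝔮.IsPrime], g ∉ 𝔮 → (∀ i, a i - algebraMap k B (τ i) * g ∈ 𝔮) →
        ¬ AlgebraicIndependent k (fun i => Ideal.Quotient.mkₐ k 𝔮 (x i)) := by
  let L := Localization.Away g
  let y : Fin 2 ⊕ ι → L := Sum.elim (fun j => algebraMap B L (x j))
    (fun i => algebraMap B L (a i) * IsLocalization.Away.invSelf g)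
  obtain ⟨q, hq0, hq⟩ := (h.localizationAway g).exists_aeval_eq_zero (ι := Fin 2 ⊕ ι)
    (by rw [Nat.card_sum]; simp; omega) y
  have hq0' : MvPolynomial.sumAlgEquiv k (Fin 2) ι q ≠ 0 := by simpa using hq0
  obtain ⟨m, hm⟩ := MvPolynomial.ne_zero_iff.1 hq0'
  refine ⟨_, hm, fun τ hτ 𝔮 _ hg ha hind => ?_⟩
  let D := FractionRing (B ⧸ 𝔮)
  let φ : B →ₐ[k] D := (Algebra.algHom k (B ⧸ 𝔮) D).comp (Ideal.Quotient.mkₐ k 𝔮)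
  have hker : ∀ b, φ b = 0 ↔ b ∈ 𝔮 := by
    intro b
    rw [← Ideal.Quotient.eq_zero_iff_mem]
    exact IsFractionRing.to_map_eq_zero_iff (R := B ⧸ 𝔮) (K := D)
  have hφg : φ g ≠ 0 := fun h => hg ((hker g).1 h)
  let ψ : L →+* D := IsLocalization.Away.lift g (g := (φ : B →+* D)) (IsUnit.mk0 _ hφg)
  have hψ : ∀ b, ψ (algebraMap B L b) = φ b := fun b => IsLocalization.Away.lift_eq g _ b
  have hψy : ∀ i, ψ (y i) = Sum.elim (fun j => φ (x j)) (fun i => algebraMap k D (τ i)) i := by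
    rintro (j | i)
    · exact hψ _
    · have h1 : ψ (IsLocalization.Away.invSelf g) * φ g = 1 := by
        rw [← hψ, ← map_mul, mul_comm, IsLocalization.Away.mul_invSelf, map_one]
      have h2 : φ (a i) = algebraMap k D (τ i) * φ g := by
        rw [← sub_eq_zero, ← AlgHom.commutes φ, ← map_mul, ← map_sub]
        exact (hker _).2 (ha i)
      change ψ (_ * _) = _
      rw [map_mul, hψ, h2, mul_assoc, mul_comm (φ g), h1, mul_one]
      rfl
  have hq1 : MvPolynomial.aeval (fun i => ψ (y i)) q = 0 := by
    have h1 : ψ (MvPolynomial.aeval y q) = 0 := by rw [hq, map_zero]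
    rw [MvPolynomial.aeval_def, MvPolynomial.hom_eval₂] at h1
    rw [MvPolynomial.aeval_def, ← h1]
    congr 1
    ext c
    simp only [RingHom.comp_apply]
    rw [IsScalarTower.algebraMap_apply k B L, hψ, AlgHom.commutes]
  let q' : MvPolynomial (Fin 2) k :=
    MvPolynomial.map (MvPolynomial.eval τ) (MvPolynomial.sumAlgEquiv k (Fin 2) ι q)
  have hq'0 : q' ≠ 0 := by
    intro h0
    apply hτ
    rw [← MvPolynomial.coeff_map]
    change MvPolynomial.coeff m q' = 0
    rw [h0, MvPolynomial.coeff_zero]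
  have hcomp : ((MvPolynomial.aeval (R := k) (fun j => φ (x j))).comp
      (MvPolynomial.mapAlgHom (MvPolynomial.aeval (R := k) τ))).comp
        (MvPolynomial.sumAlgEquiv k (Fin 2) ι).toAlgHom =
      MvPolynomial.aeval (fun i => ψ (y i)) := by
    refine MvPolynomial.algHom_ext fun i => ?_
    rw [MvPolynomial.aeval_X, hψy]
    rcases i with j | i
    · change MvPolynomial.aeval (R := k) (fun j => φ (x j)) (MvPolynomial.map _
        (MvPolynomial.sumAlgEquiv k (Fin 2) ι (MvPolynomial.X (Sum.inl j)))) = _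
      rw [MvPolynomial.sumAlgEquiv_X_inl, MvPolynomial.map_X, MvPolynomial.aeval_X]
      rfl
    · change MvPolynomial.aeval (R := k) (fun j => φ (x j)) (MvPolynomial.map _
        (MvPolynomial.sumAlgEquiv k (Fin 2) ι (MvPolynomial.X (Sum.inr i)))) = _
      rw [MvPolynomial.sumAlgEquiv_X_inr, MvPolynomial.map_C]
      simp
  refine hq'0 (algebraicIndependent_iff.1 hind q' ?_)
  apply IsFractionRing.injective (B ⧸ 𝔮) D
  rw [map_zero, ← hq1, ← hcomp, ← MvPolynomial.aeval_algebraMap_apply]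
  rfl

theorem Algebra.trdeg_le_one_of_adjoin_eq_top {k D : Type} [Field k] [CommRing D] [IsDomain D]
    [Algebra k D] (t : Set D) (ht : Algebra.adjoin k t = ⊤)
    (h : ∀ x y, x ∈ t → y ∈ t → ¬ AlgebraicIndependent k ![x, y]) : Algebra.trdeg k D ≤ 1 := by
  have : Algebra.IsAlgebraic (Algebra.adjoin k t) D :=
    ⟨fun x => isAlgebraic_algebraMap (⟨x, ht ▸ Algebra.mem_top⟩ : Algebra.adjoin k t)⟩
  obtain ⟨s, hst, hs⟩ := exists_isTranscendenceBasis_subset (R := k) t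
  rw [← hs.cardinalMk_eq_trdeg, Cardinal.le_one_iff_subsingleton]
  refine ⟨fun x y => ?_⟩
  by_contra hxy
  refine h x y (hst x.2) (hst y.2) ?_
  have := hs.1.comp ![x, y] (by
    intro i j hij
    fin_cases i <;> fin_cases j <;> simp_all)
  convert this using 1
  ext i
  fin_cases i <;> rfl

/-- Generic translates of `n - 1` elements cut out a locus of dimension at most one away from
the zeros of `g`. -/
theorem TrdegLE.exists_forall_eval_ne_zero {k B : Type} [Field k] [CommRing B] [Algebra k B]
    [Algebra.FiniteType k B] {n : ℕ} (h : TrdegLE k B n) (g : B) {ι : Type} [Finite ι]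
    (hι : n < Nat.card ι + 2) (a : ι → B) :
    ∃ G : MvPolynomial ι k, G ≠ 0 ∧ ∀ τ : ι → k, MvPolynomial.eval τ G ≠ 0 →
      ∀ (𝔮 : Ideal B) [𝔮.IsPrime], g ∉ 𝔮 → (∀ i, a i - algebraMap k B (τ i) * g ∈ 𝔮) →
        Algebra.trdeg k (B ⧸ 𝔮) ≤ 1 := by
  obtain ⟨t, ht⟩ := Algebra.FiniteType.out (R := k) (A := B)
  choose G hG0 hG using fun x : Fin 2 → B => h.exists_forall_eval_ne_zero_pair g hι a x
  refine ⟨∏ x ∈ t ×ˢ t, G ![x.1, x.2], Finset.prod_ne_zero_iff.2 fun x _ => hG0 _,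
    fun τ hτ 𝔮 _ hg ha => ?_⟩
  rw [map_prod, Finset.prod_ne_zero_iff] at hτ
  refine Algebra.trdeg_le_one_of_adjoin_eq_top (Ideal.Quotient.mkₐ k 𝔮 '' t) ?_ ?_
  · rw [← AlgHom.map_adjoin, ht, Algebra.map_top, AlgHom.range_eq_top]
    exact Ideal.Quotient.mk_surjective
  · rintro _ _ ⟨x, hx, rfl⟩ ⟨y, hy, rfl⟩ hind
    refine hG ![x, y] τ (hτ (x, y) (Finset.mem_product.2 ⟨hx, hy⟩)) 𝔮 hg ha ?_
    convert hind using 1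
    ext i
    fin_cases i <;> rfl

theorem MvPolynomial.exists_pderiv_ne_zero_of_irreducible {σ k : Type} [Field k] (p : ℕ)
    [Fact p.Prime] [CharP k p] [PerfectRing k p] {P : MvPolynomial σ k} (hP : Irreducible P) :
    ∃ i, MvPolynomial.pderiv i P ≠ 0 := by
  by_contra! h
  have hp : ∀ m ∈ P.support, ∀ i, p ∣ m i := by
    intro m hm i
    by_contra hmi
    have hpos : m i ≠ 0 := fun h0 => hmi (h0 ▸ dvd_zero p)
    have h1 := congrArg (MvPolynomial.coeff (m - Finsupp.single i 1)) (h i)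
    have hle : Finsupp.single i 1 ≤ m := by
      rw [Finsupp.single_le_iff]; omega
    rw [MvPolynomial.coeff_pderiv, tsub_add_cancel_of_le hle, MvPolynomial.coeff_zero] at h1
    have h2 : (((m - Finsupp.single i 1 : σ →₀ ℕ) i : ℕ) + 1 : k) = (m i : k) := by
      rw [Finsupp.tsub_apply, Finsupp.single_eq_same, ← Nat.cast_add_one,
        Nat.sub_add_cancel (Nat.one_le_iff_ne_zero.2 hpos)]
    rw [h2] at h1
    rcases mul_eq_zero.1 h1 with h3 | h3
    · exact MvPolynomial.mem_support_iff.1 hm h3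
    · exact hmi ((CharP.cast_eq_zero_iff k p _).1 h3)
  have : P = (∑ m ∈ P.support, MvPolynomial.monomial (m.mapRange (· / p) (Nat.zero_div p))
      ((frobeniusEquiv k p).symm (P.coeff m))) ^ p := by
    rw [sum_pow_char]
    conv_lhs => rw [P.as_sum]
    refine Finset.sum_congr rfl fun m hm => ?_
    rw [MvPolynomial.monomial_pow]
    have h1 : p • m.mapRange (· / p) (Nat.zero_div p) = m := by
      ext i
      simp [Nat.mul_div_cancel' (hp m hm i)]
    rw [h1, ← frobenius_def, ← frobeniusEquiv_apply, RingEquiv.apply_symm_apply]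
  rw [this] at hP
  exact not_irreducible_pow (Fact.out : p.Prime).ne_one hP

section Bertini

variable {ι k : Type} [Field k]

/-- The substitution `U_i ↦ U_i + lᵢ Z`, seen as an isomorphism `k[U, Z] ≃ k[U][Z]`. -/
noncomputable def shearEquiv (l : ι → k) :
    MvPolynomial (Option ι) k ≃ₐ[k] (MvPolynomial ι k)[X] :=
  (AlgEquiv.ofAlgHom
    (MvPolynomial.aeval fun o => o.elim (MvPolynomial.X none)
      fun i => MvPolynomial.X (some i) + MvPolynomial.C (l i) * MvPolynomial.X none)
    (MvPolynomial.aeval fun o => o.elim (MvPolynomial.X none)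
      fun i => MvPolynomial.X (some i) - MvPolynomial.C (l i) * MvPolynomial.X none)
    (by ext o; cases o <;> simp [MvPolynomial.algHom_C])
    (by ext o; cases o <;> simp [MvPolynomial.algHom_C])).trans (MvPolynomial.optionEquivLeft k ι)

theorem shearEquiv_X_none (l : ι → k) : shearEquiv l (MvPolynomial.X none) = X := by
  simp [shearEquiv, MvPolynomial.optionEquivLeft_X_none]

theorem shearEquiv_X_some (l : ι → k) (i : ι) :
    shearEquiv l (MvPolynomial.X (some i)) =
      C (MvPolynomial.X i) + C (MvPolynomial.C (l i)) * X := by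
  simp [shearEquiv, MvPolynomial.optionEquivLeft_X_none, MvPolynomial.optionEquivLeft_X_some,
    MvPolynomial.optionEquivLeft_C]

theorem shearEquiv_C (l : ι → k) (c : k) :
    shearEquiv l (MvPolynomial.C c) = C (MvPolynomial.C c) := by
  simp [shearEquiv, MvPolynomial.optionEquivLeft_C]

theorem derivative_shearEquiv [Fintype ι] (l : ι → k) (P : MvPolynomial (Option ι) k) :
    derivative (shearEquiv l P) = shearEquiv l (MvPolynomial.pderiv none P +
      ∑ i, MvPolynomial.C (l i) * MvPolynomial.pderiv (some i) P) := by
  classical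
  induction P using MvPolynomial.induction_on with
  | C a => simp [shearEquiv_C]
  | add p q hp hq =>
    simp only [map_add, hp, hq, mul_add, Finset.sum_add_distrib]
    ring
  | mul_X p o hp =>
    rw [map_mul, derivative_mul, hp]
    simp only [MvPolynomial.pderiv_mul, mul_add, Finset.sum_add_distrib, map_add, map_mul, map_sum,
      add_mul, Finset.sum_mul, MvPolynomial.pderiv_X]
    cases o with
    | none => simp [shearEquiv_X_none, mul_assoc]; ring
    | some i =>
      simp [shearEquiv_X_some, Pi.single_apply, shearEquiv_C, Finset.sum_ite_eq, mul_assoc]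
      ring

end Bertini

section Bertini

variable {ι k : Type} [Field k]

theorem exists_forall_derivative_shearEquiv_ne_zero [Fintype ι] [Infinite k] (p : ℕ)
    [Fact p.Prime] [CharP k p] [PerfectRing k p] (s : Finset (MvPolynomial (Option ι) k))
    (hs : ∀ P ∈ s, Irreducible P) :
    ∃ l : ι → k, ∀ P ∈ s, derivative (shearEquiv l P) ≠ 0 := by
  classical
  have key : ∀ P ∈ s, ∃ L : MvPolynomial ι k, L ≠ 0 ∧
      ∀ l, MvPolynomial.eval l L ≠ 0 → derivative (shearEquiv l P) ≠ 0 := by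
    intro P hP
    obtain ⟨o, ho⟩ := MvPolynomial.exists_pderiv_ne_zero_of_irreducible p (hs P hP)
    obtain ⟨m, hm⟩ := MvPolynomial.ne_zero_iff.1 ho
    let L : MvPolynomial ι k := MvPolynomial.C ((MvPolynomial.pderiv none P).coeff m) +
      ∑ i, MvPolynomial.X i * MvPolynomial.C ((MvPolynomial.pderiv (some i) P).coeff m)
    have hL : ∀ l, MvPolynomial.eval l L = (MvPolynomial.pderiv none P +
        ∑ i, MvPolynomial.C (l i) * MvPolynomial.pderiv (some i) P).coeff m := by
      intro l
      simp [L, MvPolynomial.coeff_sum, MvPolynomial.coeff_C_mul]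
    refine ⟨L, fun h0 => hm ?_, fun l hl h0 => ?_⟩
    · have h1 : (MvPolynomial.pderiv none P).coeff m = 0 := by
        have := congrArg (MvPolynomial.eval 0) h0
        simpa [L] using this
      cases o with
      | none => exact h1
      | some i =>
        have := congrArg (MvPolynomial.eval (Pi.single i 1)) h0
        simpa [L, h1, Pi.single_apply] using this
    · rw [derivative_shearEquiv, map_eq_zero_iff _ (shearEquiv l).injective] at h0
      rw [hL, h0, MvPolynomial.coeff_zero] at hl
      exact hl rfl
  choose! L hL0 hL using key
  have hne : ∏ P ∈ s, L P ≠ 0 := Finset.prod_ne_zero_iff.2 hL0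
  have : ∃ l, MvPolynomial.eval l (∏ P ∈ s, L P) ≠ 0 := by
    by_contra! h
    exact hne (MvPolynomial.funext fun l => by rw [h l, map_zero])
  obtain ⟨l, hl⟩ := this
  rw [map_prod, Finset.prod_ne_zero_iff] at hl
  exact ⟨l, fun P hP => hL P hP l (hl P hP)⟩

theorem exists_forall_separable_map_of_separable_map_fractionRing {S : Type} [CommRing S]
    [IsDomain S] {F : S[X]} (h : (F.map (algebraMap S (FractionRing S))).Separable) :
    ∃ r : S, r ≠ 0 ∧ ∀ {k : Type} [Field k] (φ : S →+* k), φ r ≠ 0 → (F.map φ).Separable := by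
  obtain ⟨u, v, huv⟩ := h
  obtain ⟨b, hb, hu⟩ := IsLocalization.integerNormalization_spec (nonZeroDivisors S) u
  obtain ⟨c, hc, hv⟩ := IsLocalization.integerNormalization_spec (nonZeroDivisors S) v
  set u' := IsLocalization.integerNormalization (nonZeroDivisors S) u
  set v' := IsLocalization.integerNormalization (nonZeroDivisors S) v
  have hinj : Function.Injective (mapRingHom (algebraMap S (FractionRing S))) :=
    map_injective _ (IsFractionRing.injective S _)
  have key : C c * u' * F + C b * v' * derivative F = C (b * c) := by
    apply hinj
    simp only [map_add, map_mul, coe_mapRingHom, map_C, ← derivative_map, hu, hv,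
      ← C_mul', ← algebraMap_smul (FractionRing S) b u, ← algebraMap_smul (FractionRing S) c v]
    linear_combination
      (C (algebraMap S (FractionRing S) b) * C (algebraMap S (FractionRing S) c)) * huv
  refine ⟨b * c, mul_ne_zero (nonZeroDivisors.ne_zero hb) (nonZeroDivisors.ne_zero hc), ?_⟩
  intro k _ φ hφ
  refine ⟨C (φ (b * c))⁻¹ * (C c * u').map φ, C (φ (b * c))⁻¹ * (C b * v').map φ, ?_⟩
  have := congrArg (Polynomial.map φ) key
  rw [Polynomial.map_add, Polynomial.map_mul, Polynomial.map_mul (q := derivative F), map_C,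
    ← derivative_map] at this
  rw [mul_assoc, mul_assoc, ← mul_add, this, ← C_mul, inv_mul_cancel₀ hφ, C_1]

theorem separable_map_fractionRing_prod {S κ : Type} [CommRing S] [IsDomain S]
    [NormalizedGCDMonoid S] (s : Finset κ) (F : κ → S[X]) (hF : ∀ i ∈ s, Irreducible (F i))
    (hF' : ∀ i ∈ s, derivative (F i) ≠ 0)
    (hs : ∀ i ∈ s, ∀ j ∈ s, i ≠ j → ¬ F i ∣ F j) :
    ((∏ i ∈ s, F i).map (algebraMap S (FractionRing S))).Separable := by
  have hprim : ∀ i ∈ s, (F i).IsPrimitive := fun i hi =>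
    (hF i hi).isPrimitive fun h0 => hF' i hi (by
      rw [eq_C_of_natDegree_eq_zero h0, derivative_C])
  have hirr : ∀ i ∈ s, Irreducible ((F i).map (algebraMap S (FractionRing S))) := fun i hi =>
    ((hprim i hi).irreducible_iff_irreducible_map_fraction_map).1 (hF i hi)
  rw [Polynomial.map_prod]
  refine separable_prod' ?_ ?_
  · intro i hi j hj hij
    rw [(hirr i hi).coprime_iff_not_dvd]
    rw [← IsPrimitive.dvd_iff_fraction_map_dvd_fraction_map (FractionRing S) (hprim i hi)]
    exact hs i hi j hj hij
  · intro i hi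
    rw [separable_iff_derivative_ne_zero (hirr i hi), derivative_map, ne_eq,
      Polynomial.map_eq_zero_iff (IsFractionRing.injective S _)]
    exact hF' i hi

theorem exists_dvd_pow_and_separable_map_shearEquiv [Fintype ι] [Infinite k] (p : ℕ)
    [Fact p.Prime] [CharP k p] [PerfectRing k p] {Q : MvPolynomial (Option ι) k} (hQ : Q ≠ 0) :
    ∃ (Q' : MvPolynomial (Option ι) k) (N : ℕ) (l : ι → k) (r : MvPolynomial ι k), Q ∣ Q' ^ N ∧
      r ≠ 0 ∧ ∀ τ : ι → k, MvPolynomial.eval τ r ≠ 0 →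
        ((shearEquiv l Q').map (MvPolynomial.eval τ)).Separable := by
  classical
  let _ : StrongNormalizationMonoid (MvPolynomial (Option ι) k) := Classical.arbitrary _
  let _ : StrongNormalizationMonoid (MvPolynomial ι k) := Classical.arbitrary _
  let _ := UniqueFactorizationMonoid.toNormalizedGCDMonoid (MvPolynomial ι k)
  let s := UniqueFactorizationMonoid.primeFactors Q
  have hs : ∀ P ∈ s, Irreducible P := fun P hP =>
    UniqueFactorizationMonoid.irreducible_of_normalized_factor P
      (UniqueFactorizationMonoid.mem_primeFactors.1 hP)
  obtain ⟨l, hl⟩ := exists_forall_derivative_shearEquiv_ne_zero p s hs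
  have hsep := separable_map_fractionRing_prod s (fun P => shearEquiv l P)
    (fun P hP => (MulEquiv.irreducible_iff (shearEquiv l)).2 (hs P hP)) hl
    (fun P hP P' hP' hne hdvd => by
      have h1 : P ∣ P' := (map_dvd_iff (shearEquiv l)).1 hdvd
      exact ((hs P hP).isRelPrime_iff_not_dvd.1
        (UniqueFactorizationMonoid.pairwise_primeFactors_isRelPrime hP hP' hne)) h1)
  obtain ⟨r, hr0, hr⟩ := exists_forall_separable_map_of_separable_map_fractionRing hsep
  obtain ⟨N, hN⟩ := UniqueFactorizationMonoid.exists_dvd_radical_self_pow hQ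
  refine ⟨_, N, l, r, hN, hr0, fun τ hτ => ?_⟩
  have := hr (MvPolynomial.eval τ) hτ
  rwa [← map_prod] at this

end Bertini

/-- A Bertini-type statement: generic translates of `n` elements cut out a reduced locus away from
the zeros of `g`. -/
theorem TrdegLE.exists_prod_mem {k B : Type} [Field k] [IsAlgClosed k] (p : ℕ) [Fact p.Prime]
    [CharP k p] [CommRing B] [IsReduced B] [Algebra k B] {n : ℕ} (h : TrdegLE k B n) (g : B)
    {ι : Type} [Fintype ι] (hι : n ≤ Nat.card ι) (a : ι → B) :
    ∃ (l : ι → k) (r : MvPolynomial ι k), r ≠ 0 ∧ ∀ τ : ι → k, MvPolynomial.eval τ r ≠ 0 →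
      ∃ S : Finset k, (∀ μ ∈ S, μ ≠ 0) ∧ ∀ J : Ideal B, IsUnit (Ideal.Quotient.mk J g) →
        (∀ i, a i - (algebraMap k B (l i) * g + algebraMap k B (τ i)) * g ∈ J) →
          ∏ μ ∈ S, (g - algebraMap k B μ) ∈ J := by
  classical
  have : Infinite k := IsAlgClosed.instInfinite
  let L := Localization.Away g
  let y : Option ι → L := fun o => o.elim (algebraMap B L g)
    fun i => algebraMap B L (a i) * IsLocalization.Away.invSelf g
  obtain ⟨q, hq0, hq⟩ := (h.localizationAway g).exists_aeval_eq_zero (ι := Option ι)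
    (by rw [Finite.card_option]; omega) y
  obtain ⟨Q, N, l, r, ⟨c, hc⟩, hr0, hr⟩ := exists_dvd_pow_and_separable_map_shearEquiv p hq0
  have : IsReduced L := inferInstanceAs (IsReduced (Localization _))
  have hQ : MvPolynomial.aeval y Q = 0 := by
    have : MvPolynomial.aeval y Q ^ N = 0 := by rw [← map_pow, hc, map_mul, hq, zero_mul]
    exact eq_zero_of_pow_eq_zero this
  refine ⟨l, r, hr0, fun τ hτ => ?_⟩
  set f := (shearEquiv l Q).map (MvPolynomial.eval τ) with hf
  have hsep : f.Separable := hr τ hτ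
  refine ⟨f.roots.toFinset.erase 0, fun μ hμ => (Finset.mem_erase.1 hμ).1, fun J hg hJ => ?_⟩
  let φ : B →ₐ[k] B ⧸ J := Ideal.Quotient.mkₐ k J
  let ψ : L →+* B ⧸ J := IsLocalization.Away.lift g (g := (φ : B →+* B ⧸ J)) hg
  have hψ : ∀ b, ψ (algebraMap B L b) = φ b := fun b => IsLocalization.Away.lift_eq g _ b
  have hψy : ∀ o, ψ (y o) = o.elim (φ g)
      fun i => algebraMap k (B ⧸ J) (l i) * φ g + algebraMap k (B ⧸ J) (τ i) := by
    rintro (_ | i)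
    · exact hψ _
    · have h1 : ψ (IsLocalization.Away.invSelf g) * φ g = 1 := by
        rw [← hψ, ← map_mul, mul_comm, IsLocalization.Away.mul_invSelf, map_one]
      have h2 : φ (a i) =
          (algebraMap k (B ⧸ J) (l i) * φ g + algebraMap k (B ⧸ J) (τ i)) * φ g := by
        rw [← sub_eq_zero, ← AlgHom.commutes φ, ← AlgHom.commutes φ, ← map_mul, ← map_add,
          ← map_mul, ← map_sub]
        exact Ideal.Quotient.eq_zero_iff_mem.2 (hJ i)
      change ψ (_ * _) = _
      rw [map_mul, hψ, h2, mul_assoc, mul_comm (φ g), h1, mul_one]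
      rfl
  have hQ1 : MvPolynomial.aeval (fun o => ψ (y o)) Q = 0 := by
    have h1 : ψ (MvPolynomial.aeval y Q) = 0 := by rw [hQ, map_zero]
    rw [MvPolynomial.aeval_def, MvPolynomial.hom_eval₂] at h1
    rw [MvPolynomial.aeval_def, ← h1]
    congr 1
    ext c
    simp only [RingHom.comp_apply]
    rw [IsScalarTower.algebraMap_apply k B L, hψ, AlgHom.commutes]
  have hcomp : ((aeval (R := k) (φ g)).comp
      (Polynomial.mapAlgHom (MvPolynomial.aeval (R := k) τ))).comp (shearEquiv l).toAlgHom =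
      MvPolynomial.aeval (fun o => ψ (y o)) := by
    refine MvPolynomial.algHom_ext fun o => ?_
    rw [MvPolynomial.aeval_X, hψy]
    rcases o with _ | i
    · change aeval (R := k) (φ g) (Polynomial.map _ (shearEquiv l (MvPolynomial.X none))) = _
      simp [shearEquiv_X_none]
    · change aeval (R := k) (φ g) (Polynomial.map _ (shearEquiv l (MvPolynomial.X (some i)))) = _
      simp [shearEquiv_X_some, add_comm]
  have hfg : aeval (φ g) f = 0 := by
    rw [← hQ1, ← hcomp]
    rfl
  have hprod : f = C f.leadingCoeff * ∏ μ ∈ f.roots.toFinset, (X - C μ) := by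
    rw [Finset.prod, Multiset.toFinset_val, (nodup_roots hsep).dedup]
    exact (IsAlgClosed.splits f).eq_prod_roots
  have hmem : φ (∏ μ ∈ f.roots.toFinset, (g - algebraMap k B μ)) = 0 := by
    rw [hprod, map_mul, aeval_C, map_prod] at hfg
    have hlc : IsUnit (algebraMap k (B ⧸ J) f.leadingCoeff) :=
      (IsUnit.mk0 _ (leadingCoeff_ne_zero.2 hsep.ne_zero)).map _
    rw [hlc.mul_right_eq_zero] at hfg
    rw [map_prod, ← hfg]
    exact Finset.prod_congr rfl fun μ _ => by simp
  rw [← Ideal.Quotient.eq_zero_iff_mem]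
  change φ _ = 0
  by_cases h0 : (0 : k) ∈ f.roots.toFinset
  · rw [← Finset.mul_prod_erase _ _ h0, map_mul, map_zero, sub_zero] at hmem
    exact (IsUnit.mul_right_eq_zero hg).1 hmem
  · rwa [Finset.erase_eq_of_notMem h0]

section Elementary

variable {B ι : Type*} [CommRing B] [DecidableEq ι] {s : B}

theorem ElemRel.add_mul [Fintype ι] (v : ι → B) (i₀ : ι) {c : ι → B} (hc : c i₀ = 0) :
    ElemRel s v (fun i => v i + s * c i * v i₀) := by
  have key : ∀ S : Finset ι,
      ElemRel s v (fun i => v i + s * (if i ∈ S then c i else 0) * v i₀) := by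
    intro S
    induction S using Finset.induction_on with
    | empty => exact ElemRel.of_eq (by ext; simp)
    | insert a S ha ih =>
      by_cases h0 : a = i₀
      · refine ih.trans (ElemRel.of_eq ?_)
        ext i
        by_cases hi : i = i₀
        · subst hi; simp [hc]
        · simp [h0, hi]
      · refine ih.trans ((ElemRel.update_mul h0 (c a)).trans (ElemRel.of_eq ?_))
        ext i
        by_cases hi : i = a
        · subst hi; simp [ha, hc]
        · simp [hi]
  simpa using key Finset.univ

/-- A row with an entry `1` is elementarily equivalent to a unit vector. -/
theorem ElemRel.single_of_eq_one [Fintype ι] {v : ι → B} {i₀ : ι} (h : v i₀ = 1) :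
    ElemRel 1 v (Pi.single i₀ 1) := by
  refine (ElemRel.add_mul v i₀ (c := fun i => if i = i₀ then 0 else - v i)
    (by simp)).trans (ElemRel.of_eq ?_)
  ext i
  by_cases hi : i = i₀
  · subst hi; simp [h]
  · simp [hi, h]

theorem ElemRel.single_of_isUnit [Fintype ι] {v : ι → B} {i₀ i₁ : ι} (hi : i₁ ≠ i₀)
    (h : IsUnit (v i₀)) : ElemRel 1 v (Pi.single i₀ 1) := by
  obtain ⟨u, hu⟩ := h
  refine (ElemRel.update_mul hi ((1 - v i₁) * ↑u⁻¹)).trans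
    ((ElemRel.update_mul hi.symm (1 - v i₀)).trans (ElemRel.single_of_eq_one ?_))
  simp [hi.symm, ← hu, mul_assoc]

/-- Elementary equivalence to a unit vector can be checked modulo the nilradical. -/
theorem ElemRel.single_of_quotient_nilradical [Fintype ι] {v : ι → B} {i₀ i₁ : ι} (hi : i₁ ≠ i₀)
    (h : ElemRel 1 (Ideal.Quotient.mk (nilradical B) ∘ v) (Pi.single i₀ 1)) :
    ElemRel 1 v (Pi.single i₀ 1) := by
  obtain ⟨v', hv', hrel⟩ := ElemRel.exists_lift (s := 1) (v := v)
    (f := Ideal.Quotient.mk (nilradical B)) Ideal.Quotient.mk_surjective (by rwa [map_one])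
  refine hrel.trans (ElemRel.single_of_isUnit hi ?_)
  have := congrFun hv' i₀
  rw [Function.comp_apply, Pi.single_eq_same, ← map_one (Ideal.Quotient.mk _), Ideal.Quotient.eq,
    mem_nilradical] at this
  simpa using this.isUnit_add_one

end Elementary

theorem exists_eval_ne_zero_of_ne_zero {k σ : Type} [Field k] [Infinite k]
    {G : MvPolynomial σ k} (hG : G ≠ 0) : ∃ τ, MvPolynomial.eval τ G ≠ 0 := by
  by_contra! h
  exact hG (MvPolynomial.funext fun τ => by rw [h τ, map_zero])

theorem exists_isSplitPow_of_trdegLE_one {p : ℕ} [Fact p.Prime] {k C : Type} [Field k]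
    [Algebra (ZMod p) k] [Algebra.IsAlgebraic (ZMod p) k] [CommRing C] [IsNoetherianRing C]
    [Algebra k C] (h : TrdegLE k C 1) {b e g : C} (he : e * (1 - e) = b * g) :
    ∃ N y w, N ≠ 0 ∧ IsSplitPow b e N y w := by
  let _ : Algebra (ZMod p) C := Algebra.compHom C (algebraMap (ZMod p) k)
  have : IsScalarTower (ZMod p) k C := IsScalarTower.of_algebraMap_eq fun _ => rfl
  refine exists_isSplitPow (F := ZMod p) (fun 𝔭 _ x y hxy => ?_) he
  have h1 : AlgebraicIndependent k ![x, y] := hxy.extendScalars k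
  have h2 := h1.cardinalMk_le_trdeg.trans (h 𝔭)
  simp at h2

/-- Suslin's theorem on unimodular rows over algebras of dimension at most `n` over the algebraic
closure of a finite field, in the reduced case. -/
theorem ElemRel.single_of_trdegLE_of_isReduced {p : ℕ} [Fact p.Prime] {k B : Type} [Field k]
    [IsAlgClosed k] [Algebra (ZMod p) k] [Algebra.IsAlgebraic (ZMod p) k] [CommRing B]
    [IsReduced B] [Algebra k B] [Algebra.FiniteType k B] {m : ℕ} (h : TrdegLE k B (m + 3))
    (v : Fin (m + 4) → B) (hv : Ideal.span (Set.range v) = ⊤) :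
    ElemRel 1 v (Pi.single 0 1) := by
  have : Infinite k := IsAlgClosed.instInfinite
  have : CharP k p := charP_of_injective_algebraMap (algebraMap (ZMod p) k).injective p
  have : IsNoetherianRing B := Algebra.FiniteType.isNoetherianRing k B
  let ι₁ := {i : Fin (m + 4) // i ≠ 0}
  let ι₂ := {i : Fin (m + 4) // i ≠ 0 ∧ i ≠ 1}
  have hι₁ : Nat.card ι₁ = m + 3 := by
    simp [ι₁, Nat.card_eq_fintype_card, Fintype.card_subtype_compl]
  have hι₂ : Nat.card ι₂ = m + 2 := by
    rw [Nat.card_eq_fintype_card, Fintype.card_subtype]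
    have : (Finset.univ.filter fun i : Fin (m + 4) => i ≠ 0 ∧ i ≠ 1) =
        (Finset.univ.erase 0).erase 1 := by ext i; simp [and_comm]
    rw [this, Finset.card_erase_of_mem (by simp), Finset.card_erase_of_mem (by simp)]
    simp
  obtain ⟨G₁, hG₁, hFL₁⟩ := h.exists_forall_eval_ne_zero (v 1) (ι := ι₂) (by omega)
    (fun i => v i.1)
  obtain ⟨τ₁, hτ₁⟩ := exists_eval_ne_zero_of_ne_zero hG₁
  let v' : Fin (m + 4) → B := fun i =>
    v i + 1 * (if hi : i ≠ 0 ∧ i ≠ 1 then - algebraMap k B (τ₁ ⟨i, hi⟩) else 0) * v 1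
  have hvv' : ElemRel 1 v v' := ElemRel.add_mul v 1 (by simp)
  have hv' : Ideal.span (Set.range v') = ⊤ := hvv'.span_range ▸ hv
  have hv'0 : v' 0 = v 0 := by simp [v']
  have hv'1 : v' 1 = v 1 := by simp [v']
  have hv'i : ∀ i (hi : i ≠ 0 ∧ i ≠ 1), v' i = v i - algebraMap k B (τ₁ ⟨i, hi⟩) * v 1 := by
    intro i hi
    simp only [v', dif_pos hi]
    ring
  obtain ⟨l, r, hr0, hr⟩ := h.exists_prod_mem p (v 0) (ι := ι₁) (by omega) (fun i => v' i.1)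
  obtain ⟨G₂, hG₂, hFL₂⟩ := h.exists_forall_eval_ne_zero (v 0) (ι := ι₂) (by omega)
    (fun i => v' i.1 - algebraMap k B (l ⟨i.1, i.2.1⟩) * v 0 * v 0)
  let j : ι₂ → ι₁ := fun i => ⟨i.1, i.2.1⟩
  have hj : Function.Injective j := fun a b hab => Subtype.ext (congrArg (fun x : ι₁ => x.1) hab)
  obtain ⟨τ, hτ⟩ := exists_eval_ne_zero_of_ne_zero (mul_ne_zero hr0
    ((map_ne_zero_iff _ (MvPolynomial.rename_injective j hj)).2 hG₂))
  rw [map_mul, mul_ne_zero_iff, MvPolynomial.eval_rename] at hτ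
  obtain ⟨S, hS0, hS⟩ := hr τ hτ.1
  let w : Fin (m + 4) → B := fun i =>
    v' i + 1 * (if hi : i ≠ 0 then
      - (algebraMap k B (l ⟨i, hi⟩) * v 0 + algebraMap k B (τ ⟨i, hi⟩)) else 0) * v' 0
  have hvw : ElemRel 1 v' w := ElemRel.add_mul v' 0 (by simp)
  have hw : Ideal.span (Set.range w) = ⊤ := hvw.span_range ▸ hv'
  have hw0 : w 0 = v 0 := by simp [w, hv'0]
  have hwi : ∀ i (hi : i ≠ 0), w i = v' i -
      (algebraMap k B (l ⟨i, hi⟩) * v 0 + algebraMap k B (τ ⟨i, hi⟩)) * v 0 := by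
    intro i hi
    simp only [w, dif_pos hi, hv'0]
    ring
  set 𝔠 := Ideal.span (w '' {0, 1}ᶜ) with h𝔠
  have hmem : ∀ i, i ≠ 0 → i ≠ 1 → w i ∈ 𝔠 := fun i h0 h1 =>
    Ideal.subset_span ⟨i, by simp [h0, h1], rfl⟩
  have htr : TrdegLE k (B ⧸ 𝔠) 1 := by
    intro 𝔭 _
    set 𝔮 := 𝔭.comap (Ideal.Quotient.mk 𝔠) with h𝔮
    have hq : 𝔮.IsPrime := Ideal.IsPrime.comap _
    have hmem𝔮 : ∀ i, i ≠ 0 → i ≠ 1 → w i ∈ 𝔮 := fun i h0 h1 => by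
      rw [h𝔮, Ideal.mem_comap, Ideal.Quotient.eq_zero_iff_mem.2 (hmem i h0 h1)]
      exact zero_mem _
    refine (trdeg_le_of_surjective (Ideal.quotientMapₐ 𝔭 (Ideal.Quotient.mkₐ k 𝔠) le_rfl)
      (Ideal.quotientMap_surjective (H := le_rfl) Ideal.Quotient.mk_surjective)).trans ?_
    change Algebra.trdeg k (B ⧸ 𝔮) ≤ _
    rw [Nat.cast_one]
    by_cases h0 : v 0 ∈ 𝔮
    · have hmem' : ∀ i, i ≠ 0 → i ≠ 1 → v' i ∈ 𝔮 := fun i hi0 hi1 => by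
        have := hmem𝔮 i hi0 hi1
        rw [hwi i hi0] at this
        exact (Submodule.sub_mem_iff_left _ (Ideal.mul_mem_left _ _ h0)).1 this
      refine hFL₁ τ₁ hτ₁ 𝔮 (fun h1 => ?_) (fun i => ?_)
      · refine hq.ne_top (top_unique (hv' ▸ Ideal.span_le.2 ?_))
        rintro _ ⟨i, rfl⟩
        by_cases hi0 : i = 0
        · rw [hi0, hv'0]; exact h0
        by_cases hi1 : i = 1
        · rw [hi1, hv'1]; exact h1
        exact hmem' i hi0 hi1
      · rw [← hv'i i.1 i.2]
        exact hmem' i.1 i.2.1 i.2.2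
    · refine hFL₂ (τ ∘ j) hτ.2 𝔮 h0 (fun i => ?_)
      convert hmem𝔮 i.1 i.2.1 i.2.2 using 1
      rw [hwi i.1 i.2.1]
      simp only [Function.comp_apply, j]
      ring
  have hnd : [(0 : Fin (m + 4)), 1, 2, 3].Nodup := by
    simp [Fin.ext_iff, Nat.mod_eq_of_lt]
  have hJ : ∏ μ ∈ S, (v 0 - algebraMap k B μ) ∈ Ideal.span (w '' {0}ᶜ) := by
    refine hS _ ?_ fun i => ?_
    · obtain ⟨x, y, hy, hxy⟩ : ∃ x, ∃ y ∈ Ideal.span (w '' {0}ᶜ), x * w 0 + y = 1 := by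
        have : (1 : B) ∈ Ideal.span (insert (w 0) (w '' {0}ᶜ)) := by
          rw [← Set.image_insert_eq, Set.insert_eq, Set.union_compl_self, Set.image_univ, hw]
          trivial
        obtain ⟨x, y, hy, hxy⟩ := Ideal.mem_span_insert.1 this
        exact ⟨x, y, hy, hxy.symm⟩
      refine IsUnit.of_mul_eq_one (Ideal.Quotient.mk _ x) ?_
      rw [← map_mul, ← map_one (Ideal.Quotient.mk _), Ideal.Quotient.eq, ← hxy, hw0]
      rw [show v 0 * x - (x * v 0 + y) = - y by ring]
      exact neg_mem hy
    · rw [← hwi i.1 i.2]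
      exact Ideal.subset_span ⟨i.1, i.2, rfl⟩
  have hset : w '' {0}ᶜ = insert (w 1) (w '' {0, 1}ᶜ) := by
    rw [← Set.image_insert_eq]
    congr 1
    ext i
    by_cases hi : i = 1
    · simp [hi]
    · simp [hi]
  have := PairRel.of_prod_mem (k := k) (ElemRel.pairRel w hnd)
    (fun b e g he => exists_isSplitPow_of_trdegLE_one (p := p) htr he) S id
    (Set.injOn_id _) hS0 (w 0) (w 1)
    (by rw [hw0, ← Ideal.span_insert, ← hset]; exact hJ)
  rw [Function.update_eq_self, Function.update_eq_self] at this
  refine hvv'.trans (hvw.trans (this.trans (ElemRel.single_of_eq_one ?_)))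
  simp

theorem ElemRel.single_of_trdegLE {p : ℕ} [Fact p.Prime] {k B : Type} [Field k]
    [IsAlgClosed k] [Algebra (ZMod p) k] [Algebra.IsAlgebraic (ZMod p) k] [CommRing B]
    [Algebra k B] [Algebra.FiniteType k B] {m : ℕ} (h : TrdegLE k B (m + 3))
    (v : Fin (m + 4) → B) (hv : Ideal.span (Set.range v) = ⊤) :
    ElemRel 1 v (Pi.single 0 1) := by
  refine ElemRel.single_of_quotient_nilradical (i₁ := 1) (by simp) ?_
  have : IsReduced (B ⧸ nilradical B) := by
    rw [← Ideal.isRadical_iff_quotient_reduced]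
    exact Ideal.radical_isRadical _
  refine ElemRel.single_of_trdegLE_of_isReduced (p := p) (k := k) (h.quotient _) _ ?_
  rw [Set.range_comp, ← Ideal.map_span, hv, Ideal.map_top]

open TensorProduct in
/-- A projective module of constant rank becomes free after inverting an element outside all
minimal primes. -/
theorem Module.exists_comp_eq_smul_of_rankAtStalk_eq {B P : Type} [CommRing B] [IsNoetherianRing B]
    [AddCommGroup P] [Module B P] [Module.Finite B P] [Module.Projective B P] {n : ℕ}
    (h : ∀ 𝔭 : PrimeSpectrum B, Module.rankAtStalk P 𝔭 = n) :
    ∃ s : B, (∀ 𝔭 ∈ minimalPrimes B, s ∉ 𝔭) ∧ ∃ (f : (Fin n → B) →ₗ[B] P)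
      (g : P →ₗ[B] (Fin n → B)), (∀ y, g (f y) = s • y) ∧ ∀ x, f (g x) = s • x := by
  let M : Submonoid B :=
    { carrier := {s | ∀ 𝔭 ∈ minimalPrimes B, s ∉ 𝔭}
      one_mem' := fun 𝔭 h𝔭 => (Ideal.ne_top_iff_one _).1 h𝔭.1.1.ne_top
      mul_mem' := fun {a b} ha hb 𝔭 h𝔭 hab =>
        (h𝔭.1.1.mem_or_mem hab).elim (ha 𝔭 h𝔭) (hb 𝔭 h𝔭) }
  let L := Localization M
  have hfin : (minimalPrimes B).Finite := minimalPrimes.finite_of_isNoetherianRing B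
  have : Finite (MaximalSpectrum L) := by
    have hmem : ∀ 𝔪 : MaximalSpectrum L, 𝔪.asIdeal.comap (algebraMap B L) ∈ minimalPrimes B := by
      intro 𝔪
      have h1 := ((IsLocalization.isPrime_iff_isPrime_disjoint M L 𝔪.asIdeal).1 𝔪.isMaximal.isPrime)
      have h2 : ((𝔪.asIdeal.comap (algebraMap B L) : Ideal B) : Set B) ⊆
          ⋃ 𝔭 ∈ hfin.toFinset, (𝔭 : Set B) := by
        intro x hx
        by_contra hx'
        simp only [Set.mem_iUnion, not_exists, Set.Finite.mem_toFinset, SetLike.mem_coe] at hx'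
        exact Set.disjoint_left.1 h1.2 (show x ∈ (M : Set B) from hx') hx
      obtain ⟨𝔭, h𝔭, hle⟩ := (Ideal.subset_union_prime (s := hfin.toFinset) (f := id) ⊥ ⊥
        fun 𝔭 h𝔭 _ _ => ((Set.Finite.mem_toFinset hfin).1 h𝔭).1.1).1 h2
      have h𝔭' := (Set.Finite.mem_toFinset hfin).1 h𝔭
      rw [le_antisymm hle (h𝔭'.2 ⟨h1.1, bot_le⟩ hle)]
      exact h𝔭'
    have := hfin.to_subtype
    refine _root_.Finite.of_injective (fun 𝔪 => (⟨_, hmem 𝔪⟩ : minimalPrimes B)) fun 𝔪 𝔪' hm => ?_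
    have hm' := congrArg Subtype.val hm
    dsimp only at hm'
    apply MaximalSpectrum.ext
    rw [← IsLocalization.map_under M L 𝔪.asIdeal, ← IsLocalization.map_under M L 𝔪'.asIdeal]
    exact congrArg _ hm'
  obtain ⟨b⟩ := Module.nonempty_basis_of_flat_of_finrank_eq L (L ⊗[B] P) n fun 𝔪 => by
    let _ := Ideal.Quotient.field 𝔪.asIdeal
    have h1 : Module.rankAtStalk ((L ⧸ 𝔪.asIdeal) ⊗[L] (L ⊗[B] P))
        (⊥ : PrimeSpectrum (L ⧸ 𝔪.asIdeal)) = n := by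
      rw [Module.rankAtStalk_baseChange, Module.rankAtStalk_baseChange, h]
    rw [Module.rankAtStalk_eq_finrank_of_free] at h1
    exact h1
  let e : (L ⊗[B] P) ≃ₗ[B] (L ⊗[B] (Fin n → B)) :=
    (b.equivFun.trans (TensorProduct.piScalarRight B L L (Fin n)).symm).restrictScalars B
  let f₁ : P →ₗ[B] L ⊗[B] P := TensorProduct.mk B L P 1
  let f₂ : (Fin n → B) →ₗ[B] L ⊗[B] (Fin n → B) := TensorProduct.mk B L (Fin n → B) 1
  have : Module.FinitePresentation B P := Module.finitePresentation_of_finite B P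
  obtain ⟨g, s₁, hg⟩ := Module.FinitePresentation.exists_lift_of_isLocalizedModule M f₂
    (e.toLinearMap.comp f₁)
  obtain ⟨f, s₂, hf⟩ := Module.FinitePresentation.exists_lift_of_isLocalizedModule M f₁
    (e.symm.toLinearMap.comp f₂)
  have hg' : ∀ x, f₂ (g x) = s₁ • e (f₁ x) := fun x => LinearMap.congr_fun hg x
  have hf' : ∀ x, f₁ (f x) = s₂ • e.symm (f₂ x) := fun x => LinearMap.congr_fun hf x
  obtain ⟨s₃, h₃⟩ := Module.Finite.exists_smul_of_comp_eq_of_isLocalizedModule M f₁ (f ∘ₗ g)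
    ((s₁ * s₂) • LinearMap.id) (by
      ext x
      change f₁ (f (g x)) = f₁ ((s₁ * s₂) • x)
      rw [hf', hg', Submonoid.smul_def, Submonoid.smul_def, Submonoid.smul_def, map_smul, map_smul,
        e.symm_apply_apply, smul_smul, mul_comm, Submonoid.coe_mul])
  obtain ⟨s₄, h₄⟩ := Module.Finite.exists_smul_of_comp_eq_of_isLocalizedModule M f₂ (g ∘ₗ f)
    ((s₁ * s₂) • LinearMap.id) (by
      refine LinearMap.ext fun x => ?_
      change f₂ (g (f x)) = f₂ ((s₁ * s₂) • x)
      rw [hg', hf', Submonoid.smul_def, Submonoid.smul_def, Submonoid.smul_def, map_smul, map_smul,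
        e.apply_symm_apply, smul_smul, Submonoid.coe_mul])
  have h₃' : ∀ x, (s₃ : B) • f (g x) = (s₃ : B) • ((s₁ * s₂ : M) : B) • x :=
    fun x => LinearMap.congr_fun h₃ x
  have h₄' : ∀ x, (s₄ : B) • g (f x) = (s₄ : B) • ((s₁ * s₂ : M) : B) • x :=
    fun x => LinearMap.congr_fun h₄ x
  refine ⟨((s₃ * s₄ * (s₁ * s₂) : M) : B), (s₃ * s₄ * (s₁ * s₂)).2, ((s₃ * s₄ : M) : B) • f, g,
    fun y => ?_, fun x => ?_⟩
  · rw [LinearMap.smul_apply, map_smul, Submonoid.coe_mul, mul_smul, h₄']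
    simp only [smul_smul, Submonoid.coe_mul, mul_assoc]
  · rw [LinearMap.smul_apply, Submonoid.coe_mul, mul_comm, mul_smul, h₃']
    simp only [smul_smul, Submonoid.coe_mul]
    congr 1
    ring

/-- Dividing by an element outside all minimal primes drops the dimension. -/
theorem ringKrullDim_quotient_succ_le_of_notMem_minimalPrimes {R : Type*} [CommRing R] {r : R}
    (hr : ∀ 𝔭 ∈ minimalPrimes R, r ∉ 𝔭) :
    ringKrullDim (R ⧸ Ideal.span {r}) + 1 ≤ ringKrullDim R := by
  by_cases hr' : Ideal.span {r} = ⊤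
  · rw [hr', ringKrullDim_eq_bot_of_subsingleton]
    simp
  have : Nonempty (PrimeSpectrum.zeroLocus (R := R) (Ideal.span {r})) := by
    rwa [Set.nonempty_coe_sort, Set.nonempty_iff_ne_empty, ne_eq,
      PrimeSpectrum.zeroLocus_empty_iff_eq_top]
  have := Ideal.Quotient.nontrivial_iff.mpr hr'
  have := (Ideal.Quotient.mk (Ideal.span {r})).domain_nontrivial
  rw [ringKrullDim_quotient, Order.krullDim_eq_iSup_length, ringKrullDim,
    Order.krullDim_eq_iSup_length, ← WithBot.coe_one, ← WithBot.coe_add,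
    ENat.iSup_add, WithBot.coe_le_coe, iSup_le_iff]
  intro l
  obtain ⟨p, hp, hp'⟩ := Ideal.exists_minimalPrimes_le (J := l.head.1.asIdeal) bot_le
  let p' : PrimeSpectrum R := ⟨p, hp.1.1⟩
  have hp' : p' < l.head := lt_of_le_of_ne hp' fun h => hr p hp
    (show r ∈ p by
      have h2 : Ideal.span {r} ≤ l.head.1.asIdeal := l.head.2
      have h3 : p'.asIdeal = l.head.1.asIdeal := congrArg _ h
      change r ∈ p'.asIdeal
      rw [h3]
      exact h2 (Ideal.mem_span_singleton_self r))
  have hm : StrictMono fun x : PrimeSpectrum.zeroLocus (R := R) (Ideal.span {r}) => x.1 :=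
    fun _ _ h => h
  have hcons : (p', (l.map _ hm).head) ∈ {(a, b) : PrimeSpectrum R × PrimeSpectrum R | a < b} :=
    hp'
  refine le_trans ?_ (le_iSup (fun l : LTSeries (PrimeSpectrum R) => (l.length : ℕ∞))
    (RelSeries.cons (l.map _ hm) p' hcons))
  rw [RelSeries.cons_length, LTSeries.map_length, Nat.cast_add, Nat.cast_one]

section Transvections

variable {B ι : Type*} [CommRing B] [DecidableEq ι] {s : B}

theorem ElemRel.of_eq_add_mul {v v' : ι → B} (i : ι) {x : B} (h : ∀ j ≠ i, v' j = v j)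
    (hi : v' i = v i + s * x) (hx : x ∈ Ideal.span (v '' {i}ᶜ)) : ElemRel s v v' := by
  convert ElemRel.update_add_of_mem (s := s) hx using 1
  ext j
  by_cases hj : j = i
  · subst hj; simp [hi]
  · simp [hj, h j hj]

theorem ElemRel.transvection_sq {v : ι → B} {i j h : ι} (hij : i ≠ j) (hih : i ≠ h) (hjh : j ≠ h)
    {r₁ r₂ q₁ q₂ : B} (hq : r₁ * q₁ + r₂ * q₂ = 0) :
    ElemRel s v (Function.update (Function.update v i (v i + s ^ 2 * (v i * q₁ + v j * q₂) * r₁)) j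
      (v j + s ^ 2 * (v i * q₁ + v j * q₂) * r₂)) := by
  set δ := v i * q₁ + v j * q₂ with hδ
  have mem : ∀ (w : ι → B) (a b : ι) (c : B), a ≠ b → c * w b ∈ Ideal.span (w '' {a}ᶜ) :=
    fun w a b c hab => Ideal.mul_mem_left _ _ (Ideal.subset_span ⟨b, hab.symm, rfl⟩)
  let U : B → B → B → ι → B := fun x y t =>
    Function.update (Function.update (Function.update v i x) j y) h t
  have Ui : ∀ x y t, U x y t i = x := fun x y t => by simp [U, hih, hij]
  have Uj : ∀ x y t, U x y t j = y := fun x y t => by simp [U, hjh]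
  have Uh : ∀ x y t, U x y t h = t := fun x y t => by simp [U]
  have mi : ∀ x y t c, ElemRel s (U x y t) (U (x + s * (c * t)) y t) := by
    intro x y t c
    refine ElemRel.of_eq_add_mul i (fun l hl => ?_) (x := c * t) (by rw [Ui, Ui]) ?_
    · by_cases l = j <;> by_cases l = h <;> simp_all [U]
    · simpa only [Uh] using mem (U x y t) i h c hih
  have mj : ∀ x y t c, ElemRel s (U x y t) (U x (y + s * (c * t)) t) := by
    intro x y t c
    refine ElemRel.of_eq_add_mul j (fun l hl => ?_) (x := c * t) (by rw [Uj, Uj]) ?_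
    · by_cases l = i <;> by_cases l = h <;> simp_all [U]
    · simpa only [Uh] using mem (U x y t) j h c hjh
  have mh : ∀ x y t c d, ElemRel s (U x y t) (U x y (t + s * (c * x + d * y))) := by
    intro x y t c d
    refine ElemRel.of_eq_add_mul h (fun l hl => ?_) (x := c * x + d * y) (by rw [Uh, Uh]) ?_
    · simp_all [U]
    · refine Ideal.add_mem _ ?_ ?_
      · simpa only [Ui] using mem (U x y t) h i c hih.symm
      · simpa only [Uj] using mem (U x y t) h j d hjh.symm
  have key := ((((mh (v i) (v j) (v h) q₁ q₂).trans (mi _ _ _ r₁)).trans (mj _ _ _ r₂)).trans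
    (mh _ _ _ (-q₁) (-q₂))).trans ((mi _ _ _ (-r₁)).trans (mj _ _ _ (-r₂)))
  have e : v h + s * (q₁ * v i + q₂ * v j) + s * (-q₁ * (v i + s * (r₁ * (v h + s * (q₁ * v i
      + q₂ * v j)))) + -q₂ * (v j + s * (r₂ * (v h + s * (q₁ * v i + q₂ * v j))))) = v h := by
    linear_combination (- s ^ 2 * (v h + s * (q₁ * v i + q₂ * v j))) * hq
  rw [e] at key
  convert key using 1
  · simp [U, Function.update_eq_self]
  · ext l
    by_cases hl : l = i
    · subst hl; rw [Ui]; simp [hij]; ring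
    by_cases hl' : l = j
    · subst hl'; rw [Uj]; simp; ring
    by_cases hl'' : l = h <;> simp_all [U]

theorem ElemRel.add_wedge [Fintype ι] (ρ v : ι → B) {i j : ι} (hij : i ≠ j)
    (hh : ∃ h, i ≠ h ∧ j ≠ h) (a : B) :
    ElemRel s ρ (fun l => ρ l + s ^ 2 * a * (ρ ⬝ᵥ v) *
      ((Pi.single i (v j) : ι → B) l - (Pi.single j (v i) : ι → B) l)) := by
  obtain ⟨h, hih, hjh⟩ := hh
  obtain ⟨r, hr, hr'⟩ : ∃ r, ρ ⬝ᵥ v = (ρ i * v i + ρ j * v j) + r ∧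
      r = ∑ l ∈ ((Finset.univ.erase i).erase j), ρ l * v l := by
    refine ⟨_, ?_, rfl⟩
    rw [dotProduct, ← Finset.add_sum_erase _ _ (Finset.mem_univ i), ← Finset.add_sum_erase _ _
      (Finset.mem_erase.2 ⟨hij.symm, Finset.mem_univ j⟩), add_assoc]
  have hrm : ∀ w : ι → B, ∀ l, l = i ∨ l = j → (∀ m, m ≠ i → m ≠ j → w m = ρ m) →
      ∀ c, c * r ∈ Ideal.span (w '' {l}ᶜ) := by
    intro w l hl hw c
    refine Ideal.mul_mem_left _ _ (hr' ▸ sum_mem fun m hm => ?_)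
    simp only [Finset.mem_erase, Finset.mem_univ, and_true] at hm
    refine Ideal.mul_mem_right _ _ (Ideal.subset_span ⟨m, ?_, hw m hm.2 hm.1⟩)
    rcases hl with rfl | rfl
    · exact hm.2
    · exact hm.1
  let ρ₁ := Function.update ρ i (ρ i + s * (s * a * v j * r))
  let ρ₂ := Function.update ρ₁ j (ρ₁ j + s * (- s * a * v i * r))
  have h1 : ElemRel s ρ ρ₁ := ElemRel.update_add_of_mem (hrm ρ i (.inl rfl) (fun _ _ _ => rfl) _)
  have h2 : ElemRel s ρ₁ ρ₂ := ElemRel.update_add_of_mem (hrm ρ₁ j (.inr rfl)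
    (fun m hm _ => by simp [ρ₁, hm]) _)
  have h3 := ElemRel.transvection_sq (s := s) (v := ρ₂) hij hih hjh (r₁ := a * v j)
    (r₂ := - (a * v i)) (q₁ := v i) (q₂ := v j) (by ring)
  refine (h1.trans h2).trans (h3.trans (ElemRel.of_eq ?_))
  have ei : ρ₂ i = ρ i + s * (s * a * v j * r) := by simp [ρ₂, ρ₁, hij]
  have ej : ρ₂ j = ρ j + s * (- s * a * v i * r) := by simp [ρ₂, ρ₁, hij.symm]
  ext l
  by_cases hl : l = i
  · subst hl; simp [hij, ei, ej, hr]; ring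
  by_cases hl' : l = j
  · subst hl'; simp [hij.symm, ei, ej, hr]; ring
  · simp [hl, hl', ρ₂, ρ₁]

theorem ElemRel.add_dotProduct_mul [Fintype ι] (hι : 3 ≤ Fintype.card ι) (ρ v w z : ι → B)
    (hw : w ⬝ᵥ v = 0) (hz : z ⬝ᵥ v = 1) (a : B) :
    ElemRel s ρ (fun l => ρ l + s ^ 2 * a * (ρ ⬝ᵥ v) * w l) := by
  have key : ∀ S : Finset (ι × ι), ElemRel s ρ (fun l => ρ l + s ^ 2 * a * (ρ ⬝ᵥ v) *
      ∑ x ∈ S, w x.1 * z x.2 *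
        ((Pi.single x.1 (v x.2) : ι → B) l - (Pi.single x.2 (v x.1) : ι → B) l)) := by
    intro S
    induction S using Finset.induction_on with
    | empty => simpa using ElemRel.refl ρ
    | insert x S hx ih =>
      refine ih.trans ?_
      set ρ' := (fun l => ρ l + s ^ 2 * a * (ρ ⬝ᵥ v) *
        ∑ x ∈ S, w x.1 * z x.2 * ((Pi.single x.1 (v x.2) : ι → B) l -
          (Pi.single x.2 (v x.1) : ι → B) l)) with hρ'
      have hdot : ρ' ⬝ᵥ v = ρ ⬝ᵥ v := by
        clear_value ρ'
        subst hρ'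
        generalize s ^ 2 * a * (ρ ⬝ᵥ v) = C
        simp only [dotProduct, _root_.add_mul, Finset.sum_add_distrib]
        rw [add_eq_left]
        simp only [mul_assoc, ← Finset.mul_sum, Finset.sum_mul]
        rw [Finset.sum_comm]
        have : ∀ x : ι × ι, ∑ i, w x.1 * (z x.2 *
            (((Pi.single x.1 (v x.2) : ι → B) i -
              (Pi.single x.2 (v x.1) : ι → B) i) * v i)) = 0 := by
          intro x
          simp only [← Finset.mul_sum, sub_mul, Finset.sum_sub_distrib]
          have h1 : ∀ (i : ι) (b : B), ∑ l, (Pi.single i b : ι → B) l * v l = b * v i :=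
            fun i b => single_dotProduct v b i
          rw [h1, h1]
          ring
        simp [this]
      by_cases hx' : x.1 = x.2
      · refine ElemRel.of_eq ?_
        ext l
        rw [Finset.sum_insert hx, hx']
        simp [hρ']
      · obtain ⟨h, hh⟩ : ∃ h, h ∉ ({x.1, x.2} : Finset ι) := by
          by_contra! hcon
          have := Finset.card_le_card (fun i _ => hcon i : (Finset.univ : Finset ι) ⊆ _)
          have h2 := Finset.card_le_two (a := x.1) (b := x.2)
          rw [Finset.card_univ] at this
          omega
        simp only [Finset.mem_insert, Finset.mem_singleton, not_or] at hh
        refine (ElemRel.add_wedge ρ' v hx' ⟨h, Ne.symm hh.1, Ne.symm hh.2⟩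
          (a * (w x.1 * z x.2))).trans (ElemRel.of_eq ?_)
        ext l
        rw [Finset.sum_insert hx, hdot]
        simp only [hρ']
        ring
  convert key Finset.univ using 4 with l
  rw [Fintype.sum_prod_type]
  simp only [mul_sub, Finset.sum_sub_distrib]
  have e1 : ∀ x, ∑ y, w x * z y * (Pi.single x (v y) : ι → B) l =
      if l = x then w x else 0 := by
    intro x
    split_ifs with h
    · subst h
      simp only [Pi.single_eq_same, mul_assoc, ← Finset.mul_sum]
      rw [← dotProduct, hz, mul_one]
    · simp [h]
  have e2 : ∀ x, ∑ y, w x * z y * (Pi.single y (v x) : ι → B) l = z l * (w x * v x) := by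
    intro x
    rw [Finset.sum_eq_single l]
    · simp; ring
    · intro b _ hb; simp [hb.symm]
    · simp
  simp only [e1, e2, ← Finset.mul_sum]
  rw [← dotProduct, hw]
  simp

end Transvections

/-- The ring obtained from `B` by adjoining a root of `X² - σX`. -/
abbrev DoubleRing (B : Type*) [CommRing B] (σ : B) : Type _ :=
  B[X] ⧸ Ideal.span {(X : B[X]) ^ 2 - C σ * X}

namespace DoubleRing

variable {B : Type*} [CommRing B] {σ : B}

/-- The class of the variable. -/
noncomputable def root (σ : B) : DoubleRing B σ := Ideal.Quotient.mk _ X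

theorem root_mul_root : root σ * root σ = algebraMap B _ σ * root σ := by
  rw [← sub_eq_zero]
  change Ideal.Quotient.mk _ (X * X - C σ * X) = 0
  rw [Ideal.Quotient.eq_zero_iff_mem, ← pow_two]
  exact Ideal.mem_span_singleton_self _

/-- Evaluation at a root of `X² - σX` in `B`. -/
noncomputable def eval {c : B} (hc : c ^ 2 = σ * c) : DoubleRing B σ →ₐ[B] B :=
  Ideal.Quotient.liftₐ _ (aeval c) fun a ha => by
    have : Ideal.span {(X : B[X]) ^ 2 - C σ * X} ≤ RingHom.ker (aeval c : B[X] →ₐ[B] B) := by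
      rw [Ideal.span_singleton_le_iff_mem, RingHom.mem_ker]
      simp [hc]
    exact this ha

@[simp]
theorem eval_root {c : B} (hc : c ^ 2 = σ * c) : eval hc (root σ) = c := by
  change aeval c X = c
  simp

/-- Evaluation at the root `0`. -/
noncomputable def evalZero (σ : B) : DoubleRing B σ →ₐ[B] B := eval (c := 0) (by ring)

/-- Evaluation at the root `σ`. -/
noncomputable def evalSelf (σ : B) : DoubleRing B σ →ₐ[B] B := eval (c := σ) (by ring)

theorem exists_eq_add (r : DoubleRing B σ) :
    ∃ a b : B, r = algebraMap B _ a + algebraMap B _ b * root σ := by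
  obtain ⟨f, rfl⟩ := Ideal.Quotient.mk_surjective r
  induction f using Polynomial.induction_on with
  | C a => exact ⟨a, 0, by simp; rfl⟩
  | add f g hf hg =>
    obtain ⟨a, b, h⟩ := hf
    obtain ⟨a', b', h'⟩ := hg
    exact ⟨a + a', b + b', by rw [map_add, h, h']; simp only [map_add]; ring⟩
  | monomial n a h =>
    obtain ⟨b, c, h⟩ := h
    refine ⟨0, b + c * σ, ?_⟩
    have h2 : (Ideal.Quotient.mk (Ideal.span {(X : B[X]) ^ 2 - C σ * X})) (C a * X ^ (n + 1)) =
        Ideal.Quotient.mk _ (C a * X ^ n) * root σ := by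
      rw [root, ← map_mul, mul_assoc, ← pow_succ]
    rw [h2, h]
    simp only [map_add, map_mul, map_zero]
    linear_combination algebraMap B _ c * root_mul_root (σ := σ)

@[simp]
theorem evalZero_add (a b : B) :
    evalZero σ (algebraMap B _ a + algebraMap B _ b * root σ) = a := by
  simp [evalZero]

@[simp]
theorem evalSelf_add (a b : B) :
    evalSelf σ (algebraMap B _ a + algebraMap B _ b * root σ) = a + σ * b := by
  simp [evalSelf, mul_comm]

theorem root_mem_or {𝔓 : Ideal (DoubleRing B σ)} (h𝔓 : 𝔓.IsPrime) :
    root σ ∈ 𝔓 ∨ root σ - algebraMap B _ σ ∈ 𝔓 := by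
  apply h𝔓.mem_or_mem
  rw [show root σ * (root σ - algebraMap B _ σ) = 0 by linear_combination root_mul_root (σ := σ)]
  exact 𝔓.zero_mem

theorem eq_top_of_map {I : Ideal (DoubleRing B σ)} (h0 : I.map (evalZero σ) = ⊤)
    (h1 : I.map (evalSelf σ) = ⊤) : I = ⊤ := by
  by_contra hI
  obtain ⟨𝔓, h𝔓, hle⟩ := I.exists_le_maximal hI
  have key : ∀ f : DoubleRing B σ →ₐ[B] B, I.map f = ⊤ →
      (∀ r, r - algebraMap B _ (f r) ∈ 𝔓) → False := by
    intro f hf hr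
    have hsurj : Function.Surjective f := fun b => ⟨algebraMap B _ b, by simp⟩
    have h1 : (1 : B) ∈ I.map f := hf ▸ Submodule.mem_top
    obtain ⟨r, hrI, hr1⟩ := (Ideal.mem_map_iff_of_surjective f hsurj).1 h1
    have := hr r
    rw [hr1, map_one] at this
    exact h𝔓.ne_top ((Ideal.eq_top_iff_one _).2
      ((Submodule.sub_mem_iff_right _ (hle hrI)).1 this))
  rcases root_mem_or h𝔓.isPrime with h | h
  · refine key _ h0 fun r => ?_
    obtain ⟨a, b, rfl⟩ := exists_eq_add r
    rw [evalZero_add, add_sub_cancel_left]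
    exact Ideal.mul_mem_left _ _ h
  · refine key _ h1 fun r => ?_
    obtain ⟨a, b, rfl⟩ := exists_eq_add r
    rw [evalSelf_add]
    convert Ideal.mul_mem_left _ (algebraMap B _ b) h using 1
    simp only [map_add, map_mul]
    ring

theorem span_range_eq_top {ι : Type*} {ρ : ι → DoubleRing B σ}
    (h0 : Ideal.span (Set.range (evalZero σ ∘ ρ)) = ⊤)
    (h1 : Ideal.span (Set.range (evalSelf σ ∘ ρ)) = ⊤) : Ideal.span (Set.range ρ) = ⊤ := by
  refine eq_top_of_map ?_ ?_
  · rw [Ideal.map_span, ← Set.range_comp, h0]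
  · rw [Ideal.map_span, ← Set.range_comp, h1]

theorem trdegLE {k B : Type} [Field k] [CommRing B] [Algebra k B] {n : ℕ} (h : TrdegLE k B n)
    (σ : B) : TrdegLE k (DoubleRing B σ) n := by
  intro 𝔓 h𝔓
  let f : B →ₐ[k] DoubleRing B σ := IsScalarTower.toAlgHom k B _
  have hp : (𝔓.comap f).IsPrime := Ideal.IsPrime.comap _
  refine (trdeg_le_of_surjective (Ideal.quotientMapₐ 𝔓 f le_rfl) ?_).trans (h (𝔓.comap f))
  have key : ∀ r : DoubleRing B σ, ∃ b, r - f b ∈ 𝔓 := by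
    intro r
    obtain ⟨a, b, rfl⟩ := exists_eq_add r
    rcases root_mem_or h𝔓 with h | h
    · refine ⟨a, ?_⟩
      convert Ideal.mul_mem_left _ (algebraMap B _ b) h using 1
      simp [f]
    · refine ⟨a + b * σ, ?_⟩
      convert Ideal.mul_mem_left _ (algebraMap B _ b) h using 1
      simp [f]
      ring
  intro y
  obtain ⟨r, rfl⟩ := Ideal.Quotient.mk_surjective y
  obtain ⟨b, hb⟩ := key r
  exact ⟨Ideal.Quotient.mk _ b, (Ideal.Quotient.eq.2 hb).symm⟩

instance {k B : Type} [Field k] [CommRing B] [Algebra k B] [Algebra.FiniteType k B] (σ : B) :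
    Algebra.FiniteType k (DoubleRing B σ) :=
  Algebra.FiniteType.trans (S := B) inferInstance inferInstance

end DoubleRing

section

variable {B ι : Type*} [CommRing B] [DecidableEq ι] [Fintype ι]

theorem update_add_mul_eq_vecMul_transvection (v : ι → B) (i j : ι) (c : B) :
    Function.update v i (v i + c * v j) = Matrix.vecMul v (Matrix.transvection j i c) := by
  rw [Matrix.transvection, Matrix.vecMul_add, Matrix.vecMul_one]
  ext l
  by_cases hl : l = i
  · subst hl
    simp [Matrix.vecMul, dotProduct, Matrix.single_apply, mul_comm]
  · simp [hl, Matrix.vecMul, dotProduct, Ne.symm hl]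

open DoubleRing in
theorem ElemRel.exists_units (hι : 3 ≤ Fintype.card ι) {s : B} {ρ ρ' : ι → DoubleRing B (s ^ 2)}
    (h : ElemRel 1 ρ ρ') :
    ∃ g h : Matrix ι ι B, g * h = 1 ∧ h * g = 1 ∧
      evalZero (s ^ 2) ∘ ρ' = Matrix.vecMul (evalZero (s ^ 2) ∘ ρ) g ∧
      ElemRel s (evalSelf (s ^ 2) ∘ ρ) (Matrix.vecMul (evalSelf (s ^ 2) ∘ ρ') h) := by
  induction h with
  | refl => exact ⟨1, 1, by simp, by simp, by simp, by simpa using ElemRel.refl _⟩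
  | @tail ρ₁ ρ₂ _ hstep ih =>
    obtain ⟨g, h, hgh, hhg, e0, e1⟩ := ih
    obtain ⟨i, j, c, hij, rfl⟩ := hstep
    obtain ⟨a, b, rfl⟩ := exists_eq_add c
    have hT : ∀ (f : DoubleRing B (s ^ 2) →ₐ[B] B) (c : DoubleRing B (s ^ 2)),
        f ∘ (Function.update ρ₁ i (ρ₁ i + 1 * c * ρ₁ j)) =
          Matrix.vecMul (f ∘ ρ₁) (Matrix.transvection j i (f c)) := by
      intro f c
      rw [← update_add_mul_eq_vecMul_transvection, Function.comp_update]
      simp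
    have hTT : ∀ x y : B, Matrix.transvection j i x * Matrix.transvection j i y =
        Matrix.transvection j i (x + y) := fun x y =>
      Matrix.transvection_mul_transvection_same j i hij.symm x y
    refine ⟨g * Matrix.transvection j i a, Matrix.transvection j i (-a) * h, ?_, ?_, ?_, ?_⟩
    · rw [Matrix.mul_assoc, ← Matrix.mul_assoc (Matrix.transvection j i a), hTT]
      simp [hgh]
    · rw [Matrix.mul_assoc, ← Matrix.mul_assoc h, hhg, Matrix.one_mul, hTT]
      simp
    · rw [hT, e0, evalZero_add, Matrix.vecMul_vecMul]
    · refine e1.trans ?_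
      rw [hT, evalSelf_add, Matrix.vecMul_vecMul, ← Matrix.mul_assoc, hTT]
      generalize evalSelf (s ^ 2) ∘ ρ₁ = u
      have hj : Matrix.vecMul u h ⬝ᵥ (fun l => g l j) = u j := by
        change Matrix.vecMul (Matrix.vecMul u h) g j = _
        rw [Matrix.vecMul_vecMul, hhg, Matrix.vecMul_one]
      have key := ElemRel.add_dotProduct_mul (s := s) hι (Matrix.vecMul u h) (fun l => g l j)
        (h i) (h j) ?_ ?_ b
      · refine key.trans (ElemRel.of_eq ?_)
        rw [hj, ← Matrix.vecMul_vecMul, ← update_add_mul_eq_vecMul_transvection]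
        rw [add_right_comm, add_neg_cancel, zero_add]
        have : Function.update u i (u i + s ^ 2 * b * u j) =
            u + Pi.single i (s ^ 2 * b * u j) := by
          ext l
          by_cases hl : l = i
          · subst hl; simp
          · simp [hl]
        rw [this, Matrix.add_vecMul]
        ext l
        rw [Pi.add_apply, Matrix.vecMul, Matrix.vecMul, single_dotProduct]
      · change (h * g) i j = 0
        rw [hhg, Matrix.one_apply_ne hij]
      · change (h * g) j j = 1
        rw [hhg, Matrix.one_apply_eq]

end

open DoubleRing in
theorem ElemRel.single_of_eq_add_sq {p : ℕ} [Fact p.Prime] {k B : Type} [Field k]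
    [IsAlgClosed k] [Algebra (ZMod p) k] [Algebra.IsAlgebraic (ZMod p) k] [CommRing B]
    [Algebra k B] [Algebra.FiniteType k B] {m : ℕ} (h : TrdegLE k B (m + 3)) (s : B)
    (v b : Fin (m + 4) → B) (hv : Ideal.span (Set.range v) = ⊤)
    (hb : ∀ i, v i = (Pi.single 0 1 : Fin (m + 4) → B) i + s ^ 2 * b i) :
    ElemRel s v (Pi.single 0 1) := by
  let ρ : Fin (m + 4) → DoubleRing B (s ^ 2) := fun i =>
    algebraMap B _ ((Pi.single 0 1 : Fin (m + 4) → B) i) + algebraMap B _ (b i) * root (s ^ 2)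
  have h0 : evalZero (s ^ 2) ∘ ρ = Pi.single 0 1 := by ext i; simp only [ρ, Function.comp_apply,
    evalZero_add]
  have h1 : evalSelf (s ^ 2) ∘ ρ = v := by ext i; simp only [ρ, Function.comp_apply,
    evalSelf_add, hb]
  have hρ : Ideal.span (Set.range ρ) = ⊤ := by
    refine span_range_eq_top ?_ (h1 ▸ hv)
    rw [h0, Ideal.eq_top_iff_one]
    exact Ideal.subset_span ⟨0, by simp⟩
  have key := ElemRel.single_of_trdegLE (p := p) (k := k) (trdegLE h (s ^ 2)) ρ hρ
  obtain ⟨g, g', hg, hg', e0, e1⟩ := key.exists_units (by simp)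
  have hs : ∀ f : DoubleRing B (s ^ 2) →ₐ[B] B,
      f ∘ (Pi.single 0 1 : Fin (m + 4) → _) = Pi.single 0 1 := by
    intro f
    ext i
    by_cases hi : i = 0
    · subst hi; simp
    · simp [hi]
  rw [hs, h0] at e0
  rw [hs, h1, e0, Matrix.vecMul_vecMul, hg, Matrix.vecMul_one] at e1
  exact e1

/-- One elementary operation on `B × P`. -/
def ELStep {B P : Type*} [CommRing B] [AddCommGroup P] [Module B P] (x y : B × P) : Prop :=
  (∃ φ : P →ₗ[B] B, y = (x.1 + φ x.2, x.2)) ∨ ∃ q : P, y = (x.1, x.2 + x.1 • q)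

/-- Equivalence of elements of `B × P` under elementary operations. -/
def ELRel {B P : Type*} [CommRing B] [AddCommGroup P] [Module B P] : B × P → B × P → Prop :=
  Relation.ReflTransGen ELStep

section

variable {B P : Type*} [CommRing B] [AddCommGroup P] [Module B P]

theorem ELRel.refl (x : B × P) : ELRel x x := Relation.ReflTransGen.refl

theorem ELRel.of_eq {x y : B × P} (h : x = y) : ELRel x y := h ▸ ELRel.refl x

theorem ELRel.trans {x y z : B × P} (h : ELRel x y) (h' : ELRel y z) : ELRel x z :=
  Relation.ReflTransGen.trans h h'

theorem ELRel.add_apply (a : B) (p : P) (φ : P →ₗ[B] B) : ELRel (a, p) (a + φ p, p) :=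
  Relation.ReflTransGen.single (.inl ⟨φ, rfl⟩)

theorem ELRel.add_smul (a : B) (p q : P) : ELRel (a, p) (a, p + a • q) :=
  Relation.ReflTransGen.single (.inr ⟨q, rfl⟩)

theorem ELRel.transvection (a : B) (p q : P) {φ : P →ₗ[B] B} (h : φ q = 0) :
    ELRel (a, p) (a, p + φ p • q) := by
  refine (((ELRel.add_apply a p φ).trans (ELRel.add_smul _ _ q)).trans
    (ELRel.add_apply _ _ (-φ))).trans ((ELRel.add_smul _ _ (-q)).trans (ELRel.of_eq ?_))
  simp only [h, LinearMap.neg_apply, map_add, map_smul, Prod.mk.injEq]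
  constructor
  · ring
  · module

theorem ELRel.exists_equiv {x y : B × P} (h : ELRel x y) :
    ∃ θ : (B × P) ≃ₗ[B] (B × P), θ x = y := by
  induction h with
  | refl => exact ⟨LinearEquiv.refl _ _, rfl⟩
  | tail _ h ih =>
    obtain ⟨θ, rfl⟩ := ih
    obtain ⟨φ, rfl⟩ | ⟨q, rfl⟩ := h
    · let e : (B × P) ≃ₗ[B] (B × P) := LinearEquiv.ofLinearMap
        ((LinearMap.fst B B P + φ ∘ₗ LinearMap.snd B B P).prod (LinearMap.snd B B P))
        ((LinearMap.fst B B P - φ ∘ₗ LinearMap.snd B B P).prod (LinearMap.snd B B P))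
        (by ext <;> simp) (by ext <;> simp)
      exact ⟨θ.trans e, rfl⟩
    · let e : (B × P) ≃ₗ[B] (B × P) := LinearEquiv.ofLinearMap
        ((LinearMap.fst B B P).prod (LinearMap.snd B B P + (LinearMap.fst B B P).smulRight q))
        ((LinearMap.fst B B P).prod (LinearMap.snd B B P - (LinearMap.fst B B P).smulRight q))
        (by ext <;> simp) (by ext <;> simp)
      exact ⟨θ.trans e, rfl⟩

theorem ELRel.exists_unimodular {x y : B × P} (h : ELRel x y)
    (hx : ∃ Φ : B × P →ₗ[B] B, Φ x = 1) : ∃ Φ : B × P →ₗ[B] B, Φ y = 1 := by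
  obtain ⟨θ, rfl⟩ := h.exists_equiv
  obtain ⟨Φ, hΦ⟩ := hx
  exact ⟨Φ ∘ₗ θ.symm.toLinearMap, by simpa using hΦ⟩

theorem ElemRel.elRel {n : ℕ} {t : B} {v w : Fin (n + 1) → B} (h : ElemRel (t ^ 2) v w)
    (f : (Fin n → B) →ₗ[B] P) (g : P →ₗ[B] (Fin n → B)) (hgf : ∀ y, g (f y) = t • y) :
    ELRel (v 0, f (fun l => v l.succ)) (w 0, f (fun l => w l.succ)) := by
  induction h with
  | refl => exact ELRel.refl _
  | @tail u _ _ h ih =>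
    refine ih.trans ?_
    obtain ⟨i, j, c, hij, rfl⟩ := h
    have upd : ∀ (l : Fin n) (x : B), (fun m : Fin n => Function.update u l.succ
        (u l.succ + x) m.succ) = (fun m => u m.succ) + Pi.single l x := by
      intro l x
      ext m
      by_cases hm : m = l
      · subst hm; simp
      · simp [hm]
    cases i using Fin.cases with
    | zero =>
      obtain ⟨l, rfl⟩ := Fin.exists_succ_eq.2 hij.symm
      refine (ELRel.add_apply _ _ ((t * c) • LinearMap.proj l ∘ₗ g)).trans (ELRel.of_eq ?_)
      simp [hgf]
      ring
    | succ l =>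
      rw [upd, map_add, ← mul_one (t ^ 2 * c * u j), ← smul_eq_mul, Pi.single_smul, map_smul,
        Function.update_of_ne (Fin.succ_ne_zero l).symm]
      cases j using Fin.cases with
      | zero =>
        refine (ELRel.add_smul _ _ ((t ^ 2 * c) • f (Pi.single l 1))).trans (ELRel.of_eq ?_)
        rw [smul_smul, mul_comm]
      | succ m =>
        have hlm : l ≠ m := fun h => hij (h ▸ rfl)
        refine (ELRel.transvection _ _ (t • f (Pi.single l 1))
          (φ := c • LinearMap.proj m ∘ₗ g) ?_).trans (ELRel.of_eq ?_)
        · simp [hgf, hlm.symm]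
        · simp [hgf, smul_smul]
          congr 1
          ring

open TensorProduct

/-- Elementary operations lift from a quotient. -/
theorem ELRel.exists_lift [Module.Projective B P] {I : Ideal B} {x : B × P}
    {y : (B ⧸ I) × ((B ⧸ I) ⊗[B] P)} (h : ELRel (Ideal.Quotient.mk I x.1, 1 ⊗ₜ x.2) y) :
    ∃ z, y = (Ideal.Quotient.mk I z.1, 1 ⊗ₜ z.2) ∧ ELRel x z := by
  induction h with
  | refl => exact ⟨x, rfl, ELRel.refl _⟩
  | tail _ h ih =>
    obtain ⟨z, rfl, hz⟩ := ih
    obtain ⟨φ, rfl⟩ | ⟨q, rfl⟩ := h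
    · obtain ⟨ψ, hψ⟩ := Module.projective_lifting_property (Algebra.linearMap B (B ⧸ I))
        (φ.restrictScalars B ∘ₗ TensorProduct.mk B (B ⧸ I) P 1) Ideal.Quotient.mk_surjective
      refine ⟨_, ?_, hz.trans (ELRel.add_apply z.1 z.2 ψ)⟩
      have : Ideal.Quotient.mk I (ψ z.2) = φ (1 ⊗ₜ z.2) := LinearMap.congr_fun hψ z.2
      simp [this]
    · obtain ⟨q, rfl⟩ := TensorProduct.mk_surjective B P (B ⧸ I) Ideal.Quotient.mk_surjective q
      refine ⟨_, ?_, hz.trans (ELRel.add_smul z.1 z.2 q)⟩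
      ext
      · rfl
      · dsimp only
        rw [TensorProduct.tmul_add, TensorProduct.tmul_smul, TensorProduct.mk_apply]
        rfl

theorem exists_unimodular_quotient (I : Ideal B) {a : B} {p : P}
    (h : ∃ Φ : B × P →ₗ[B] B, Φ (a, p) = 1) :
    ∃ Φ : (B ⧸ I) × ((B ⧸ I) ⊗[B] P) →ₗ[B ⧸ I] (B ⧸ I),
      Φ (Ideal.Quotient.mk I a, 1 ⊗ₜ p) = 1 := by
  obtain ⟨Φ, hΦ⟩ := h
  refine ⟨(Ideal.Quotient.mk I (Φ (1, 0))) • LinearMap.fst _ _ _ +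
    ((Algebra.linearMap B (B ⧸ I) ∘ₗ Φ ∘ₗ LinearMap.inr B B P).liftBaseChange (B ⧸ I)) ∘ₗ
      LinearMap.snd _ _ _, ?_⟩
  have : Φ (a, p) = Φ (1, 0) * a + Φ (0, p) := by
    rw [mul_comm, ← smul_eq_mul, ← map_smul, ← map_add]
    simp
  have h1 : Ideal.Quotient.mk I (Φ (1, 0) * a + Φ (0, p)) = 1 := by rw [← this, hΦ, map_one]
  refine Eq.trans ?_ h1
  rw [map_add, map_mul]
  simp only [LinearMap.add_apply, LinearMap.smul_apply, LinearMap.comp_apply, LinearMap.fst_apply,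
    LinearMap.snd_apply, LinearMap.liftBaseChange_tmul, one_smul, LinearMap.inr_apply]
  rfl

theorem ELRel.exists_of_quotient_span_singleton [Module.Projective B P] {t : B}
    (h : ∀ x : (B ⧸ Ideal.span {t}) × ((B ⧸ Ideal.span {t}) ⊗[B] P),
      (∃ Φ : _ →ₗ[B ⧸ Ideal.span {t}] (B ⧸ Ideal.span {t}), Φ x = 1) → ELRel x (1, 0))
    {a : B} {p : P} (hap : ∃ Φ : B × P →ₗ[B] B, Φ (a, p) = 1) :
    ∃ b q, ELRel (a, p) (1 + t * b, t • q) := by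
  obtain ⟨⟨z, q⟩, hz, hrel⟩ := ELRel.exists_lift (x := (a, p))
    (h _ (exists_unimodular_quotient (Ideal.span {t}) hap))
  obtain ⟨h1, h2⟩ := Prod.ext_iff.1 hz
  dsimp only at h1 h2
  rw [← map_one (Ideal.Quotient.mk _), eq_comm, Ideal.Quotient.eq,
    Ideal.mem_span_singleton'] at h1
  obtain ⟨b, hb⟩ := h1
  have h3 := congrArg (TensorProduct.quotTensorEquivQuotSMul P (Ideal.span {t})) h2
  rw [map_zero, TensorProduct.quotTensorEquivQuotSMul_mk_one_tmul, eq_comm,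
    Submodule.Quotient.mk_eq_zero, Submodule.ideal_span_singleton_smul,
    Submodule.mem_smul_pointwise_iff_exists] at h3
  obtain ⟨q', -, rfl⟩ := h3
  refine ⟨b, q', ?_⟩
  rw [mul_comm, hb, add_sub_cancel]
  exact hrel

end

theorem span_range_eq_top_of_apply_eq_one {B P : Type*} [CommRing B] [AddCommGroup P] [Module B P]
    {n : ℕ} (f : (Fin n → B) →ₗ[B] P) (v : Fin (n + 1) → B) {Φ : B × P →ₗ[B] B}
    (h : Φ (v 0, f (fun l => v l.succ)) = 1) : Ideal.span (Set.range v) = ⊤ := by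
  rw [Ideal.eq_top_iff_one, ← h]
  have h1 : Φ (v 0, f (fun l => v l.succ)) =
      Φ (v 0 • (1, 0)) + (Φ ∘ₗ LinearMap.inr B B P ∘ₗ f) (fun l => v l.succ) := by
    rw [LinearMap.comp_apply, LinearMap.comp_apply, ← map_add]
    simp
  rw [h1, map_smul, smul_eq_mul, mul_comm, LinearMap.pi_apply_eq_sum_univ]
  refine Ideal.add_mem _ (Ideal.mul_mem_left _ _ (Ideal.subset_span ⟨_, rfl⟩))
    (sum_mem fun l _ => ?_)
  rw [smul_eq_mul]
  exact Ideal.mul_mem_right _ _ (Ideal.subset_span ⟨_, rfl⟩)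

/-- Over an affine algebra of dimension at most `n` over the algebraic closure of a finite field,
the elementary operations act transitively on unimodular elements of `B × P` if `P` is a
projective module of rank `n ≥ 3`. -/
theorem ELRel.one_zero_of_ringKrullDim_le {p : ℕ} [Fact p.Prime] {k : Type} [Field k]
    [IsAlgClosed k] [Algebra (ZMod p) k] [Algebra.IsAlgebraic (ZMod p) k] {n : ℕ} (hn : 3 ≤ n)
    {B P : Type} [CommRing B] [Algebra k B] [Algebra.FiniteType k B] [AddCommGroup P] [Module B P]
    [Module.Finite B P] [Module.Projective B P]
    (hP : ∀ 𝔭 : PrimeSpectrum B, Module.rankAtStalk P 𝔭 = n) (hB : ringKrullDim B ≤ n)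
    (x : B × P) (hx : ∃ Φ : B × P →ₗ[B] B, Φ x = 1) : ELRel x (1, 0) := by
  obtain ⟨N, hN⟩ : ∃ N : ℕ, ringKrullDim B < N := ⟨n + 1, lt_of_le_of_lt hB (by
    exact_mod_cast Nat.lt_succ_self n)⟩
  induction N generalizing B P with
  | zero =>
    have : Subsingleton B := by
      by_contra h
      have : Nontrivial B := not_subsingleton_iff_nontrivial.1 h
      exact absurd ringKrullDim_nonneg_of_nontrivial (not_le.2 hN)
    have : Subsingleton P := Module.subsingleton B P
    exact ELRel.of_eq (Subsingleton.elim _ _)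
  | succ N ih =>
    have : IsNoetherianRing B := Algebra.FiniteType.isNoetherianRing k B
    obtain ⟨s, hs, f, g, hgf, hfg⟩ := Module.exists_comp_eq_smul_of_rankAtStalk_eq hP
    have hs5 : ∀ 𝔭 ∈ minimalPrimes B, s ^ 5 ∉ 𝔭 := fun 𝔭 h𝔭 h =>
      hs 𝔭 h𝔭 (h𝔭.1.1.mem_of_pow_mem _ h)
    have hdim := ringKrullDim_quotient_succ_le_of_notMem_minimalPrimes hs5
    have hdim' : ringKrullDim (B ⧸ Ideal.span {s ^ 5}) ≤ ringKrullDim B :=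
      ringKrullDim_quotient_le _
    obtain ⟨a, q⟩ := x
    obtain ⟨b, q, hrel⟩ := ELRel.exists_of_quotient_span_singleton (t := s ^ 5) (fun y hy => by
      refine ih (fun 𝔭 => ?_) (hdim'.trans hB) y hy ?_
      · rw [Module.rankAtStalk_baseChange, hP]
      · by_contra! h
        have h2 : ((N : WithBot ℕ∞) + 1) ≤ ringKrullDim B :=
          (add_le_add_left h 1).trans hdim
        exact absurd hN (not_lt.2 (by exact_mod_cast h2))) hx
    obtain ⟨Φ, hΦ⟩ := hrel.exists_unimodular hx
    refine hrel.trans ?_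
    obtain ⟨m, rfl⟩ : ∃ m, n = m + 3 := ⟨n - 3, by omega⟩
    let c : Fin (m + 4) → B := Fin.cons (s * b) (g q)
    let v : Fin (m + 4) → B := fun i => (Pi.single 0 1 : Fin (m + 4) → B) i + (s ^ 2) ^ 2 * c i
    have hv0 : v 0 = 1 + s ^ 5 * b := by simp [v, c]; ring
    have hvs : (fun l : Fin (m + 3) => v l.succ) = s ^ 4 • g q := by
      ext l
      simp [v, c]
      ring
    have hfq : f (fun l : Fin (m + 3) => v l.succ) = s ^ 5 • q := by
      rw [hvs, map_smul, hfg, smul_smul, ← pow_succ]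
    have hv : Ideal.span (Set.range v) = ⊤ := by
      refine span_range_eq_top_of_apply_eq_one f v (Φ := Φ) ?_
      rw [hfq, hv0, hΦ]
    have key := (ElemRel.single_of_eq_add_sq (p := p) (k := k)
      (TrdegLE.of_ringKrullDim_le hB) (s ^ 2) v c hv (fun _ => rfl)).elRel f g hgf
    rw [hfq, hv0] at key
    refine key.trans (ELRel.of_eq ?_)
    have : (fun l : Fin (m + 3) => (Pi.single 0 1 : Fin (m + 4) → B) l.succ) = 0 := by
      ext l; simp
    rw [this, map_zero, Pi.single_eq_same]

section Cancellation

variable {R M N : Type*} [CommRing R] [AddCommGroup M] [Module R M] [AddCommGroup N] [Module R N]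

theorem nonempty_equiv_of_prod_equiv
    (h : ∀ x : R × M, (∃ Φ : R × M →ₗ[R] R, Φ x = 1) → ∃ θ : (R × M) ≃ₗ[R] (R × M), θ x = (1, 0))
    (e : (R × M) ≃ₗ[R] (R × N)) : Nonempty (M ≃ₗ[R] N) := by
  obtain ⟨θ, hθ⟩ := h (e.symm (1, 0)) ⟨LinearMap.fst R R N ∘ₗ e.toLinearMap, by simp⟩
  let e' : (R × M) ≃ₗ[R] (R × N) := θ.symm.trans e
  have h1 : e' (1, 0) = (1, 0) := by simp [e', ← hθ]
  have h1' : e'.symm (1, 0) = (1, 0) := by rw [← h1, e'.symm_apply_apply]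
  have h2 : ∀ r : R, e' (r, 0) = (r, 0) := fun r => by
    have := e'.map_smul r (1, 0)
    rw [h1] at this
    simpa using this
  have h2' : ∀ r : R, e'.symm (r, 0) = (r, 0) := fun r => by rw [← h2, e'.symm_apply_apply]
  refine ⟨LinearEquiv.ofLinearMap
    (LinearMap.snd R R N ∘ₗ e'.toLinearMap ∘ₗ LinearMap.inr R R M)
    (LinearMap.snd R R M ∘ₗ e'.symm.toLinearMap ∘ₗ LinearMap.inr R R N) ?_ ?_⟩
  · ext q
    have h3 : (0, (e'.symm (0, q)).2) = e'.symm (0, q) - ((e'.symm (0, q)).1, 0) := by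
      ext <;> simp
    simp only [LinearMap.comp_apply, LinearMap.inr_apply, LinearMap.snd_apply,
      LinearEquiv.coe_coe, LinearMap.id_apply]
    rw [h3, map_sub, e'.apply_symm_apply, h2]
    simp
  · ext q
    have h3 : (0, (e' (0, q)).2) = e' (0, q) - ((e' (0, q)).1, 0) := by
      ext <;> simp
    simp only [LinearMap.comp_apply, LinearMap.inr_apply, LinearMap.snd_apply,
      LinearEquiv.coe_coe, LinearMap.id_apply]
    rw [h3, map_sub, e'.symm_apply_apply, h2']
    simp

/-- The module `M × Rᵐ⁺¹` with one copy of `R` split off. -/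
def prodSuccEquiv (R M : Type*) [CommRing R] [AddCommGroup M] [Module R M] (m : ℕ) :
    (M × (Fin (m + 1) → R)) ≃ₗ[R] (R × (M × (Fin m → R))) where
  toFun x := (x.2 0, x.1, fun i => x.2 i.succ)
  invFun y := (y.2.1, Fin.cons y.1 y.2.2)
  map_add' _ _ := rfl
  map_smul' _ _ := rfl
  left_inv x := by
    ext i
    · rfl
    · cases i using Fin.cases <;> rfl
  right_inv _ := rfl

theorem exists_equiv_one_zero_of_equiv (e : M ≃ₗ[R] N)
    (h : ∀ x : R × M, (∃ Φ : R × M →ₗ[R] R, Φ x = 1) → ∃ θ : (R × M) ≃ₗ[R] (R × M), θ x = (1, 0))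
    (x : R × N) (hx : ∃ Φ : R × N →ₗ[R] R, Φ x = 1) :
    ∃ θ : (R × N) ≃ₗ[R] (R × N), θ x = (1, 0) := by
  let E : (R × M) ≃ₗ[R] (R × N) := (LinearEquiv.refl R R).prodCongr e
  obtain ⟨Φ, hΦ⟩ := hx
  obtain ⟨θ, hθ⟩ := h (E.symm x) ⟨Φ ∘ₗ E.toLinearMap, by simpa using hΦ⟩
  refine ⟨(E.symm.trans θ).trans E, ?_⟩
  rw [LinearEquiv.trans_apply, LinearEquiv.trans_apply, hθ]
  simp [E]

theorem IsCancellative.of_exists_equiv {R M : Type} [CommRing R] [AddCommGroup M] [Module R M]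
    (h : ∀ (m : ℕ) (x : R × (M × (Fin m → R))),
      (∃ Φ : R × (M × (Fin m → R)) →ₗ[R] R, Φ x = 1) →
      ∃ θ : (R × (M × (Fin m → R))) ≃ₗ[R] (R × (M × (Fin m → R))), θ x = (1, 0)) :
    IsCancellative R M := by
  intro Q _ _ _ _ m hm
  induction m with
  | zero =>
    obtain ⟨e⟩ := hm
    exact ⟨(LinearEquiv.prodUnique.symm.trans e).trans LinearEquiv.prodUnique⟩
  | succ m ih =>
    obtain ⟨e⟩ := hm
    exact ih (nonempty_equiv_of_prod_equiv (h m)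
      (((prodSuccEquiv R M m).symm.trans e).trans (prodSuccEquiv R Q m)))

/-- If free modules of rank `n` are cancellative, then unimodular rows of length `n + 1` can be
completed to invertible matrices. -/
theorem IsCancellative.exists_mulVec_eq_single {R : Type} [CommRing R] {n : ℕ}
    (h : IsCancellative R (Fin n → R)) (ρ : Fin (n + 1) → R)
    (hρ : Ideal.span (Set.range ρ) = ⊤) :
    ∃ Θ Θ' : Matrix (Fin (n + 1)) (Fin (n + 1)) R, Θ * Θ' = 1 ∧ Θ' * Θ = 1 ∧
      Θ.mulVec ρ = Pi.single 0 1 := by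
  obtain ⟨c, hc⟩ := (Submodule.mem_span_range_iff_exists_fun R).1
    ((Ideal.eq_top_iff_one _).1 hρ)
  let Φ : (Fin (n + 1) → R) →ₗ[R] R := Fintype.linearCombination R c
  have hΦ : Φ ρ = 1 := by
    rw [← hc]
    simp [Φ, Fintype.linearCombination_apply, mul_comm]
  let Q := LinearMap.ker Φ
  let π : (Fin (n + 1) → R) →ₗ[R] Q :=
    (LinearMap.id - Φ.smulRight ρ).codRestrict Q fun x => by
      simp [Q, LinearMap.mem_ker, hΦ]
  have hπ : ∀ x, (π x : Fin (n + 1) → R) = x - Φ x • ρ := fun x => rfl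
  have hQ : ∀ q : Q, Φ q = 0 := fun q => q.2
  have hπQ : π ∘ₗ Q.subtype = LinearMap.id := by
    ext q
    simp [hπ, hQ]
  let e₁ : (Fin (n + 1) → R) ≃ₗ[R] (R × Q) := LinearEquiv.ofLinearMap (Φ.prod π)
    (LinearMap.coprod (LinearMap.toSpanSingleton R _ ρ) Q.subtype)
    (by
      refine LinearMap.ext fun x => Prod.ext ?_ (Subtype.ext ?_)
      · simp [hΦ, hQ]
      · simp [hπ, hΦ, hQ])
    (by
      refine LinearMap.ext fun x => ?_
      simp [hπ])
  have hfin : Module.Finite R Q := Module.Finite.of_surjective π fun q =>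
    ⟨q, LinearMap.congr_fun hπQ q⟩
  have hproj : Module.Projective R Q := Module.Projective.of_split Q.subtype π hπQ
  let e₂ : (R × (Fin n → R)) ≃ₗ[R] (Fin (n + 1) → R) :=
    { toFun := fun x => Fin.cons x.1 x.2
      invFun := fun y => (y 0, fun i => y i.succ)
      map_add' := fun x y => by ext i; cases i using Fin.cases <;> rfl
      map_smul' := fun x y => by ext i; cases i using Fin.cases <;> rfl
      left_inv := fun x => rfl
      right_inv := fun y => by ext i; cases i using Fin.cases <;> rfl }
  let u := LinearEquiv.funUnique (Fin 1) R R
  obtain ⟨τ⟩ := h Q hfin hproj 1 ⟨((((LinearEquiv.refl R _).prodCongr u).trans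
    (LinearEquiv.prodComm R _ _)).trans (e₂.trans e₁)).trans
    ((LinearEquiv.prodComm R _ _).trans ((LinearEquiv.refl R _).prodCongr u.symm))⟩
  let θ : (Fin (n + 1) → R) ≃ₗ[R] (Fin (n + 1) → R) :=
    (e₁.trans ((LinearEquiv.refl R R).prodCongr τ.symm)).trans e₂
  refine ⟨LinearMap.toMatrix' θ.toLinearMap, LinearMap.toMatrix' θ.symm.toLinearMap, ?_, ?_, ?_⟩
  · rw [← LinearMap.toMatrix'_comp]
    simp
  · rw [← LinearMap.toMatrix'_comp]
    simp
  · rw [← Matrix.toLin'_apply, Matrix.toLin'_toMatrix']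
    have h1 : e₁ ρ = (1, 0) := Prod.ext hΦ (Subtype.ext (by
      change ρ - Φ ρ • ρ = 0
      simp [hΦ]))
    have : θ ρ = e₂ (1, 0) := by
      simp [θ, h1]
    refine this.trans ?_
    ext i
    cases i using Fin.cases with
    | zero => exact (Pi.single_eq_same (M := fun _ => R) 0 1).symm
    | succ i => exact (Pi.single_eq_of_ne (M := fun _ => R) (Fin.succ_ne_zero i) 1).symm

/-- An automorphism of `N` lifting an automorphism of `M` which is trivial modulo `s ^ 2`. -/
theorem exists_equiv_apply_eq {s : R} {f : M →ₗ[R] N} {g : N →ₗ[R] M}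
    (hgf : ∀ x, g (f x) = s • x) {T T' : M →ₗ[R] M}
    (h : ∀ x, s • (T x + T' x + s ^ 2 • T (T' x)) = 0)
    (h' : ∀ x, s • (T' x + T x + s ^ 2 • T' (T x)) = 0) :
    ∃ θ : N ≃ₗ[R] N, ∀ x, θ (f x) = f (x + s ^ 2 • T x) := by
  refine ⟨LinearEquiv.ofLinearMap (LinearMap.id + s • (f ∘ₗ T ∘ₗ g))
    (LinearMap.id + s • (f ∘ₗ T' ∘ₗ g)) ?_ ?_, fun x => ?_⟩
  · ext y
    have := congrArg f (h (g y))
    simp only [map_smul, map_add, map_zero] at this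
    simp only [LinearMap.comp_apply, LinearMap.add_apply, LinearMap.id_apply,
      LinearMap.smul_apply, map_add, map_smul, hgf]
    rw [← sub_eq_zero, ← this]
    module
  · ext y
    have := congrArg f (h' (g y))
    simp only [map_smul, map_add, map_zero] at this
    simp only [LinearMap.comp_apply, LinearMap.add_apply, LinearMap.id_apply,
      LinearMap.smul_apply, map_add, map_smul, hgf]
    rw [← sub_eq_zero, ← this]
    module
  · simp [hgf, smul_smul, pow_two]

end Cancellation

theorem one_add_smul_mul_one_add_smul {R S : Type*} [CommRing R] [Ring S] [Algebra R S] (r : R)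
    (x y : S) : (1 + r • x) * (1 + r • y) = 1 + r • (x + y + r • (x * y)) := by
  simp only [mul_add, add_mul, mul_one, one_mul, smul_mul_assoc, mul_smul_comm]
  module

namespace DoubleRing

variable {B : Type} [CommRing B] {σ : B} {ι : Type*} [Fintype ι] [DecidableEq ι]

theorem exists_mapMatrix_evalSelf (M : Matrix ι ι (DoubleRing B σ)) :
    ∃ Ξ : Matrix ι ι B, (evalSelf σ).mapMatrix M = (evalZero σ).mapMatrix M + σ • Ξ := by
  choose a b h using fun i j => exists_eq_add (M i j)
  refine ⟨Matrix.of b, ?_⟩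
  ext i j
  simp [h]

/-- A matrix over `B[X] / (X² - σX)` carrying a unimodular column to the first basis vector yields
a matrix over `B`, trivial modulo `σ`, taking `e₀ + σc` to the first basis vector. -/
theorem exists_matrix_mulVec_eq_single {n : ℕ}
    (h : IsCancellative (DoubleRing B σ) (Fin n → DoubleRing B σ)) (c : Fin (n + 1) → B)
    (hc : Ideal.span (Set.range (Pi.single 0 1 + σ • c : Fin (n + 1) → B)) = ⊤) :
    ∃ T T' : Matrix (Fin (n + 1)) (Fin (n + 1)) B,
      σ • (T + T' + σ • (T * T')) = 0 ∧ σ • (T' + T + σ • (T' * T)) = 0 ∧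
      (1 + σ • T).mulVec (Pi.single 0 1 + σ • c) = Pi.single 0 1 := by
  let e : Fin (n + 1) → B := Pi.single 0 1
  let ρ : Fin (n + 1) → DoubleRing B σ := fun i =>
    algebraMap B _ (e i) + algebraMap B _ (c i) * root σ
  have hρ0 : evalZero σ ∘ ρ = e := by ext i; simp [ρ]
  have hρ1 : evalSelf σ ∘ ρ = e + σ • c := by ext i; simp [ρ]
  have hρ : Ideal.span (Set.range ρ) = ⊤ := by
    refine span_range_eq_top ?_ (hρ1 ▸ hc)
    rw [hρ0, Ideal.eq_top_iff_one]
    exact Ideal.subset_span ⟨0, by simp [e]⟩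
  obtain ⟨Θ, Θ', h1, h2, h3⟩ := h.exists_mulVec_eq_single ρ hρ
  have hmap : ∀ f : DoubleRing B σ →ₐ[B] B, (f.mapMatrix Θ).mulVec (f ∘ ρ) = e := by
    intro f
    ext i
    have := congrArg f (congrFun h3 i)
    rw [Matrix.mulVec, dotProduct, map_sum] at this
    simp only [map_mul] at this
    rw [Matrix.mulVec, dotProduct]
    refine this.trans ?_
    simp only [e, Pi.single_apply]
    split_ifs <;> simp
  have h4 : ∀ f : DoubleRing B σ →ₐ[B] B, f.mapMatrix Θ * f.mapMatrix Θ' = 1 := fun f => by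
    rw [← map_mul, h1, map_one]
  have h5 : ∀ f : DoubleRing B σ →ₐ[B] B, f.mapMatrix Θ' * f.mapMatrix Θ = 1 := fun f => by
    rw [← map_mul, h2, map_one]
  obtain ⟨Ξ, hΞ⟩ := exists_mapMatrix_evalSelf Θ
  obtain ⟨Ξ', hΞ'⟩ := exists_mapMatrix_evalSelf Θ'
  set M₀ := (evalZero σ).mapMatrix Θ
  set M₀' := (evalZero σ).mapMatrix Θ'
  set M₁ := (evalSelf σ).mapMatrix Θ
  set M₁' := (evalSelf σ).mapMatrix Θ'
  have hT : 1 + σ • (M₀' * Ξ) = M₀' * M₁ := by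
    rw [hΞ, mul_add, h5, mul_smul_comm]
  have hT' : 1 + σ • (Ξ' * M₀) = M₁' * M₀ := by
    rw [hΞ', add_mul, h5, smul_mul_assoc]
  refine ⟨M₀' * Ξ, Ξ' * M₀, ?_, ?_, ?_⟩
  · rw [← add_eq_left, ← one_add_smul_mul_one_add_smul, hT, hT', mul_assoc, ← mul_assoc M₁,
      h4, one_mul, h5]
  · rw [← add_eq_left, ← one_add_smul_mul_one_add_smul, hT, hT', mul_assoc, ← mul_assoc M₀,
      h4, one_mul, h5]
  · have h6 := hmap (evalZero σ)
    have h7 := hmap (evalSelf σ)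
    rw [hρ0] at h6
    rw [hρ1] at h7
    rw [hT, ← Matrix.mulVec_mulVec]
    refine (congrArg M₀'.mulVec h7).trans ?_
    rw [← h6, Matrix.mulVec_mulVec, h5, Matrix.one_mulVec]

end DoubleRing

/-- Lifting the completion of unimodular elements `(1 + s³b, s³q)` from a free module to a
projective module which is free after inverting `s`. -/
theorem exists_equiv_apply_eq_one_zero {A P : Type} [CommRing A] [AddCommGroup P] [Module A P]
    {n : ℕ} {s : A} {f : (Fin n → A) →ₗ[A] P} {g : P →ₗ[A] (Fin n → A)}
    (hgf : ∀ y, g (f y) = s • y) (hf : ∀ x, s • x ∈ LinearMap.range f)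
    (hann : ∀ a, s ^ 2 * a = 0 → s * a = 0)
    (hcan : IsCancellative (DoubleRing A (s ^ 2)) (Fin n → DoubleRing A (s ^ 2)))
    (b : A) (x : P) (hx : ∃ Φ : A × P →ₗ[A] A, Φ (1 + s ^ 3 * b, s ^ 3 • x) = 1) :
    ∃ θ : (A × P) ≃ₗ[A] (A × P), θ (1 + s ^ 3 * b, s ^ 3 • x) = (1, 0) := by
  obtain ⟨y, hy⟩ := hf x
  obtain ⟨Φ, hΦ⟩ := hx
  let c : Fin (n + 1) → A := Fin.cons (s * b) y
  let v : Fin (n + 1) → A := Pi.single 0 1 + s ^ 2 • c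
  let F : (Fin (n + 1) → A) →ₗ[A] A × P :=
    (LinearMap.proj 0).prod (f ∘ₗ LinearMap.funLeft A A Fin.succ)
  let G : (A × P) →ₗ[A] (Fin (n + 1) → A) :=
    { toFun := fun z => Fin.cons (s * z.1) (g z.2)
      map_add' := fun z w => by ext i; cases i using Fin.cases <;> simp [mul_add]
      map_smul' := fun r z => by ext i; cases i using Fin.cases <;> simp [mul_left_comm] }
  have hGF : ∀ z, G (F z) = s • z := fun z => by
    ext i
    cases i using Fin.cases with
    | zero => simp [G, F]
    | succ i => exact congrFun (hgf _) i
  have hFv : F v = (1 + s ^ 3 * b, s ^ 3 • x) := by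
    refine Prod.ext ?_ ?_
    · simp [F, v, c]
      ring
    · have : LinearMap.funLeft A A Fin.succ v = s ^ 2 • y := by
        ext i
        simp [v, c, LinearMap.funLeft_apply]
      change f (LinearMap.funLeft A A Fin.succ v) = _
      rw [this, map_smul, hy, smul_smul, ← pow_succ]
  have hFe : F (Pi.single 0 1) = (1, 0) := by
    refine Prod.ext (by simp [F]) ?_
    have : LinearMap.funLeft A A Fin.succ (Pi.single 0 1 : Fin (n + 1) → A) = 0 := by
      ext i
      simp [LinearMap.funLeft_apply]
    change f (LinearMap.funLeft A A Fin.succ (Pi.single 0 1)) = 0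
    rw [this, map_zero]
  have hv : Ideal.span (Set.range v) = ⊤ :=
    span_range_eq_top_of_apply_eq_one f v (Φ := Φ) (by rw [← hΦ, ← hFv]; rfl)
  obtain ⟨T, T', h1, h2, h3⟩ := DoubleRing.exists_matrix_mulVec_eq_single hcan c hv
  have hs : ∀ M : Matrix (Fin (n + 1)) (Fin (n + 1)) A, s ^ 2 • M = 0 → s • M = 0 := by
    intro M hM
    ext i j
    exact hann _ (congrFun (congrFun hM i) j)
  have key : ∀ U V : Matrix (Fin (n + 1)) (Fin (n + 1)) A,
      s ^ 2 • (U + V + s ^ 2 • (U * V)) = 0 → ∀ z,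
      s • (U.mulVecLin z + V.mulVecLin z + s ^ 2 • U.mulVecLin (V.mulVecLin z)) = 0 := by
    intro U V h z
    have := congrArg (fun M => Matrix.mulVec M z) (hs _ h)
    simpa [Matrix.smul_mulVec, Matrix.add_mulVec, Matrix.mulVec_mulVec] using this
  obtain ⟨θ, hθ⟩ := exists_equiv_apply_eq hGF (key T T' h1) (key T' T h2)
  refine ⟨θ, ?_⟩
  rw [← hFv, hθ, ← hFe, ← h3, Matrix.add_mulVec, Matrix.one_mulVec, Matrix.smul_mulVec]
  rfl

/-- Cancellation for a projective module `P` of rank `n` over an affine algebra of dimension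
`n + 1` over the algebraic closure of a finite field, if `P` becomes free after inverting `s` and
free modules of rank `n` over `A[X] / (X² - s²X)` are cancellative. -/
theorem IsCancellative.of_doubleRing {p : ℕ} [Fact p.Prime] {k : Type} [Field k] [IsAlgClosed k]
    [Algebra (ZMod p) k] [Algebra.IsAlgebraic (ZMod p) k] {n : ℕ} (hn : 3 ≤ n)
    {A P : Type} [CommRing A] [Algebra k A] [Algebra.FiniteType k A] (hdim : ringKrullDim A = n + 1)
    [AddCommGroup P] [Module A P] [Module.Finite A P] [Module.Projective A P]
    (hrank : HasRank A P n) {s : A} {q : Fin n → P} {φ : Fin n → (P →ₗ[A] A)}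
    (hdiag : ∀ i j, φ i (q j) = if i = j then s else 0)
    (hspan : ∀ x : P, s • x ∈ Submodule.span A (Set.range q))
    (hnzd : Ideal.Quotient.mk (nilradical A) s ∈ nonZeroDivisors (A ⧸ nilradical A))
    (hann : ∀ a, s ^ 2 * a = 0 → s * a = 0)
    (hcan : IsCancellative (DoubleRing A (s ^ 2)) (Fin n → DoubleRing A (s ^ 2))) :
    IsCancellative A P := by
  have hsmin : ∀ 𝔭 ∈ minimalPrimes A, s ^ 3 ∉ 𝔭 := by
    intro 𝔭 h𝔭 h
    have h1 : s ∈ ⋃ 𝔮 ∈ (⊥ : Ideal A).minimalPrimes, (𝔮 : Set A) :=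
      Set.mem_biUnion h𝔭 (h𝔭.1.1.mem_of_pow_mem _ h)
    rw [Ideal.iUnion_minimalPrimes] at h1
    obtain ⟨y, hy, hys⟩ := h1
    refine hy ((Ideal.Quotient.eq_zero_iff_mem (I := nilradical A)).1 (hnzd.1 _ ?_))
    rw [← map_mul]
    exact Ideal.Quotient.eq_zero_iff_mem.2 hys
  let f : (Fin n → A) →ₗ[A] P := Fintype.linearCombination A q
  let g : P →ₗ[A] (Fin n → A) := LinearMap.pi φ
  have hgf : ∀ y, g (f y) = s • y := fun y => by
    ext i
    simp [f, g, Fintype.linearCombination_apply, hdiag, mul_comm]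
  have hf : ∀ x, s • x ∈ LinearMap.range f := fun x => by
    rw [Fintype.range_linearCombination]
    exact hspan x
  have htrans : ∀ x : A × P, (∃ Φ : A × P →ₗ[A] A, Φ x = 1) →
      ∃ θ : (A × P) ≃ₗ[A] (A × P), θ x = (1, 0) := by
    rintro ⟨a, x⟩ hx
    obtain ⟨b, y, hrel⟩ := ELRel.exists_of_quotient_span_singleton (t := s ^ 3) (fun z hz => by
      refine ELRel.one_zero_of_ringKrullDim_le (p := p) (k := k) (n := n)
        (by omega) (fun 𝔭 => ?_) ?_ z hz
      · rw [Module.rankAtStalk_baseChange, hrank]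
      · have h1 := ringKrullDim_quotient_succ_le_of_notMem_minimalPrimes hsmin
        rwa [hdim, ENat.WithBot.add_le_add_one_right_iff] at h1) hx
    obtain ⟨θ₁, hθ₁⟩ := hrel.exists_equiv
    obtain ⟨θ₂, hθ₂⟩ := exists_equiv_apply_eq_one_zero hgf hf hann hcan b y
      (hrel.exists_unimodular hx)
    exact ⟨θ₁.trans θ₂, by rw [LinearEquiv.trans_apply, hθ₁, hθ₂]⟩
  refine IsCancellative.of_exists_equiv fun m => ?_
  cases m with
  | zero => exact exists_equiv_one_zero_of_equiv LinearEquiv.prodUnique.symm htrans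
  | succ m =>
    intro x hx
    refine (ELRel.one_zero_of_ringKrullDim_le (p := p) (k := k)
      (n := n + (m + 1)) (by omega) (fun 𝔭 => ?_) ?_ x hx).exists_equiv
    · have : Nontrivial A := 𝔭.nontrivial
      rw [Module.rankAtStalk_prod, Pi.add_apply, hrank, Module.rankAtStalk_eq_finrank_of_free]
      simp
    · rw [hdim]
      exact_mod_cast (by omega : n + 1 ≤ n + (m + 1))

theorem statement3
    (p : ℕ) [Fact p.Prime]
    (A : Type) [CommRing A] [Algebra (AlgebraicClosure (ZMod p)) A]
    [Algebra.FiniteType (AlgebraicClosure (ZMod p)) A]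
    (d : ℕ) (hd : 4 ≤ d) (hdim : ringKrullDim A = d)
    (P : Type) [AddCommGroup P] [Module A P] [Module.Finite A P] [Module.Projective A P]
    (hrank : HasRank A P (d - 1)) (s : A)
    -- (i) `P_s` is free over `A_s`
    (hfree : Module.Free (Localization.Away s)
      (LocalizedModule (Submonoid.powers s) P))
    -- (ii) `φ i (q j) = δ_{ij} • s`
    (q : Fin (d - 1) → P) (φ : Fin (d - 1) → (P →ₗ[A] A))
    (hdiag : ∀ i j, φ i (q j) = if i = j then s else 0)
    -- (iii) `sP ⊆ q_1 A + … + q_{d-1} A`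
    (hspan : ∀ x : P, s • x ∈ Submodule.span A (Set.range q))
    -- (iv) the image of `s` in `A_red` is a non-zero-divisor
    (hnzd : (Ideal.Quotient.mk (nilradical A) s) ∈ nonZeroDivisors (A ⧸ nilradical A))
    -- (v) `(0 : sA) = (0 : s²A)`
    (hann : {a : A | s * a = 0} = {a : A | s ^ 2 * a = 0})
    -- the free module of rank `d - 1` over `R = A[X]/(X² - s²X)` is cancellative
    (hcan : IsCancellative (A[X] ⧸ Ideal.span {(X : A[X]) ^ 2 - C (s ^ 2) * X})
      (Fin (d - 1) → A[X] ⧸ Ideal.span {(X : A[X]) ^ 2 - C (s ^ 2) * X})) :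
    IsCancellative A P := by
  refine IsCancellative.of_doubleRing (p := p) (k := AlgebraicClosure (ZMod p)) (n := d - 1)
    (by omega) ?_ hrank hdiag hspan hnzd (fun a ha => ?_) hcan
  · rw [hdim]
    exact_mod_cast (by omega : d = d - 1 + 1)
  · have : a ∈ {a : A | s * a = 0} := by
      rw [hann]
      exact ha
    exact this
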